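/- arXiv:1110.6331 — 2 statements merged into one kernel-verified Lean document; each statement's English description precedes it below -/
import Mathlib

section
/- With the notation of the context, let α ∈ 𝓞_K be totally positive with α ≡ 1 (mod 8𝓞_K) and with the ideals (α) and (σα) coprime, set 𝔞 = (α), and let β = (α + σα)/2, which lies in 𝓞_L. Then spin(σ, 𝔞) = (β/𝔇)_L, the quadratic residue symbol in L of β modulo the relative discriminant 𝔇. -/
set_option synthInstance.maxHeartbeats 1000000
set_option maxHeartbeats 2000000

open NumberField
open scoped Classical

attribute [local instance] FractionRing.liftAlgebra

noncomputable section

variable {K : Type*} [Field K] [NumberField K]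

/-- The quadratic residue symbol `(α/𝔭)` modulo a prime ideal `𝔭` of the ring of
integers: `1` if `α` is a nonzero square modulo `𝔭`, `-1` if it is a nonzero
non-square, and `0` if `α ∈ 𝔭`. -/
def legSym (𝔭 : Ideal (𝓞 K)) (α : 𝓞 K) : ℤ :=
  if Ideal.Quotient.mk 𝔭 α = 0 then 0
  else if IsSquare (Ideal.Quotient.mk 𝔭 α) then 1 else -1

/-- The quadratic residue symbol `(α/𝔟)` for an ideal `𝔟`, extended multiplicatively over
the prime factorization of `𝔟` (with multiplicity). -/
def quadSym (𝔟 : Ideal (𝓞 K)) (α : 𝓞 K) : ℤ :=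
  ((UniqueFactorizationMonoid.normalizedFactors 𝔟).map (fun 𝔭 => legSym 𝔭 α)).prod

/-- An element of `𝓞 K` is totally positive if it is positive under every real embedding. -/
def TotPos (α : 𝓞 K) : Prop := ∀ v : K →+* ℝ, 0 < v (α : K)

/-- The image of an ideal under a field automorphism. -/
def galMap (σ : K ≃ₐ[ℚ] K) (𝔞 : Ideal (𝓞 K)) : Ideal (𝓞 K) :=
  Ideal.map (RingOfIntegers.mapRingHom (σ : K →+* K)) 𝔞

/-- The spin `spin(σ,𝔞) = (α/σ𝔞)` of a principal ideal `𝔞` having a totally positive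
generator `α`; under the standing hypotheses this is independent of the chosen totally
positive generator. -/
def spin (σ : K ≃ₐ[ℚ] K) (𝔞 : Ideal (𝓞 K)) : ℤ :=
  if h : ∃ α : 𝓞 K, Ideal.span {α} = 𝔞 ∧ TotPos α then
    quadSym (galMap σ 𝔞) h.choose
  else 0

/-- An ideal of the ring of integers is odd if it is coprime to `2`. -/
def OddIdeal (𝔞 : Ideal (𝓞 K)) : Prop := IsCoprime 𝔞 (Ideal.span {(2 : 𝓞 K)})

/-- The relative discriminant of `K/L`: the relative norm from `K` to `L` of the
different ideal of `𝓞 K` over `𝓞 L`. -/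
def relDiscr (L : Type*) [Field L] [NumberField L] (K : Type*) [Field K] [NumberField K]
    [Algebra L K] : Ideal (𝓞 L) :=
  Ideal.span ((Algebra.intNorm (𝓞 L) (𝓞 K)) '' (differentIdeal (𝓞 L) (𝓞 K) : Set (𝓞 K)))

set_option linter.unusedSectionVars false

section Mean

variable {A B C : Type*} [AddCommGroup A] [AddCommGroup B] [AddCommGroup C]

/-- A function on an abelian group that is invariant under a subgroup of finite index. -/
def AlmostPeriodic (f : A → ℂ) : Prop :=
  ∃ H : AddSubgroup A, H.FiniteIndex ∧ ∀ x, ∀ y ∈ H, f (x + y) = f x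

/-- The mean value of a function that is invariant under a subgroup of finite index. -/
def mean (f : A → ℂ) : ℂ :=
  if h : AlmostPeriodic f then
    (∑ᶠ x : A ⧸ h.choose, f x.out) / Nat.card (A ⧸ h.choose)
  else 0

lemma sum_comp_surjective_div_card {F G : Type*} [AddCommGroup F] [AddCommGroup G] [Fintype F]
    [Fintype G] (p : F →+ G) (hp : Function.Surjective p) (g : G → ℂ) :
    (∑ x, g (p x)) / Nat.card F = (∑ y, g y) / Nat.card G := by
  have hfib : ∀ y : G, Fintype.card {x // p x = y} = Nat.card p.ker := by
    intro y
    obtain ⟨x₀, rfl⟩ := hp y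
    rw [← Nat.card_eq_fintype_card]
    refine Nat.card_congr
      { toFun := fun x => ⟨x.1 - x₀, by simp [AddMonoidHom.mem_ker, x.2]⟩
        invFun := fun k => ⟨k.1 + x₀, by simp [(AddMonoidHom.mem_ker).1 k.2]⟩
        left_inv := fun x => by simp
        right_inv := fun k => by simp }
  have h1 : (∑ x, g (p x)) = Nat.card p.ker * ∑ y, g y := by
    rw [← Fintype.sum_fiberwise p, Finset.mul_sum]
    refine Finset.sum_congr rfl fun y _ => ?_
    rw [Finset.sum_congr rfl (fun (x : {x // p x = y}) _ => by rw [x.2]), Finset.sum_const,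
      Finset.card_univ, hfib, nsmul_eq_mul]
  have h2 : Nat.card F = Nat.card p.ker * Nat.card G := by
    rw [Nat.card_eq_fintype_card, ← Finset.card_univ,
      Finset.card_eq_sum_card_fiberwise (f := p) (t := Finset.univ) (by simp), Nat.card_eq_fintype_card (α := G),
      ← Finset.card_univ (α := G), mul_comm, ← smul_eq_mul, ← Finset.sum_const]
    refine Finset.sum_congr rfl fun y _ => ?_
    rw [← hfib y, Fintype.card_subtype]
  have h3 : (Nat.card p.ker : ℂ) ≠ 0 := Nat.cast_ne_zero.2 Nat.card_pos.ne'
  rw [h1, h2]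
  push_cast
  rw [mul_div_mul_left _ _ h3]

lemma AlmostPeriodic.of_factor {F : Type*} [AddCommGroup F] [Finite F] (π : A →+ F)
    {f : A → ℂ} {g : F → ℂ} (hf : ∀ x, f x = g (π x)) : AlmostPeriodic f := by
  refine ⟨π.ker, ?_, fun x y hy => by rw [hf, hf, map_add, (AddMonoidHom.mem_ker).1 hy, add_zero]⟩
  exact AddSubgroup.finiteIndex_ker π

lemma mean_eq_of_factor {F : Type*} [AddCommGroup F] [Fintype F] (π : A →+ F)
    (hπ : Function.Surjective π) {f : A → ℂ} {g : F → ℂ} (hf : ∀ x, f x = g (π x)) :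
    mean f = (∑ y, g y) / Nat.card F := by
  have h : AlmostPeriodic f := .of_factor π hf
  rw [mean, dif_pos h]
  set H := h.choose with hH
  have hfi : H.FiniteIndex := h.choose_spec.1
  have hper := h.choose_spec.2
  have hK : π.ker.FiniteIndex := AddSubgroup.finiteIndex_ker π
  have hHK : (H ⊓ π.ker).FiniteIndex := inferInstance
  have : Finite (A ⧸ H) := AddSubgroup.finite_quotient_of_finiteIndex
  have : Finite (A ⧸ H ⊓ π.ker) := AddSubgroup.finite_quotient_of_finiteIndex
  let _ := Fintype.ofFinite (A ⧸ H)
  let _ := Fintype.ofFinite (A ⧸ H ⊓ π.ker)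
  let p : A ⧸ H ⊓ π.ker →+ A ⧸ H := QuotientAddGroup.map _ _ (AddMonoidHom.id A) (fun x hx => hx.1)
  let q : A ⧸ H ⊓ π.ker →+ F := QuotientAddGroup.lift _ π (fun x hx => hx.2)
  have hp : Function.Surjective p := by
    intro y
    obtain ⟨x, rfl⟩ := QuotientAddGroup.mk_surjective y
    exact ⟨(x : A ⧸ H ⊓ π.ker), rfl⟩
  have hq : Function.Surjective q := by
    intro y
    obtain ⟨x, rfl⟩ := hπ y
    exact ⟨(x : A ⧸ H ⊓ π.ker), rfl⟩
  have hout : ∀ x : A, f ((x : A ⧸ H).out) = f x := by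
    intro x
    obtain ⟨h', hh'⟩ := QuotientAddGroup.mk_out_eq_add H x
    rw [hh', hper _ _ h'.2]
  rw [finsum_eq_sum_of_fintype, ← sum_comp_surjective_div_card p hp (fun x => f x.out),
    ← sum_comp_surjective_div_card q hq g]
  congr 1
  refine Finset.sum_congr rfl fun y _ => ?_
  obtain ⟨x, rfl⟩ := QuotientAddGroup.mk_surjective y
  exact (hout x).trans (hf x)

/-- Almost periodic functions are those which factor through a finite quotient. -/
lemma AlmostPeriodic.exists_factor {f : A → ℂ} (h : AlmostPeriodic f) :
    ∃ H : AddSubgroup A, ∃ _ : Finite (A ⧸ H), ∃ g : A ⧸ H → ℂ,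
      ∀ x, f x = g (QuotientAddGroup.mk' H x) := by
  obtain ⟨H, hH, hper⟩ := h
  refine ⟨H, AddSubgroup.finite_quotient_of_finiteIndex, fun x => f x.out, fun x => ?_⟩
  obtain ⟨h', hh'⟩ := QuotientAddGroup.mk_out_eq_add H x
  simp only [QuotientAddGroup.mk'_apply]
  rw [hh', hper _ _ h'.2]

lemma AlmostPeriodic.comp {f : B → ℂ} (h : AlmostPeriodic f) (φ : A →+ B) :
    AlmostPeriodic (fun x => f (φ x)) := by
  obtain ⟨H, _, g, hg⟩ := h.exists_factor
  exact .of_factor ((QuotientAddGroup.mk' H).comp φ) (fun x => hg (φ x))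

lemma mean_comp_surjective {f : B → ℂ} (h : AlmostPeriodic f) (φ : A →+ B)
    (hφ : Function.Surjective φ) : mean (fun x => f (φ x)) = mean f := by
  obtain ⟨H, _, g, hg⟩ := h.exists_factor
  let _ := Fintype.ofFinite (B ⧸ H)
  rw [mean_eq_of_factor _ (QuotientAddGroup.mk'_surjective H) hg]
  exact mean_eq_of_factor ((QuotientAddGroup.mk' H).comp φ)
    ((QuotientAddGroup.mk'_surjective H).comp hφ) (fun x => hg (φ x))

lemma mean_const (c : ℂ) : mean (fun _ : A => c) = c := by
  rw [mean_eq_of_factor (0 : A →+ Unit) (fun _ => ⟨0, rfl⟩) (g := fun _ => c) (fun _ => rfl)]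
  simp

lemma mean_const_mul {f : A → ℂ} (h : AlmostPeriodic f) (c : ℂ) :
    mean (fun x => c * f x) = c * mean f := by
  obtain ⟨H, _, g, hg⟩ := h.exists_factor
  let _ := Fintype.ofFinite (A ⧸ H)
  rw [mean_eq_of_factor _ (QuotientAddGroup.mk'_surjective H) hg,
    mean_eq_of_factor _ (QuotientAddGroup.mk'_surjective H) (g := fun x => c * g x)
      (fun x => by rw [hg]), ← Finset.mul_sum, mul_div_assoc]

lemma mean_conj {f : A → ℂ} (h : AlmostPeriodic f) :
    mean (fun x => starRingEnd ℂ (f x)) = starRingEnd ℂ (mean f) := by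
  obtain ⟨H, _, g, hg⟩ := h.exists_factor
  let _ := Fintype.ofFinite (A ⧸ H)
  rw [mean_eq_of_factor _ (QuotientAddGroup.mk'_surjective H) hg,
    mean_eq_of_factor _ (QuotientAddGroup.mk'_surjective H) (g := fun x => starRingEnd ℂ (g x))
      (fun x => by rw [hg]), map_div₀, map_sum, map_natCast]

lemma mean_translate {f : A → ℂ} (h : AlmostPeriodic f) (y : A) :
    mean (fun x => f (x + y)) = mean f := by
  obtain ⟨H, _, g, hg⟩ := h.exists_factor
  let _ := Fintype.ofFinite (A ⧸ H)
  rw [mean_eq_of_factor _ (QuotientAddGroup.mk'_surjective H) hg,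
    mean_eq_of_factor _ (QuotientAddGroup.mk'_surjective H)
      (g := fun x => g (x + QuotientAddGroup.mk' H y))
      (fun x => by rw [hg, map_add])]
  congr 1
  exact Fintype.sum_equiv (Equiv.addRight _) _ _ (fun x => rfl)

/-- The mean of a nontrivial character vanishes. -/
lemma mean_char_eq_zero {χ : A → ℂ} (h : AlmostPeriodic χ) (hχ : ∀ x y, χ (x + y) = χ x * χ y)
    {y : A} (hy : χ y ≠ 1) : mean χ = 0 := by
  have h1 := mean_translate h y
  have h2 : (fun x => χ (x + y)) = fun x => χ y * χ x := by
    funext x; rw [hχ, mul_comm]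
  rw [h2, mean_const_mul h] at h1
  have h3 : (χ y - 1) * mean χ = 0 := by rw [sub_mul, h1, one_mul, sub_self]
  exact (mul_eq_zero.1 h3).resolve_left (sub_ne_zero.2 hy)

/-- Fubini for means over a product. -/
lemma mean_prod {f : A × B → ℂ} (h : AlmostPeriodic f) :
    mean f = mean (fun x => mean (fun y => f (x, y))) := by
  obtain ⟨H, hH, hper⟩ := h
  have : Finite ((A × B) ⧸ H) := AddSubgroup.finite_quotient_of_finiteIndex
  let H₁ := ((QuotientAddGroup.mk' H).comp (AddMonoidHom.inl A B)).ker
  let H₂ := ((QuotientAddGroup.mk' H).comp (AddMonoidHom.inr A B)).ker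
  have hf₁ : H₁.FiniteIndex := AddSubgroup.finiteIndex_ker _
  have hf₂ : H₂.FiniteIndex := AddSubgroup.finiteIndex_ker _
  have : Finite (A ⧸ H₁) := AddSubgroup.finite_quotient_of_finiteIndex
  have : Finite (B ⧸ H₂) := AddSubgroup.finite_quotient_of_finiteIndex
  let _ := Fintype.ofFinite (A ⧸ H₁)
  let _ := Fintype.ofFinite (B ⧸ H₂)
  let g : (A ⧸ H₁) × (B ⧸ H₂) → ℂ := fun z => f (z.1.out, z.2.out)
  have hg : ∀ x y, f (x, y) = g (x, y) := by
    intro x y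
    obtain ⟨a, ha⟩ := QuotientAddGroup.mk_out_eq_add H₁ x
    obtain ⟨b, hb⟩ := QuotientAddGroup.mk_out_eq_add H₂ y
    have ha' : ((a : A), (0 : B)) ∈ H := (QuotientAddGroup.eq_zero_iff _).1 a.2
    have hb' : ((0 : A), (b : B)) ∈ H := (QuotientAddGroup.eq_zero_iff _).1 b.2
    have := hper (x, y) _ (H.add_mem ha' hb')
    simp only [g]
    rw [ha, hb, ← this]
    simp
  rw [mean_eq_of_factor ((QuotientAddGroup.mk' H₁).prodMap (QuotientAddGroup.mk' H₂))
    (Function.Surjective.prodMap (QuotientAddGroup.mk'_surjective H₁)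
      (QuotientAddGroup.mk'_surjective H₂)) (g := g) (fun z => hg z.1 z.2)]
  rw [mean_eq_of_factor (QuotientAddGroup.mk' H₁) (QuotientAddGroup.mk'_surjective H₁)
    (g := fun x => (∑ y, g (x, y)) / Nat.card (B ⧸ H₂))
    (fun x => mean_eq_of_factor (QuotientAddGroup.mk' H₂) (QuotientAddGroup.mk'_surjective H₂)
      (fun y => hg x y))]
  rw [← Finset.sum_div, Nat.card_prod, Fintype.sum_prod_type, div_div]
  push_cast
  rw [mul_comm (Nat.card (A ⧸ H₁) : ℂ)]

lemma AlmostPeriodic.prod_mul {f : A → ℂ} {g : B → ℂ} (hf : AlmostPeriodic f)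
    (hg : AlmostPeriodic g) : AlmostPeriodic (fun z : A × B => f z.1 * g z.2) := by
  obtain ⟨H, _, f', hf'⟩ := hf.exists_factor
  obtain ⟨J, _, g', hg'⟩ := hg.exists_factor
  exact .of_factor ((QuotientAddGroup.mk' H).prodMap (QuotientAddGroup.mk' J))
    (g := fun z => f' z.1 * g' z.2) (fun z => by rw [hf', hg']; rfl)

lemma mean_prod_mul {f : A → ℂ} {g : B → ℂ} (hf : AlmostPeriodic f)
    (hg : AlmostPeriodic g) :
    mean (fun z : A × B => f z.1 * g z.2) = mean f * mean g := by
  rw [mean_prod (hf.prod_mul hg)]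
  simp only [mean_const_mul hg]
  simp only [mul_comm _ (mean g)]
  rw [mean_const_mul hf]

/-- A function decomposing as a product along a surjection from a product. -/
lemma mean_eq_mul {h : C → ℂ} {f : A → ℂ} {g : B → ℂ} (hh : AlmostPeriodic h)
    (hf : AlmostPeriodic f) (hg : AlmostPeriodic g) (φ : A × B →+ C)
    (hφ : Function.Surjective φ) (H : ∀ x y, h (φ (x, y)) = f x * g y) :
    mean h = mean f * mean g := by
  rw [← mean_comp_surjective hh φ hφ, ← mean_prod_mul hf hg]
  congr 1
  funext z
  exact H z.1 z.2

lemma mean_pi {ι : Type*} [Fintype ι] {f : ι → ℤ → ℂ} (N : ι → ℕ) [∀ i, NeZero (N i)]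
    (g : ∀ i, ZMod (N i) → ℂ) (hg : ∀ i (x : ℤ), f i x = g i x) :
    mean (fun z : ι → ℤ => ∏ i, f i (z i)) = ∏ i, mean (f i) := by
  have h1 : ∀ i, mean (f i) = (∑ y, g i y) / Nat.card (ZMod (N i)) := fun i =>
    mean_eq_of_factor (Int.castAddHom (ZMod (N i))) (ZMod.intCast_surjective) (hg i)
  let π : (ι → ℤ) →+ (∀ i, ZMod (N i)) :=
    { toFun := fun z i => (z i : ZMod (N i))
      map_zero' := by ext; simp
      map_add' := fun x y => by ext; simp }
  have hπ : Function.Surjective π := fun y =>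
    ⟨fun i => (ZMod.intCast_surjective (y i)).choose,
      funext fun i => (ZMod.intCast_surjective (y i)).choose_spec⟩
  rw [mean_eq_of_factor π hπ (g := fun y => ∏ i, g i (y i))
    (fun x => Finset.prod_congr rfl fun i _ => hg i (x i))]
  simp only [h1, Finset.prod_div_distrib]
  rw [Fintype.prod_sum, Nat.card_pi]
  push_cast
  rfl

/-- Restricting a mean to a subgroup `S` of finite index, given as the image of `B`. -/
lemma exists_mean_indicator (ι : B →+ A) (hfin : ι.range.FiniteIndex) :
    ∃ r : ℝ, 0 < r ∧ ∀ f : A → ℂ, AlmostPeriodic f →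
      mean (fun x => if x ∈ ι.range then f x else 0) = r * mean (fun y => f (ι y)) := by
  refine ⟨(ι.range.index : ℝ)⁻¹, inv_pos.2 (Nat.cast_pos.2 (Nat.pos_of_ne_zero hfin.index_ne_zero)),
    fun f hf => ?_⟩
  obtain ⟨H₀, hH₀, hper₀⟩ := hf
  obtain ⟨H, hH, hHS, hper⟩ : ∃ H : AddSubgroup A, H.FiniteIndex ∧ H ≤ ι.range ∧
      ∀ x, ∀ y ∈ H, f (x + y) = f x :=
    ⟨H₀ ⊓ ι.range, inferInstance, inf_le_right, fun x y hy => hper₀ x y hy.1⟩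
  have : Finite (A ⧸ H) := AddSubgroup.finite_quotient_of_finiteIndex
  let _ := Fintype.ofFinite (A ⧸ H)
  let p := QuotientAddGroup.mk' H
  let g : A ⧸ H → ℂ := fun x => f x.out
  have hg : ∀ x, f x = g (p x) := by
    intro x
    obtain ⟨h', hh'⟩ := QuotientAddGroup.mk_out_eq_add H x
    simp only [g, p, QuotientAddGroup.mk'_apply]
    rw [hh', hper _ _ h'.2]
  let S := ι.range.map p
  have hS : ∀ x, p x ∈ S ↔ x ∈ ι.range := by
    intro x
    constructor
    · rintro ⟨y, hy, hxy⟩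
      have : -y + x ∈ H := QuotientAddGroup.eq.1 hxy
      have h2 := ι.range.add_mem hy (hHS this)
      simpa using h2
    · exact fun h => ⟨x, h, rfl⟩
  rw [mean_eq_of_factor p (QuotientAddGroup.mk'_surjective H)
    (g := fun x => if x ∈ S then g x else 0) (fun x => by simp only [hS, hg])]
  let q : B →+ S := (p.comp ι).codRestrict S (fun y => ⟨ι y, ⟨y, rfl⟩, rfl⟩)
  have hq : Function.Surjective q := by
    rintro ⟨_, _, ⟨y, rfl⟩, rfl⟩
    exact ⟨y, rfl⟩
  rw [mean_eq_of_factor q hq (g := fun x => g x) (fun y => hg (ι y))]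
  have hcard : Nat.card (A ⧸ H) = Nat.card S * ι.range.index := by
    have h1 : S.index = ι.range.index := by
      have := AddSubgroup.index_comap_of_surjective S (QuotientAddGroup.mk'_surjective H)
      rw [← this]
      congr 1
      ext x
      exact hS x
    rw [← h1, AddSubgroup.card_mul_index]
  rw [hcard, ← Finset.sum_filter, ← Finset.sum_subtype_eq_sum_filter]
  push_cast
  have e : ∑ x ∈ Finset.subtype (fun x => x ∈ S) Finset.univ, g x = ∑ x : S, g x := by
    refine Finset.sum_congr ?_ fun _ _ => rfl
    ext; simp
  rw [e]
  field_simp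

end Mean

section Theta

open Complex Filter Topology

/-- The additive character `x ↦ exp (2πix)` on `ℚ`. -/
def eQ (x : ℚ) : ℂ := cexp (2 * Real.pi * I * x)

lemma eQ_add (x y : ℚ) : eQ (x + y) = eQ x * eQ y := by
  rw [eQ, eQ, eQ, ← Complex.exp_add]; push_cast; ring_nf

lemma eQ_eq_one_iff (x : ℚ) : eQ x = 1 ↔ ∃ n : ℤ, x = n := by
  rw [eQ, Complex.exp_eq_one_iff]
  refine exists_congr fun n => ?_
  rw [mul_comm (n : ℂ)]
  have : (2 * Real.pi * I : ℂ) ≠ 0 := Complex.two_pi_I_ne_zero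
  rw [mul_right_inj' this]
  exact_mod_cast Iff.rfl

lemma eQ_int (n : ℤ) : eQ n = 1 := (eQ_eq_one_iff _).2 ⟨n, rfl⟩

lemma conj_eQ (x : ℚ) : starRingEnd ℂ (eQ x) = eQ (-x) := by
  rw [eQ, eQ, ← Complex.exp_conj]
  congr 1
  simp [Complex.conj_ofNat]

lemma tendsto_jacobiTheta₂_imaginary (z : ℝ) :
    Tendsto (fun T : ℝ => jacobiTheta₂ z (I * T)) atTop (𝓝 1) := by
  have h1 : ∑' n : ℤ, (if n = 0 then (1 : ℂ) else 0) = 1 := by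
    rw [tsum_ite_eq]
  rw [← h1]
  unfold jacobiTheta₂
  have hnorm : ∀ (n : ℤ) (T : ℝ), ‖jacobiTheta₂_term n z (I * T)‖ = Real.exp (-Real.pi * n ^ 2 * T) := by
    intro n T
    rw [norm_jacobiTheta₂_term]
    simp
  refine tendsto_tsum_of_dominated_convergence
    (bound := fun n : ℤ => ‖jacobiTheta₂_term n z (I * (1 : ℝ))‖) ?_ ?_ ?_
  · refine ((summable_jacobiTheta₂_term_iff z _).2 ?_).norm
    simp
  · intro n
    split_ifs with hn
    · subst hn
      simp [jacobiTheta₂_term]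
    · rw [tendsto_zero_iff_norm_tendsto_zero]
      simp only [hnorm]
      refine Real.tendsto_exp_atBot.comp ?_
      refine Tendsto.const_mul_atTop_of_neg ?_ tendsto_id
      have : (0 : ℝ) < (n : ℝ) ^ 2 := by positivity
      have := Real.pi_pos
      nlinarith
  · filter_upwards [eventually_ge_atTop 1] with T hT n
    rw [hnorm, hnorm]
    apply Real.exp_le_exp.2
    have : 0 ≤ Real.pi * (n : ℝ) ^ 2 := by positivity
    nlinarith

lemma sqrt_mul_tsum_residue (N : ℕ) (hN : 0 < N) (k : ℤ) {ε : ℝ} (hε : 0 < ε) :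
    (√ε : ℂ) * ∑' n : ℤ, cexp (-Real.pi * ε * (n * N + k) ^ 2) =
      (1 / N) * jacobiTheta₂ ((-(k : ℝ) / N : ℝ)) (I * ((1 / (N ^ 2 * ε) : ℝ) : ℂ)) := by
  have hNr : (0 : ℝ) < N := by exact_mod_cast hN
  have hNc : (N : ℂ) ≠ 0 := by exact_mod_cast hN.ne'
  have hεc : (ε : ℂ) ≠ 0 := by exact_mod_cast hε.ne'
  have hs : (√ε : ℂ) ≠ 0 := by exact_mod_cast (Real.sqrt_pos.2 hε).ne'
  have hs2 : (√ε : ℂ) ^ 2 = ε := by exact_mod_cast Real.sq_sqrt hε.le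
  rw [jacobiTheta₂_functional_equation]
  have e1 : (-I * (I * ((1 / (N ^ 2 * ε) : ℝ) : ℂ))) = ((1 / (N ^ 2 * ε) : ℝ) : ℂ) := by
    rw [← mul_assoc, neg_mul, I_mul_I]; ring
  have e2 : (1 / (N ^ 2 * ε) : ℝ) = (1 / (N * √ε)) ^ 2 := by
    rw [div_pow, mul_pow, Real.sq_sqrt hε.le]; simp
  have e3 : (((1 / (N ^ 2 * ε) : ℝ) : ℂ)) ^ (1 / 2 : ℂ) = 1 / (N * √ε) := by
    have : (0:ℝ) ≤ 1 / (N * √ε) := by positivity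
    rw [e2, show (1 / 2 : ℂ) = ((1 / 2 : ℝ) : ℂ) by push_cast; rfl, ← ofReal_cpow (by positivity),
      ← Real.sqrt_eq_rpow, Real.sqrt_sq this]
    push_cast; rfl
  rw [e1, e3, jacobiTheta₂, one_div_one_div, mul_assoc, ← mul_assoc (1 / (N : ℂ)),
    show (1 / (N : ℂ)) * (N * √ε) = √ε by field_simp]
  congr 1
  rw [← tsum_mul_left]
  refine tsum_congr fun n => ?_
  rw [jacobiTheta₂_term, ← Complex.exp_add]
  congr 1
  push_cast
  field_simp
  linear_combination (-(2 * n * N * k  : ℂ) - n ^ 2 * N ^ 2 - k ^ 2 + (n * N + k) ^ 2) * I_sq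

lemma jacobiTheta_eq_sum_residue (N : ℕ) [NeZero N] (hN2 : Even N) {ε : ℝ} (hε : 0 < ε) :
    jacobiTheta (1 / N + I * ε) =
      ∑ k : Fin N, cexp (Real.pi * I * (k : ℕ) ^ 2 / N) *
        ∑' n : ℤ, cexp (-Real.pi * ε * (n * N + ((k : ℕ) : ℤ)) ^ 2) := by
  have hNc : (N : ℂ) ≠ 0 := by exact_mod_cast NeZero.ne N
  have him : 0 < (1 / N + I * ε : ℂ).im := by
    have : (1 / N : ℂ).im = 0 := by
      rw [show (1 / N : ℂ) = ((1 / N : ℝ) : ℂ) by push_cast; rfl, ofReal_im]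
    simp only [add_im, this, zero_add, mul_im, I_re, I_im, ofReal_re, ofReal_im]
    simpa using hε
  have hsum : Summable fun n : ℤ => cexp (Real.pi * I * (n : ℂ) ^ 2 * (1 / N + I * ε)) := by
    have := (summable_jacobiTheta₂_term_iff 0 _).2 him
    refine this.congr fun n => ?_
    simp [jacobiTheta₂_term]
  obtain ⟨A, hA⟩ := hN2
  have hNA : (N : ℂ) = 2 * A := by rw [hA]; push_cast; ring
  have key : ∀ (k : Fin N) (n : ℤ),
      cexp (Real.pi * I * (((Int.divModEquiv N).symm (n, k) : ℤ) : ℂ) ^ 2 * (1 / N + I * ε)) =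
      cexp (Real.pi * I * (k : ℕ) ^ 2 / N) * cexp (-Real.pi * ε * (n * N + ((k : ℕ) : ℤ)) ^ 2) := by
    intro k n
    rw [Int.divModEquiv_symm_apply, ← Complex.exp_add, Complex.exp_eq_exp_iff_exists_int]
    refine ⟨A * n ^ 2 + n * k, ?_⟩
    push_cast
    have hA0 : (A : ℂ) ≠ 0 := fun h => hNc (by rw [hNA, h, mul_zero])
    rw [hNA]
    field_simp
    linear_combination (2 * A * ε * (n * (2 * A) + k) ^ 2) * I_sq
  rw [jacobiTheta, ← (Int.divModEquiv N).symm.tsum_eq, ← (Equiv.prodComm _ _).tsum_eq]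
  have hs2 : Summable fun p : Fin N × ℤ => cexp (Real.pi * I *
      (((Int.divModEquiv N).symm ((Equiv.prodComm (Fin N) ℤ) p) : ℤ) : ℂ) ^ 2 * (1 / N + I * ε)) :=
    ((Equiv.summable_iff (Equiv.prodComm (Fin N) ℤ)).2
      ((Equiv.summable_iff (Int.divModEquiv N).symm).2 hsum))
  rw [hs2.tsum_prod, tsum_fintype]
  refine Finset.sum_congr rfl fun k _ => ?_
  rw [← tsum_mul_left]
  exact tsum_congr fun n => key k n

lemma tendsto_sqrt_mul_jacobiTheta (N : ℕ) [NeZero N] (hN2 : Even N) :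
    Tendsto (fun ε : ℝ => (√ε : ℂ) * jacobiTheta (1 / N + I * ε)) (𝓝[>] 0)
      (𝓝 ((∑ k : Fin N, cexp (Real.pi * I * (k : ℕ) ^ 2 / N)) / N)) := by
  have hN : 0 < N := Nat.pos_of_neZero N
  have hNr : (0 : ℝ) < N := by exact_mod_cast hN
  have h1 : ∀ k : Fin N, Tendsto (fun ε : ℝ => cexp (Real.pi * I * (k : ℕ) ^ 2 / N) *
      ((1 / N) * jacobiTheta₂ ((-(((k : ℕ) : ℤ) : ℝ) / N : ℝ)) (I * ((1 / (N ^ 2 * ε) : ℝ) : ℂ))))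
      (𝓝[>] 0) (𝓝 (cexp (Real.pi * I * (k : ℕ) ^ 2 / N) * ((1 / N) * 1))) := by
    intro k
    refine ((Tendsto.const_mul _ ?_)).const_mul _
    refine (tendsto_jacobiTheta₂_imaginary _).comp ?_
    have : Tendsto (fun ε : ℝ => (1 / N ^ 2 : ℝ) * ε⁻¹) (𝓝[>] 0) atTop :=
      Tendsto.const_mul_atTop (by positivity) tendsto_inv_nhdsGT_zero
    refine this.congr fun ε => ?_
    rw [one_div, one_div, mul_inv]
  have h2 := tendsto_finsetSum (Finset.univ) (fun k _ => h1 k)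
  have e : ∑ k : Fin N, cexp (Real.pi * I * (k : ℕ) ^ 2 / N) * ((1 / N : ℂ) * 1) =
      (∑ k : Fin N, cexp (Real.pi * I * (k : ℕ) ^ 2 / N)) / N := by
    rw [← Finset.sum_mul]; ring
  rw [e] at h2
  refine h2.congr' ?_
  filter_upwards [self_mem_nhdsWithin] with ε hε
  rw [jacobiTheta_eq_sum_residue N hN2 hε, Finset.mul_sum]
  refine Finset.sum_congr rfl fun k _ => ?_
  rw [← sqrt_mul_tsum_residue N hN _ hε]
  push_cast
  ring

lemma jacobiTheta_two_mul_add (A : ℕ) (τ : ℂ) : jacobiTheta (2 * A + τ) = jacobiTheta τ := by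
  induction A with
  | zero => simp
  | succ A ih =>
    rw [← ih, ← jacobiTheta_two_add (2 * A + τ)]
    push_cast
    ring_nf

lemma ofReal_mul_cpow {r : ℝ} (hr : 0 < r) {z : ℂ} (hz : z ≠ 0) (s : ℂ) :
    ((r : ℂ) * z) ^ s = (r : ℂ) ^ s * z ^ s := by
  have hr' : (r : ℂ) ≠ 0 := by exact_mod_cast hr.ne'
  rw [cpow_def_of_ne_zero (mul_ne_zero hr' hz), cpow_def_of_ne_zero hr', cpow_def_of_ne_zero hz,
    Complex.log_ofReal_mul hr hz, ← Complex.exp_add, Complex.ofReal_log hr.le]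
  ring_nf

lemma jacobiTheta_inv (τ : ℂ) :
    jacobiTheta τ = 1 / (-I * τ) ^ (1 / 2 : ℂ) * jacobiTheta (-1 / τ) := by
  rw [jacobiTheta_eq_jacobiTheta₂, jacobiTheta_eq_jacobiTheta₂, jacobiTheta₂_functional_equation]
  simp

lemma sqrt_mul_jacobiTheta (A : ℕ) [NeZero A] {ε : ℝ} (hε : 0 < ε) :
    (√ε : ℂ) * jacobiTheta (1 / ((2 * A : ℕ) : ℂ) + I * ε) =
      1 / (-I * (1 / (2 * A) + I * ε)) ^ (1 / 2 : ℂ) *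
        (1 / (2 * A / (1 / (2 * A) + I * ε)) ^ (1 / 2 : ℂ) *
          jacobiTheta (-1 / (2 * A) + I * ((1 / (4 * A ^ 2 * ε) : ℝ) : ℂ))) := by
  have hA : (A : ℂ) ≠ 0 := by exact_mod_cast NeZero.ne A
  have hεc : (ε : ℂ) ≠ 0 := by exact_mod_cast hε.ne'
  have hs : (√ε : ℂ) ≠ 0 := by exact_mod_cast (Real.sqrt_pos.2 hε).ne'
  have hτ : (1 / (2 * A) + I * ε : ℂ) ≠ 0 := by
    intro h
    have := congrArg Complex.im h
    rw [show (1 / (2 * A) + I * ε : ℂ) = ((1 / (2 * A) : ℝ) : ℂ) + I * ε by push_cast; rfl] at this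
    simp at this
    exact hε.ne' this
  push_cast
  set τ : ℂ := 1 / (2 * A) + I * ε with hτdef
  have hτ2 : 2 * A * τ = 1 + 2 * A * I * ε := by rw [hτdef]; field_simp
  have hw : (2 * A + -1 / τ : ℂ) = I * (ε * (2 * A / τ)) := by
    field_simp
    linear_combination hτ2
  have e1 : -I * (2 * A + -1 / τ : ℂ) = ε * (2 * A / τ) := by
    rw [hw, ← mul_assoc, neg_mul, I_mul_I]; ring
  have e2 : -1 / (2 * A + -1 / τ : ℂ) = -1 / (2 * A) + I * (1 / (4 * A ^ 2 * ε)) := by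
    rw [hw]
    field_simp
    linear_combination (-2 : ℂ) * I_sq - 2 * mul_inv_cancel₀ hA
  have e3 : (ε : ℂ) ^ (1 / 2 : ℂ) = √ε := by
    rw [show (1 / 2 : ℂ) = ((1 / 2 : ℝ) : ℂ) by push_cast; rfl, ← ofReal_cpow hε.le,
      ← Real.sqrt_eq_rpow]
  rw [jacobiTheta_inv τ, ← jacobiTheta_two_mul_add A (-1 / τ), jacobiTheta_inv (2 * A + -1 / τ), e1,
    e2, ofReal_mul_cpow hε (div_ne_zero (mul_ne_zero two_ne_zero hA) hτ), e3]
  field_simp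

lemma tendsto_jacobiTheta_add_imaginary (x : ℝ) :
    Tendsto (fun T : ℝ => jacobiTheta (x + I * T)) atTop (𝓝 1) := by
  have h := isBigO_at_im_infty_jacobiTheta_sub_one
  have h1 : Tendsto (fun τ : ℂ => Real.exp (-Real.pi * τ.im)) (comap im atTop) (𝓝 0) := by
    refine Real.tendsto_exp_atBot.comp ?_
    exact Tendsto.const_mul_atTop_of_neg (by simpa using Real.pi_pos) tendsto_comap
  have h2 := h.trans_tendsto h1
  have h3 : Tendsto (fun T : ℝ => (x + I * T : ℂ)) atTop (comap im atTop) := by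
    rw [tendsto_comap_iff]
    refine tendsto_id.congr fun T => ?_
    simp
  have h4 := (h2.comp h3).add_const 1
  simpa [Function.comp_def] using h4

lemma cpow_half_neg_I_div (A : ℕ) [NeZero A] :
    ∃ r : ℝ, 0 < r ∧ 1 / (-I * (1 / (2 * A))) ^ (1 / 2 : ℂ) = r * cexp (Real.pi * I / 4) := by
  have hA : (0 : ℝ) < A := by exact_mod_cast Nat.pos_of_neZero A
  have hr : (0 : ℝ) < 1 / (2 * A) := by positivity
  refine ⟨((1 / (2 * A) : ℝ) ^ (1 / 2 : ℝ))⁻¹, by positivity, ?_⟩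
  rw [show (-I * (1 / (2 * A)) : ℂ) = ((1 / (2 * A) : ℝ) : ℂ) * -I by push_cast; ring,
    ofReal_mul_cpow hr (neg_ne_zero.2 I_ne_zero), cpow_def_of_ne_zero (neg_ne_zero.2 I_ne_zero),
    log_neg_I, show (1 / 2 : ℂ) = ((1 / 2 : ℝ) : ℂ) by push_cast; rfl, ← ofReal_cpow hr.le,
    one_div, mul_inv, ← Complex.exp_neg]
  push_cast
  congr 2
  ring

lemma sum_gauss_eq (A : ℕ) [NeZero A] :
    ∃ r : ℝ, 0 < r ∧ (∑ k : Fin (2 * A), cexp (Real.pi * I * (k : ℕ) ^ 2 / (2 * A : ℕ))) /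
      (2 * A : ℕ) = r * cexp (Real.pi * I / 4) := by
  have hA : (0 : ℝ) < A := by exact_mod_cast Nat.pos_of_neZero A
  have hAc : (A : ℂ) ≠ 0 := by exact_mod_cast NeZero.ne A
  have : NeZero (2 * A) := ⟨by have := NeZero.ne A; omega⟩
  obtain ⟨r, hr, hr'⟩ := cpow_half_neg_I_div A
  have hτ : Tendsto (fun ε : ℝ => (1 / (2 * A) + I * ε : ℂ)) (𝓝[>] 0) (𝓝 (1 / (2 * A))) := by
    have : Continuous fun ε : ℝ => (1 / (2 * A) + I * ε : ℂ) := by fun_prop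
    have h := (this.tendsto 0).mono_left (nhdsWithin_le_nhds (s := Set.Ioi 0))
    simpa using h
  have e1 : (-I * (1 / (2 * A)) : ℂ) ∈ slitPlane := by
    rw [mem_slitPlane_iff]
    right
    rw [show (-I * (1 / (2 * A)) : ℂ) = ((-(1 / (2 * A)) : ℝ) : ℂ) * I by push_cast; ring]
    have : (1 / (2 * A) : ℝ) ≠ 0 := by positivity
    simp [mul_im, NeZero.ne A]
  have e2 : (2 * A / (1 / (2 * A)) : ℂ) = (((2 * A) ^ 2 : ℝ) : ℂ) := by push_cast; field_simp
  have t1 := (((hτ.const_mul (-I)).cpow (tendsto_const_nhds (x := (1 / 2 : ℂ))) e1).inv₀ (by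
    rw [Ne, cpow_eq_zero_iff]; simp [I_ne_zero, hAc]))
  have hne : (1 / (2 * A) : ℂ) ≠ 0 := by simp [hAc]
  have t2 := ((((tendsto_const_nhds (x := (2 * A : ℂ))).div hτ hne)).cpow (tendsto_const_nhds (x := (1 / 2 : ℂ)))
    (by rw [e2]; exact ofReal_mem_slitPlane.2 (by positivity))).inv₀ (by
      rw [e2, Ne, cpow_eq_zero_iff]; simp [hAc])
  have t3 : Tendsto (fun ε : ℝ => jacobiTheta (-1 / (2 * A) + I * ((1 / (4 * A ^ 2 * ε) : ℝ) : ℂ)))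
      (𝓝[>] 0) (𝓝 1) := by
    have h1 := tendsto_jacobiTheta_add_imaginary (-1 / (2 * A))
    have h2 : Tendsto (fun ε : ℝ => (1 / (4 * A ^ 2) : ℝ) * ε⁻¹) (𝓝[>] 0) atTop :=
      Tendsto.const_mul_atTop (by positivity) tendsto_inv_nhdsGT_zero
    refine (h1.comp h2).congr fun ε => ?_
    simp only [Function.comp_def]
    push_cast
    congr 2
    field_simp
  have t := t1.mul (t2.mul t3)
  have t' := tendsto_sqrt_mul_jacobiTheta (2 * A) (even_two_mul A)
  have := tendsto_nhds_unique (t'.congr' ?_) t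
  · rw [this, ← one_div, hr', e2, mul_one,
      show (1 / 2 : ℂ) = ((1 / 2 : ℝ) : ℂ) by push_cast; rfl, ← ofReal_cpow (by positivity)]
    refine ⟨r * (((2 * A : ℝ) ^ 2) ^ (1 / 2 : ℝ))⁻¹, by positivity, ?_⟩
    push_cast
    ring
  · filter_upwards [self_mem_nhdsWithin] with ε hε
    rw [sqrt_mul_jacobiTheta A hε]
    simp only [one_div]
    rfl

lemma eQ_sq_div_factor (A : ℕ) [NeZero A] :
    ∃ g : ZMod (2 * A) → ℂ, ∀ k : ℤ, eQ ((k : ℚ) ^ 2 / (4 * A)) = g (Int.castAddHom (ZMod (2 * A)) k) := by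
  have : NeZero (2 * A) := ⟨by have := NeZero.ne A; omega⟩
  have hA : (A : ℚ) ≠ 0 := by exact_mod_cast NeZero.ne A
  refine ⟨fun z => eQ (((z.val : ℤ) : ℚ) ^ 2 / (4 * A)), fun k => ?_⟩
  have h : (2 * A : ℤ) ∣ k - ((k : ZMod (2 * A)).val : ℤ) := by
    have := (ZMod.intCast_eq_intCast_iff_dvd_sub ((k : ZMod (2 * A)).val : ℤ) k (2 * A)).1 (by simp)
    exact_mod_cast this
  obtain ⟨m, hm⟩ := h
  simp only [Int.coe_castAddHom]
  set v : ℤ := ((k : ZMod (2 * A)).val : ℤ) with hv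
  have hk : k = v + 2 * A * m := by linarith
  have : (k : ℚ) ^ 2 / (4 * A) = ((v : ℚ)) ^ 2 / (4 * A) + ((v * m + A * m ^ 2 : ℤ) : ℚ) := by
    rw [hk]; push_cast; field_simp; ring
  rw [this, eQ_add, eQ_int, mul_one]

theorem mean_eQ_sq_div (A : ℕ) [NeZero A] :
    ∃ r : ℝ, 0 < r ∧ mean (fun k : ℤ => eQ ((k : ℚ) ^ 2 / (4 * A))) = r * cexp (Real.pi * I / 4) := by
  have : NeZero (2 * A) := ⟨by have := NeZero.ne A; omega⟩
  obtain ⟨r, hr, h⟩ := sum_gauss_eq A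
  obtain ⟨g, hg⟩ := eQ_sq_div_factor A
  refine ⟨r, hr, ?_⟩
  rw [mean_eq_of_factor (Int.castAddHom (ZMod (2 * A))) (ZMod.intCast_surjective) hg, ← h,
    Nat.card_zmod]
  congr 1
  have hbij : Function.Bijective
      fun k : Fin (2 * A) => Int.castAddHom (ZMod (2 * A)) ((k : ℕ) : ℤ) := by
    constructor
    · intro a b hab
      have := congrArg ZMod.val hab
      simp only [Int.coe_castAddHom, Int.cast_natCast, ZMod.val_cast_of_lt a.2,
        ZMod.val_cast_of_lt b.2] at this
      exact Fin.ext this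
    · intro z
      exact ⟨⟨z.val, z.val_lt⟩, by simp⟩
  refine (Fintype.sum_bijective _ hbij _ _ fun k => ?_).symm
  rw [← hg, eQ]
  congr 1
  push_cast
  have hA : (A : ℂ) ≠ 0 := by exact_mod_cast NeZero.ne A
  field_simp
  try ring

end Theta

section Milgram

open Complex

lemma eQ_sum {ι : Type*} (s : Finset ι) (f : ι → ℚ) : eQ (∑ i ∈ s, f i) = ∏ i ∈ s, eQ (f i) := by
  induction s using Finset.induction_on with
  | empty => simpa using eQ_int 0
  | insert a s ha ih => rw [Finset.sum_insert ha, Finset.prod_insert ha, eQ_add, ih]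

lemma eQ_ne_zero (x : ℚ) : eQ x ≠ 0 := Complex.exp_ne_zero _

/-- A full subgroup of a positive definite quadratic space contains an orthogonal basis. -/
lemma exists_orthogonal_basis_mem {V : Type*} [AddCommGroup V] [Module ℚ V] [FiniteDimensional ℚ V]
    (B : LinearMap.BilinForm ℚ V) (hsymm : ∀ x y, B x y = B y x) (M : AddSubgroup V)
    (hfull : ∀ v, ∃ N : ℕ, 0 < N ∧ N • v ∈ M) :
    ∃ e : Module.Basis (Fin (Module.finrank ℚ V)) ℚ V, (∀ i, e i ∈ M) ∧
      ∀ i j, i ≠ j → B (e i) (e j) = 0 := by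
  obtain ⟨v, hv⟩ := LinearMap.BilinForm.exists_orthogonal_basis (B := B) ⟨fun x y => hsymm x y⟩
  choose N hN hNM using fun i => hfull (v i)
  have hu : ∀ i, IsUnit (N i : ℚ) := fun i => (Nat.cast_ne_zero.2 (hN i).ne').isUnit
  refine ⟨v.isUnitSMul hu, fun i => ?_, fun i j hij => ?_⟩
  · rw [Module.Basis.isUnitSMul_apply, Nat.cast_smul_eq_nsmul]
    exact hNM i
  · have : B (v i) (v j) = 0 := hv hij
    simp [Module.Basis.isUnitSMul_apply, this]

/-- A form of Milgram's theorem for positive definite quadratic spaces. -/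
theorem exists_mean_eQ_dual {V : Type*} [AddCommGroup V] [Module ℚ V] [FiniteDimensional ℚ V]
    (B : LinearMap.BilinForm ℚ V) (hsymm : ∀ x y, B x y = B y x) (hpos : ∀ x ≠ 0, 0 < B x x)
    (M M' : AddSubgroup V) (hfull : ∀ v, ∃ N : ℕ, 0 < N ∧ N • v ∈ M)
    (hint : ∀ m ∈ M, ∃ z : ℤ, B m m = z)
    (hM' : ∀ x, x ∈ M' ↔ ∀ m ∈ M, ∃ z : ℤ, 2 * B x m = z) :
    ∃ r : ℝ, 0 < r ∧ mean (fun x : M' => eQ (B x x)) =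
      r * cexp (Real.pi * I / 4) ^ Module.finrank ℚ V := by
  obtain ⟨e, heM, heo⟩ := exists_orthogonal_basis_mem B hsymm M hfull
  have ha : ∀ i, ∃ a : ℕ, 0 < a ∧ B (e i) (e i) = a := by
    intro i
    obtain ⟨z, hz⟩ := hint _ (heM i)
    have h0 := hpos _ (e.ne_zero i)
    rw [hz] at h0
    have h1 : 0 < z := by exact_mod_cast h0
    refine ⟨z.toNat, by omega, ?_⟩
    rw [hz]
    exact_mod_cast (Int.toNat_of_nonneg h1.le).symm
  choose a ha0 hae using ha
  have hnz : ∀ i, NeZero (a i) := fun i => ⟨(ha0 i).ne'⟩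
  have hnz2 : ∀ i, NeZero (2 * a i) := fun i => ⟨by have := ha0 i; omega⟩
  have haq (i) : (a i : ℚ) ≠ 0 := by exact_mod_cast (ha0 i).ne'
  let ι := Fin (Module.finrank ℚ V)
  let φ : (ι → ℤ) →+ V :=
    { toFun := fun k => ∑ i, ((k i : ℚ) / (2 * a i)) • e i
      map_zero' := by simp
      map_add' := fun x y => by
        rw [← Finset.sum_add_distrib]
        refine Finset.sum_congr rfl fun i _ => ?_
        rw [← add_smul]
        congr 1
        push_cast [Pi.add_apply]
        ring }
  have hφ (k) : φ k = ∑ i, ((k i : ℚ) / (2 * a i)) • e i := rfl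
  have hBe (k i) : B (φ k) (e i) = k i / 2 := by
    rw [hφ, map_sum, LinearMap.sum_apply, Finset.sum_eq_single i]
    · rw [map_smul, LinearMap.smul_apply, hae, smul_eq_mul]
      have := haq i
      field_simp
    · intro j _ hj
      rw [map_smul, LinearMap.smul_apply, heo j i hj, smul_zero]
    · simp
  have hq (k) : B (φ k) (φ k) = ∑ i, (k i : ℚ) ^ 2 / (4 * a i) := by
    conv_lhs => rw [hφ k, map_sum]
    refine Finset.sum_congr rfl fun i _ => ?_
    rw [map_smul, ← hφ, hBe, smul_eq_mul]
    have := haq i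
    field_simp
    try ring
  have hφinj : Function.Injective φ := by
    rw [injective_iff_map_eq_zero]
    intro k hk
    ext i
    have := hBe k i
    rw [hk, map_zero, LinearMap.zero_apply] at this
    have : (k i : ℚ) = 0 := by linarith
    exact_mod_cast this
  have hsurj : ∀ x ∈ M', ∃ k, φ k = x := by
    intro x hx
    choose k hk using fun i => (hM' x).1 hx (e i) (heM i)
    refine ⟨k, ?_⟩
    rw [hφ]
    conv_rhs => rw [← e.sum_repr x]
    refine Finset.sum_congr rfl fun i _ => ?_
    congr 1
    have h1 : B x (e i) = e.repr x i * a i := by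
      conv_lhs => rw [← e.sum_repr x]
      rw [map_sum, LinearMap.sum_apply, Finset.sum_eq_single i]
      · rw [map_smul, LinearMap.smul_apply, hae, smul_eq_mul]
      · intro j _ hj
        rw [map_smul, LinearMap.smul_apply, heo j i hj, smul_zero]
      · simp
    rw [← hk i, h1]
    have := haq i
    field_simp
  let π : (ι → ℤ) →+ (∀ i, ZMod (2 * a i)) :=
    { toFun := fun z i => (z i : ZMod (2 * a i))
      map_zero' := by ext; simp
      map_add' := fun x y => by ext; simp }
  have hMM' : M ≤ M' := by
    intro m hm
    rw [hM']
    intro m' hm'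
    obtain ⟨z, hz⟩ := hint _ (M.add_mem hm hm')
    obtain ⟨z1, hz1⟩ := hint _ hm
    obtain ⟨z2, hz2⟩ := hint _ hm'
    refine ⟨z - z1 - z2, ?_⟩
    push_cast
    rw [← hz, ← hz1, ← hz2]
    simp only [map_add, LinearMap.add_apply]
    rw [hsymm m' m]
    ring
  have hker : π.ker ≤ M.comap φ := by
    intro k hk
    rw [AddSubgroup.mem_comap, hφ]
    refine M.sum_mem fun i _ => ?_
    have h1 : ((k i : ℤ) : ZMod (2 * a i)) = 0 := congrFun hk i
    obtain ⟨c, hc⟩ := (ZMod.intCast_zmod_eq_zero_iff_dvd _ _).1 h1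
    have : (k i : ℚ) / (2 * a i) = c := by
      rw [hc]
      have := haq i
      push_cast
      field_simp
    rw [this, Int.cast_smul_eq_zsmul]
    exact M.zsmul_mem (heM i) c
  have hkerfin : π.ker.FiniteIndex := AddSubgroup.finiteIndex_ker π
  choose g hg using fun i => eQ_sq_div_factor (a i)
  let f : (ι → ℤ) → ℂ := fun k => ∏ i, eQ ((k i : ℚ) ^ 2 / (4 * a i))
  have hf (k) : f k = eQ (B (φ k) (φ k)) := by rw [hq, eQ_sum]
  have hfap : AlmostPeriodic f := .of_factor π (g := fun y => ∏ i, g i (y i))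
    fun x => Finset.prod_congr rfl fun i _ => hg i (x i)
  choose r hr hr' using fun i => mean_eQ_sq_div (a i)
  have hmean : mean f = ((∏ i, r i : ℝ) : ℂ) * cexp (Real.pi * I / 4) ^ Module.finrank ℚ V := by
    have := mean_pi (f := fun i (k : ℤ) => eQ ((k : ℚ) ^ 2 / (4 * a i))) (fun i => 2 * a i) g hg
    rw [this, Finset.prod_congr rfl fun i _ => hr' i, Finset.prod_mul_distrib, Finset.prod_const,
      Finset.card_univ, Fintype.card_fin]
    push_cast
    rfl
  let S := M'.comap φ
  let S₀ := M.comap φ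
  have hS₀fin : S₀.FiniteIndex := AddSubgroup.finiteIndex_of_le hker
  have hSfin : S.FiniteIndex :=
    AddSubgroup.finiteIndex_of_le (hker.trans (AddSubgroup.comap_mono hMM'))
  let Ψ : (ι → ℤ) × S₀ →+ (ι → ℤ) := (AddMonoidHom.id _).coprod S₀.subtype
  have hΨ : Function.Surjective Ψ := fun x => ⟨(x, 0), by simp [Ψ]⟩
  have h1 : mean f = mean (fun x => if x ∈ S.subtype.range then f x else 0) := by
    rw [← mean_comp_surjective hfap Ψ hΨ, mean_prod (hfap.comp Ψ)]
    congr 1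
    funext x
    have h2 : ∀ y : S₀, f (Ψ (x, y)) = f x * eQ (2 * B (φ x) (φ y)) := by
      intro y
      have h3 : Ψ (x, y) = x + y := rfl
      obtain ⟨z, hz⟩ := hint _ y.2
      rw [h3, hf, hf, map_add, ← eQ_add]
      have h4 : B (φ x + φ y) (φ x + φ y) =
          B (φ x) (φ x) + 2 * B (φ x) (φ y) + (z : ℚ) := by
        rw [← hz]
        simp only [map_add, LinearMap.add_apply]
        rw [hsymm (φ y) (φ x)]
        ring
      rw [h4, eQ_add, eQ_int, mul_one]
    have h2' : (fun y : S₀ => f (Ψ (x, y))) = fun y : S₀ => f x * eQ (2 * B (φ x) (φ y)) :=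
      funext h2
    have hap : AlmostPeriodic fun y : S₀ => eQ (2 * B (φ x) (φ y)) := by
      have h5 : AlmostPeriodic fun y : S₀ => f (Ψ (x, y)) := by
        obtain ⟨H, _, g', hg'⟩ := (hfap.comp Ψ).exists_factor
        exact .of_factor ((QuotientAddGroup.mk' H).comp (AddMonoidHom.inr _ _))
          (g := fun z => g' (QuotientAddGroup.mk' H (x, 0) + z))
          fun y => by rw [hg', AddMonoidHom.comp_apply, ← map_add]; simp
      obtain ⟨H, hH, hper⟩ := h5
      refine ⟨H, hH, fun u v hv => ?_⟩
      have := hper u v hv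
      dsimp only at this ⊢
      rw [h2, h2] at this
      refine mul_left_cancel₀ ?_ this
      rw [hf]; exact eQ_ne_zero _
    rw [h2', mean_const_mul hap]
    by_cases hx : x ∈ S.subtype.range
    · rw [if_pos hx]
      have hx' : φ x ∈ M' := by
        rw [AddSubgroup.range_subtype] at hx
        exact hx
      have : (fun y : S₀ => eQ (2 * B (φ x) (φ y))) = fun _ => 1 := by
        funext y
        exact (eQ_eq_one_iff _).2 ((hM' _).1 hx' _ y.2)
      rw [this, mean_const, mul_one]
    · rw [if_neg hx]
      have hx' : φ x ∉ M' := by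
        rw [AddSubgroup.range_subtype] at hx
        exact hx
      have : ∃ m ∈ M, ¬ ∃ z : ℤ, 2 * B (φ x) m = z := by
        by_contra! h
        exact hx' ((hM' _).2 fun m hm => h m hm)
      obtain ⟨m, hm, hz⟩ := this
      obtain ⟨k, hk⟩ := hsurj m (hMM' hm)
      have hk' : k ∈ S₀ := by rw [AddSubgroup.mem_comap, hk]; exact hm
      rw [mean_char_eq_zero hap (fun u v => ?_) (y := ⟨k, hk'⟩) ?_, mul_zero]
      rotate_left
      · rw [← eQ_add]
        congr 1
        simp only [AddSubgroup.coe_add, map_add]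
        ring
      · simp only [hk]
        rwa [Ne, eQ_eq_one_iff]
  have hr2 : S.subtype.range.FiniteIndex := by rwa [AddSubgroup.range_subtype]
  obtain ⟨r', hr'0, hr'1⟩ := exists_mean_indicator S.subtype hr2
  rw [hr'1 f hfap] at h1
  let φS : S →+ M' := (φ.comp S.subtype).codRestrict M' fun x => x.2
  have hφS : Function.Surjective φS := by
    rintro ⟨x, hx⟩
    obtain ⟨k, hk⟩ := hsurj x hx
    exact ⟨⟨k, by rw [AddSubgroup.mem_comap, hk]; exact hx⟩, Subtype.ext hk⟩
  have hφSi : Function.Injective φS := by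
    intro x y hxy
    exact Subtype.ext (hφinj (congrArg Subtype.val hxy))
  let E : S ≃+ M' := AddEquiv.ofBijective φS ⟨hφSi, hφS⟩
  have hEap : AlmostPeriodic fun x : M' => eQ (B x x) := by
    have := (hfap.comp S.subtype).comp E.symm.toAddMonoidHom
    convert this using 2 with x
    have h6 : (φ (S.subtype (E.symm x)) : V) = x := congrArg Subtype.val (E.apply_symm_apply x)
    exact (by rw [hf]; exact congrArg eQ (by rw [h6]) :
      f (S.subtype (E.symm x)) = eQ (B x x)).symm
  have h7 : mean (fun y : S => f (S.subtype y)) = mean (fun x : M' => eQ (B x x)) := by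
    rw [← mean_comp_surjective hEap φS hφS]
    congr 1
    funext y
    rw [hf]
    rfl
  rw [h7, hmean] at h1
  have hr'c : (r' : ℂ) ≠ 0 := by exact_mod_cast hr'0.ne'
  refine ⟨r'⁻¹ * ∏ i, r i, mul_pos (inv_pos.2 hr'0) (Finset.prod_pos fun i _ => hr i), ?_⟩
  rw [ofReal_mul, mul_assoc, h1, ofReal_inv, inv_mul_cancel_left₀ hr'c]

end Milgram

section QuadSym

open UniqueFactorizationMonoid

variable {F : Type*} [Field F] [NumberField F]

lemma quotient_finite {𝔟 : Ideal (𝓞 F)} (h : 𝔟 ≠ ⊥) : Finite (𝓞 F ⧸ 𝔟) :=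
  Ideal.finiteQuotientOfFreeOfNeBot 𝔟 h

lemma legSym_mul {𝔭 : Ideal (𝓞 F)} (hp : 𝔭.IsPrime) (h0 : 𝔭 ≠ ⊥) (x y : 𝓞 F) :
    legSym 𝔭 (x * y) = legSym 𝔭 x * legSym 𝔭 y := by
  have := hp.isMaximal h0
  let _ := Ideal.Quotient.field 𝔭
  have := quotient_finite h0
  let _ := Fintype.ofFinite (𝓞 F ⧸ 𝔭)
  have h (z : 𝓞 F) : legSym 𝔭 z = quadraticChar (𝓞 F ⧸ 𝔭) (Ideal.Quotient.mk 𝔭 z) := by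
    rw [quadraticChar_apply, quadraticCharFun, legSym]
    congr
  rw [h, h, h, map_mul, map_mul]

lemma legSym_congr {𝔭 : Ideal (𝓞 F)} {x y : 𝓞 F} (h : x - y ∈ 𝔭) : legSym 𝔭 x = legSym 𝔭 y := by
  rw [legSym, legSym, (Ideal.Quotient.mk_eq_mk_iff_sub_mem x y).2 h]

lemma legSym_sq {𝔭 : Ideal (𝓞 F)} {x : 𝓞 F} (h : x ∉ 𝔭) : legSym 𝔭 x * legSym 𝔭 x = 1 := by
  rw [legSym, if_neg (by rwa [Ideal.Quotient.eq_zero_iff_mem])]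
  split_ifs <;> rfl

lemma isPrime_of_mem_normalizedFactors {𝔟 𝔭 : Ideal (𝓞 F)} (h : 𝔭 ∈ normalizedFactors 𝔟) :
    𝔭.IsPrime ∧ 𝔭 ≠ ⊥ ∧ 𝔟 ≤ 𝔭 :=
  have hp := prime_of_normalized_factor _ h
  ⟨Ideal.isPrime_of_prime hp, hp.ne_zero, Ideal.dvd_iff_le.1 (dvd_of_mem_normalizedFactors h)⟩

lemma notMem_of_isCoprime {𝔟 𝔭 : Ideal (𝓞 F)} {x : 𝓞 F} (h : IsCoprime 𝔟 (Ideal.span {x}))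
    (hp : 𝔭.IsPrime) (hle : 𝔟 ≤ 𝔭) : x ∉ 𝔭 := by
  intro hx
  rw [Ideal.isCoprime_iff_sup_eq] at h
  exact hp.ne_top (top_le_iff.1 (h ▸ sup_le hle ((Ideal.span_singleton_le_iff_mem _).2 hx)))

lemma quadSym_mul (𝔟 : Ideal (𝓞 F)) (x y : 𝓞 F) :
    quadSym 𝔟 (x * y) = quadSym 𝔟 x * quadSym 𝔟 y := by
  rw [quadSym, quadSym, quadSym, ← Multiset.prod_map_mul]
  congr 1
  refine Multiset.map_congr rfl fun 𝔭 hp => ?_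
  obtain ⟨h1, h2, -⟩ := isPrime_of_mem_normalizedFactors hp
  exact legSym_mul h1 h2 x y

lemma quadSym_congr {𝔟 : Ideal (𝓞 F)} {x y : 𝓞 F} (h : x - y ∈ 𝔟) :
    quadSym 𝔟 x = quadSym 𝔟 y := by
  rw [quadSym, quadSym]
  congr 1
  exact Multiset.map_congr rfl fun 𝔭 hp =>
    legSym_congr ((isPrime_of_mem_normalizedFactors hp).2.2 h)

lemma quadSym_ideal_mul {𝔞 𝔟 : Ideal (𝓞 F)} (ha : 𝔞 ≠ ⊥) (hb : 𝔟 ≠ ⊥) (x : 𝓞 F) :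
    quadSym (𝔞 * 𝔟) x = quadSym 𝔞 x * quadSym 𝔟 x := by
  rw [quadSym, quadSym, quadSym, normalizedFactors_mul ha hb, Multiset.map_add, Multiset.prod_add]

lemma quadSym_top (x : 𝓞 F) : quadSym ⊤ x = 1 := by
  rw [quadSym, ← Ideal.one_eq_top, normalizedFactors_one, Multiset.map_zero, Multiset.prod_zero]

lemma quadSym_prime {𝔭 : Ideal (𝓞 F)} (hp : 𝔭.IsPrime) (h0 : 𝔭 ≠ ⊥) (x : 𝓞 F) :
    quadSym 𝔭 x = legSym 𝔭 x := by
  rw [quadSym, normalizedFactors_irreducible (Ideal.prime_of_isPrime h0 hp).irreducible,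
    normalize_eq, Multiset.map_singleton, Multiset.prod_singleton]

lemma quadSym_mul_self {𝔟 : Ideal (𝓞 F)} {x : 𝓞 F} (h : IsCoprime 𝔟 (Ideal.span {x})) :
    quadSym 𝔟 x * quadSym 𝔟 x = 1 := by
  rw [quadSym, ← Multiset.prod_map_mul]
  refine Multiset.prod_eq_one fun y hy => ?_
  obtain ⟨𝔭, hp, rfl⟩ := Multiset.mem_map.1 hy
  obtain ⟨h1, -, h3⟩ := isPrime_of_mem_normalizedFactors hp
  exact legSym_sq (notMem_of_isCoprime h h1 h3)

lemma quadSym_eq_one_or {𝔟 : Ideal (𝓞 F)} {x : 𝓞 F} (h : IsCoprime 𝔟 (Ideal.span {x})) :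
    quadSym 𝔟 x = 1 ∨ quadSym 𝔟 x = -1 := mul_self_eq_one_iff.1 (quadSym_mul_self h)

lemma quadSym_sq {𝔟 : Ideal (𝓞 F)} {x : 𝓞 F} (h : IsCoprime 𝔟 (Ideal.span {x})) :
    quadSym 𝔟 (x ^ 2) = 1 := by
  rw [sq, quadSym_mul, quadSym_mul_self h]

/-- `ψ` is an additive character of `𝓞 F` whose conductor is the ideal `𝔟`. -/
structure HasConductor (ψ : 𝓞 F → ℂ) (𝔟 : Ideal (𝓞 F)) : Prop where
  add : ∀ x y, ψ (x + y) = ψ x * ψ y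
  mem_iff : ∀ y, y ∈ 𝔟 ↔ ∀ x, ψ (x * y) = 1

namespace HasConductor

variable {ψ : 𝓞 F → ℂ} {𝔟 : Ideal (𝓞 F)}

lemma comp_mul (h : HasConductor ψ 𝔟) {p : 𝓞 F} {𝔠 : Ideal (𝓞 F)}
    (hp : ∀ y, y ∈ 𝔠 ↔ p * y ∈ 𝔟) : HasConductor (fun y => ψ (p * y)) 𝔠 where
  add x y := by rw [mul_add, h.add]
  mem_iff y := by
    rw [hp, h.mem_iff]
    exact forall_congr' fun x => by rw [mul_left_comm]

lemma eq_one (h : HasConductor ψ 𝔟) {y : 𝓞 F} (hy : y ∈ 𝔟) : ψ y = 1 := by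
  simpa using (h.mem_iff y).1 hy 1

lemma congr (h : HasConductor ψ 𝔟) {x y : 𝓞 F} (hy : x - y ∈ 𝔟) : ψ x = ψ y := by
  rw [← sub_add_cancel x y, h.add, h.eq_one hy, one_mul]

lemma factor (h : HasConductor ψ 𝔟) (u x : 𝓞 F) :
    ψ (u * x ^ 2) = (fun z : 𝓞 F ⧸ 𝔟 => ψ (u * z.out ^ 2))
      ((Ideal.Quotient.mk 𝔟).toAddMonoidHom x) := by
  refine h.congr ?_
  rw [← mul_sub]
  refine 𝔟.mul_mem_left _ ?_
  have : x - (Ideal.Quotient.mk 𝔟 x).out ∈ 𝔟 := by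
    rw [← Ideal.Quotient.mk_eq_mk_iff_sub_mem, Ideal.Quotient.mk_out]
  rw [sq_sub_sq]
  exact 𝔟.mul_mem_left _ this

lemma ap (h : HasConductor ψ 𝔟) (hb : 𝔟 ≠ ⊥) (u : 𝓞 F) :
    AlmostPeriodic fun x => ψ (u * x ^ 2) := by
  have := quotient_finite hb
  exact .of_factor (F := 𝓞 F ⧸ 𝔟) (Ideal.Quotient.mk 𝔟).toAddMonoidHom
    (g := fun z : 𝓞 F ⧸ 𝔟 => ψ (u * z.out ^ 2)) fun x => h.factor u x

end HasConductor

end QuadSym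

section Twist

open UniqueFactorizationMonoid

variable {F : Type*} [Field F] [NumberField F] {ψ : 𝓞 F → ℂ}

lemma sum_comp_sq {k : Type*} [Field k] [Fintype k] (hk : ringChar k ≠ 2) (h : k → ℂ) :
    ∑ x, h (x ^ 2) = ∑ y, ((quadraticChar k y : ℤ) + 1 : ℂ) * h y := by
  rw [← Finset.sum_fiberwise Finset.univ (fun x : k => x ^ 2)]
  refine Finset.sum_congr rfl fun y _ => ?_
  rw [Finset.sum_congr rfl (g := fun _ => h y) (fun x hx => by rw [(Finset.mem_filter.1 hx).2]),
    Finset.sum_const, nsmul_eq_mul]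
  congr 1
  have := quadraticChar_card_sqrts hk y
  rw [Set.toFinset_ofPred] at this
  exact_mod_cast congrArg (Int.cast (R := ℂ)) this

lemma sum_addChar_sq_twist {k : Type*} [Field k] [Fintype k] (hk : ringChar k ≠ 2)
    (Ψ : AddChar k ℂ) (hΨ : Ψ ≠ 1) {u : k} (hu : u ≠ 0) :
    ∑ x, Ψ (u * x ^ 2) = (quadraticChar k u : ℤ) * ∑ x, Ψ (x ^ 2) := by
  have hchar : ∀ Φ : AddChar k ℂ, Φ ≠ 1 → ∑ x, Φ (x ^ 2) =
      gaussSum ((quadraticChar k).ringHomComp (Int.castRingHom ℂ)) Φ := by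
    intro Φ hΦ
    rw [sum_comp_sq hk]
    simp only [add_mul, one_mul, Finset.sum_add_distrib, AddChar.sum_eq_zero_of_ne_one hΦ, add_zero]
    rfl
  have h1 : Ψ.mulShift u ≠ 1 := by
    intro h
    apply hΨ
    ext x
    have := DFunLike.congr_fun h (u⁻¹ * x)
    rwa [AddChar.mulShift_apply, mul_inv_cancel_left₀ hu] at this
  have h2 := gaussSum_mulShift ((quadraticChar k).ringHomComp (Int.castRingHom ℂ)) Ψ (Units.mk0 u hu)
  have h3 : ((quadraticChar k u : ℤ) : ℂ) * (quadraticChar k u : ℤ) = 1 := by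
    have := quadraticChar_sq_one hu
    rw [sq] at this
    exact_mod_cast this
  rw [Units.val_mk0] at h2
  rw [hchar Ψ hΨ, ← h2, ← hchar _ h1]
  simp only [AddChar.mulShift_apply]
  have h4 : (quadraticChar k).ringHomComp (Int.castRingHom ℂ) u = (quadraticChar k u : ℤ) := rfl
  rw [h4, ← mul_assoc, h3, one_mul]

/-- The twist formula modulo a prime. -/
lemma HasConductor.twist_prime {𝔭 : Ideal (𝓞 F)} (hψ : HasConductor ψ 𝔭) (hp : 𝔭.IsPrime)
    (h0 : 𝔭 ≠ ⊥) (h2 : (2 : 𝓞 F) ∉ 𝔭) {u : 𝓞 F} (hu : u ∉ 𝔭) :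
    mean (fun x => ψ (u * x ^ 2)) = quadSym 𝔭 u * mean (fun x => ψ (x ^ 2)) := by
  have := hp.isMaximal h0
  let _ := Ideal.Quotient.field 𝔭
  have := quotient_finite h0
  let _ := Fintype.ofFinite (𝓞 F ⧸ 𝔭)
  have hout : ∀ x : 𝓞 F, ψ (Ideal.Quotient.mk 𝔭 x).out = ψ x := fun x => hψ.congr (by
    rw [← Ideal.Quotient.mk_eq_mk_iff_sub_mem, Ideal.Quotient.mk_out])
  let Ψ : AddChar (𝓞 F ⧸ 𝔭) ℂ :=
    { toFun := fun z => ψ z.out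
      map_zero_eq_one' := by
        rw [← map_zero (Ideal.Quotient.mk 𝔭), hout]
        exact hψ.eq_one 𝔭.zero_mem
      map_add_eq_mul' := fun x y => by
        obtain ⟨x, rfl⟩ := Ideal.Quotient.mk_surjective x
        obtain ⟨y, rfl⟩ := Ideal.Quotient.mk_surjective y
        rw [← map_add, hout, hout, hout, hψ.add] }
  have hΨ (x : 𝓞 F) : Ψ (Ideal.Quotient.mk 𝔭 x) = ψ x := hout x
  have hΨ1 : Ψ ≠ 1 := by
    intro h
    refine (Ideal.ne_top_iff_one _).1 hp.ne_top ((hψ.mem_iff 1).2 fun x => ?_)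
    rw [mul_one, ← hΨ, h, AddChar.one_apply]
  have hk : ringChar (𝓞 F ⧸ 𝔭) ≠ 2 := by
    intro h
    apply h2
    rw [← Ideal.Quotient.eq_zero_iff_mem, map_ofNat]
    have := ringChar.Nat.cast_ringChar (R := 𝓞 F ⧸ 𝔭)
    rw [h] at this
    exact_mod_cast this
  have hm (v : 𝓞 F) : mean (fun x => ψ (v * x ^ 2)) =
      (∑ z, Ψ (Ideal.Quotient.mk 𝔭 v * z ^ 2)) / Nat.card (𝓞 F ⧸ 𝔭) :=
    mean_eq_of_factor (F := 𝓞 F ⧸ 𝔭) (Ideal.Quotient.mk 𝔭).toAddMonoidHom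
      Ideal.Quotient.mk_surjective fun x => by
        rw [← hΨ, map_mul, map_pow]; rfl
  have hm1 := hm 1
  simp only [one_mul, map_one] at hm1
  have hu' : Ideal.Quotient.mk 𝔭 u ≠ 0 := by rwa [Ne, Ideal.Quotient.eq_zero_iff_mem]
  rw [hm, hm1, sum_addChar_sq_twist hk Ψ hΨ1 hu', mul_div_assoc, quadSym_prime hp h0]
  congr 2
  rw [quadraticChar_apply, quadraticCharFun, legSym]
  congr

lemma HasConductor.sq_left {𝔞 𝔠 : Ideal (𝓞 F)} (hψ : HasConductor ψ (𝔞 * 𝔠)) {p q : 𝓞 F}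
    (hp : p ∈ 𝔠) (hq : q ∈ 𝔞) (hpq : q + p = 1) : HasConductor (fun y => ψ (p ^ 2 * y)) 𝔞 := by
  refine hψ.comp_mul fun y => ⟨fun hy => ?_, fun hy => ?_⟩
  · rw [mul_comm (p ^ 2), sq]
    exact Ideal.mul_mem_mul hy (𝔠.mul_mem_left _ hp)
  · have h1 : p ^ 2 * y ∈ 𝔞 := (Ideal.mul_le_left : 𝔞 * 𝔠 ≤ 𝔞) hy
    have h2 : y = p ^ 2 * y + q * ((p + 1) * y) := by
      linear_combination (-y * (p + 1)) * hpq
    rw [h2]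
    exact 𝔞.add_mem h1 (𝔞.mul_mem_right _ hq)

/-- Splitting a quadratic Gauss sum along a coprime factorization of its conductor. -/
lemma HasConductor.mean_coprime {𝔞 𝔠 : Ideal (𝓞 F)} (hψ : HasConductor ψ (𝔞 * 𝔠))
    (h0 : 𝔞 * 𝔠 ≠ ⊥) {p q : 𝓞 F} (hp : p ∈ 𝔠) (hq : q ∈ 𝔞) (hpq : q + p = 1) (u : 𝓞 F) :
    mean (fun x => ψ (u * x ^ 2)) =
      mean (fun x => ψ (p ^ 2 * (u * x ^ 2))) * mean (fun x => ψ (q ^ 2 * (u * x ^ 2))) := by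
  have ha : 𝔞 ≠ ⊥ := fun h => h0 (by rw [h, Ideal.bot_mul])
  have hc : 𝔠 ≠ ⊥ := fun h => h0 (by rw [h, Ideal.mul_bot])
  let φ : 𝓞 F × 𝓞 F →+ 𝓞 F :=
    (AddMonoidHom.mulLeft p).coprod (AddMonoidHom.mulLeft q)
  refine mean_eq_mul (hψ.ap h0 u) ((hψ.sq_left hp hq hpq).ap ha u)
    (((mul_comm 𝔞 𝔠 ▸ hψ).sq_left hq hp (by rw [add_comm, hpq])).ap hc u) φ (fun x => ⟨(x, x), ?_⟩)
    fun x y => ?_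
  · change p * x + q * x = x
    linear_combination x * hpq
  · change ψ (u * (p * x + q * y) ^ 2) = _
    rw [← hψ.add]
    refine hψ.congr ?_
    have : u * (p * x + q * y) ^ 2 - (p ^ 2 * (u * x ^ 2) + q ^ 2 * (u * y ^ 2)) =
      (q * p) * (2 * u * x * y) := by ring
    rw [this]
    exact Ideal.mul_mem_right _ _ (Ideal.mul_mem_mul hq hp)

/-- The mean of `ψ (x²)` is, up to a factor depending only on `𝔭`, that of `ψ (π²x²)`, if the
conductor of `ψ` is `𝔭²𝔠` and `π ∈ 𝔭 \ 𝔭²` is suitably chosen. -/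
lemma exists_mean_prime_sq {𝔭 𝔠 : Ideal (𝓞 F)} (hp : 𝔭.IsPrime) (h0 : 𝔭 * 𝔭 * 𝔠 ≠ ⊥)
    (h2 : (2 : 𝓞 F) ∉ 𝔭) : ∃ π : 𝓞 F, ∃ C : ℂ, ∀ ψ : 𝓞 F → ℂ, HasConductor ψ (𝔭 * 𝔭 * 𝔠) →
      HasConductor (fun y => ψ (π ^ 2 * y)) 𝔠 ∧
      mean (fun x => ψ (x ^ 2)) = C * mean (fun x => ψ (π ^ 2 * x ^ 2)) := by
  have hp0 : 𝔭 ≠ ⊥ := fun h => h0 (by rw [h, Ideal.bot_mul, Ideal.bot_mul])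
  have hc0 : 𝔠 ≠ ⊥ := fun h => h0 (by rw [h, Ideal.mul_bot])
  have hle : 𝔭 * 𝔭 * 𝔠 ≤ 𝔭 := Ideal.mul_le_left.trans Ideal.mul_le_left
  obtain ⟨π, hπ⟩ := IsDedekindDomain.exists_sup_span_eq hle h0
  have hπp : π ∈ 𝔭 := hπ ▸ Ideal.mem_sup_right (Ideal.mem_span_singleton_self π)
  have : Finite (𝓞 F ⧸ 𝔭) := quotient_finite hp0
  have hfin : (𝔭.toAddSubgroup.subtype).range.FiniteIndex := by
    rw [AddSubgroup.range_subtype]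
    have : Finite (𝓞 F ⧸ 𝔭.toAddSubgroup) := this
    exact AddSubgroup.finiteIndex_of_finite_quotient
  obtain ⟨r, -, hr⟩ := exists_mean_indicator 𝔭.toAddSubgroup.subtype hfin
  refine ⟨π, r, fun ψ hψ => ⟨hψ.comp_mul fun y => ⟨fun hy => ?_, fun hy => ?_⟩, ?_⟩⟩
  · rw [sq]
    exact Ideal.mul_mem_mul (Ideal.mul_mem_mul hπp hπp) hy
  · have h3 : Ideal.span {y} * (𝔭 * 𝔭) ≤ 𝔠 * (𝔭 * 𝔭) := by
      rw [Ideal.span_singleton_mul_le_iff]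
      have h4 : 𝔭 * 𝔭 ≤ 𝔭 * (𝔭 * 𝔭 * 𝔠) ⊔ Ideal.span {π} * Ideal.span {π} := by
        conv_lhs => rw [← hπ]
        rw [Ideal.sup_mul, Ideal.mul_sup, Ideal.mul_sup]
        refine sup_le (sup_le ?_ ?_) (sup_le ?_ le_sup_right)
        · exact le_sup_of_le_left (Ideal.mul_mono_left hle)
        · rw [mul_comm]
          exact le_sup_of_le_left
            (Ideal.mul_mono_left ((Ideal.span_singleton_le_iff_mem _).2 hπp))
        · exact le_sup_of_le_left
            (Ideal.mul_mono_left ((Ideal.span_singleton_le_iff_mem _).2 hπp))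
      intro z hz
      obtain ⟨a, ha, b, hb, rfl⟩ := Submodule.mem_sup.1 (h4 hz)
      rw [mul_add]
      refine Ideal.add_mem _ (Ideal.mul_mem_left _ _ ?_) ?_
      · rw [mul_comm 𝔠]
        exact Ideal.mul_le_right ha
      · rw [Ideal.span_singleton_mul_span_singleton, Ideal.mem_span_singleton'] at hb
        obtain ⟨c, rfl⟩ := hb
        rw [mul_comm 𝔠, show y * (c * (π * π)) = c * (π ^ 2 * y) by ring]
        exact Ideal.mul_mem_left _ _ hy
    have h5 : 𝔭 * 𝔭 ≠ 0 := mul_ne_zero hp0 hp0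
    have h6 := Ideal.dvd_iff_le.2 h3
    rw [mul_dvd_mul_iff_right h5, Ideal.dvd_iff_le, Ideal.span_singleton_le_iff_mem] at h6
    exact h6
  · have hap : AlmostPeriodic fun x => ψ (x ^ 2) := by simpa using hψ.ap h0 1
    have hmem (x : 𝓞 F) : x ∈ 𝔭.toAddSubgroup.subtype.range ↔ x ∈ 𝔭 := by
      rw [AddSubgroup.range_subtype]; rfl
    let φ : 𝓞 F × (𝔭 * 𝔠).toAddSubgroup →+ 𝓞 F :=
      (AddMonoidHom.id _).coprod (𝔭 * 𝔠).toAddSubgroup.subtype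
    have hφ : Function.Surjective φ := fun x => ⟨(x, 0), by simp [φ]⟩
    have h1 : mean (fun x => ψ (x ^ 2)) =
        mean (fun x => if x ∈ 𝔭.toAddSubgroup.subtype.range then ψ (x ^ 2) else 0) := by
      rw [← mean_comp_surjective hap φ hφ, mean_prod (hap.comp φ)]
      congr 1
      funext x
      have h3 (y : (𝔭 * 𝔠).toAddSubgroup) :
          ψ (φ (x, y) ^ 2) = ψ (x ^ 2) * ψ (2 * x * (y : 𝓞 F)) := by
        have : φ (x, y) = x + y := rfl
        rw [this, ← hψ.add]
        refine hψ.congr ?_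
        rw [show (x + (y : 𝓞 F)) ^ 2 - (x ^ 2 + 2 * x * y) = y * y by ring]
        have : (y : 𝓞 F) * y ∈ (𝔭 * 𝔠) * (𝔭 * 𝔠) := Ideal.mul_mem_mul y.2 y.2
        rw [show (𝔭 * 𝔠) * (𝔭 * 𝔠) = (𝔭 * 𝔭 * 𝔠) * 𝔠 by ring] at this
        exact Ideal.mul_le_left this
      have hap2 : AlmostPeriodic fun y : (𝔭 * 𝔠).toAddSubgroup => ψ (2 * x * (y : 𝓞 F)) := by
        have := quotient_finite h0
        have hlin : AlmostPeriodic ψ :=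
          .of_factor (F := 𝓞 F ⧸ 𝔭 * 𝔭 * 𝔠) (Ideal.Quotient.mk (𝔭 * 𝔭 * 𝔠)).toAddMonoidHom
            (g := fun z => ψ z.out) fun x => hψ.congr (by
              rw [← Ideal.Quotient.mk_eq_mk_iff_sub_mem]
              exact (Ideal.Quotient.mk_out _).symm)
        exact hlin.comp ((AddMonoidHom.mulLeft (2 * x)).comp (𝔭 * 𝔠).toAddSubgroup.subtype)
      simp only [h3]
      rw [mean_const_mul hap2, hmem]
      by_cases hx : x ∈ 𝔭
      · rw [if_pos hx]
        have : (fun y : (𝔭 * 𝔠).toAddSubgroup => ψ (2 * x * (y : 𝓞 F))) = fun _ => 1 := by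
          funext y
          refine hψ.eq_one ?_
          have : x * (y : 𝓞 F) ∈ 𝔭 * (𝔭 * 𝔠) := Ideal.mul_mem_mul hx y.2
          rw [mul_assoc, mul_assoc]
          exact Ideal.mul_mem_left _ _ this
        rw [this, mean_const, mul_one]
      · rw [if_neg hx]
        have : ∃ y ∈ 𝔭 * 𝔠, ψ (2 * x * y) ≠ 1 := by
          by_contra! h
          have h3 : Ideal.span {2 * x} * (𝔭 * 𝔠) ≤ 𝔭 * (𝔭 * 𝔠) := by
            rw [Ideal.span_singleton_mul_le_iff]
            intro y hy
            rw [← mul_assoc 𝔭, hψ.mem_iff]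
            intro z
            rw [mul_left_comm]
            exact h _ (Ideal.mul_mem_left _ _ hy)
          have h6 := Ideal.dvd_iff_le.2 h3
          have h5 : 𝔭 * 𝔠 ≠ 0 := mul_ne_zero hp0 hc0
          rw [mul_dvd_mul_iff_right h5, Ideal.dvd_iff_le, Ideal.span_singleton_le_iff_mem] at h6
          exact (hp.mem_or_mem h6).elim h2 hx
        obtain ⟨y, hy, hy1⟩ := this
        rw [mean_char_eq_zero hap2 (fun u v => ?_) (y := ⟨y, hy⟩) hy1, mul_zero]
        rw [← hψ.add, AddSubgroup.coe_add, mul_add]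
    rw [h1, hr _ hap]
    congr 1
    let φ' : 𝓞 F × (𝔭 * 𝔭 * 𝔠).toAddSubgroup →+ 𝔭.toAddSubgroup :=
      ((AddMonoidHom.mulLeft π).coprod (𝔭 * 𝔭 * 𝔠).toAddSubgroup.subtype).codRestrict _
        fun x => 𝔭.add_mem (𝔭.mul_mem_right _ hπp) (hle x.2.2)
    have hφ' : Function.Surjective φ' := by
      rintro ⟨w, hw⟩
      have hw' : w ∈ 𝔭 := hw
      rw [← hπ] at hw'
      obtain ⟨a, ha, b, hb, hab⟩ := Submodule.mem_sup.1 hw'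
      obtain ⟨c, rfl⟩ := Ideal.mem_span_singleton'.1 hb
      refine ⟨(c, ⟨a, ha⟩), Subtype.ext ?_⟩
      change π * c + a = w
      rw [← hab]; ring
    have hap3 := hap.comp 𝔭.toAddSubgroup.subtype
    rw [← mean_comp_surjective hap3 φ' hφ',
      ← mean_comp_surjective (hψ.ap h0 (π ^ 2)) (AddMonoidHom.fst (𝓞 F) (𝔭 * 𝔭 * 𝔠).toAddSubgroup)
        (fun x => ⟨(x, 0), rfl⟩)]
    congr 1
    funext x
    change ψ ((π * x.1 + (x.2 : 𝓞 F)) ^ 2) = ψ (π ^ 2 * x.1 ^ 2)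
    refine hψ.congr ?_
    rw [show (π * x.1 + (x.2 : 𝓞 F)) ^ 2 - π ^ 2 * x.1 ^ 2 = (x.2 : 𝓞 F) * (2 * π * x.1 + x.2) by
      ring]
    exact Ideal.mul_mem_right _ _ x.2.2

lemma twist_aux (n : ℕ) : ∀ (𝔟 : Ideal (𝓞 F)) (ψ : 𝓞 F → ℂ) (u : 𝓞 F), 𝔟 ≠ ⊥ →
    Multiset.card (normalizedFactors 𝔟) = n → HasConductor ψ 𝔟 → IsCoprime 𝔟 (Ideal.span {2}) →
    IsCoprime 𝔟 (Ideal.span {u}) →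
    mean (fun x => ψ (u * x ^ 2)) = quadSym 𝔟 u * mean (fun x => ψ (x ^ 2)) := by
  induction n using Nat.strong_induction_on with
  | _ n ih =>
  intro 𝔟 ψ u h0 hn hψ h2 hu
  by_cases htop : 𝔟 = ⊤
  · subst htop
    have : ∀ x, ψ x = 1 := fun x => hψ.eq_one trivial
    simp only [this, quadSym_top, mean_const]
    simp
  obtain ⟨𝔭, hpm, hle⟩ := Ideal.exists_le_maximal 𝔟 htop
  have hp := hpm.isPrime
  have hp0 : 𝔭 ≠ ⊥ := fun h => h0 (le_bot_iff.1 (h ▸ hle))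
  have h2p : (2 : 𝓞 F) ∉ 𝔭 := notMem_of_isCoprime h2 hp hle
  have hup : u ∉ 𝔭 := notMem_of_isCoprime hu hp hle
  obtain ⟨𝔠, rfl⟩ := Ideal.dvd_iff_le.2 hle
  have hc0 : 𝔠 ≠ ⊥ := fun h => h0 (by rw [h, Ideal.mul_bot])
  have hcard : Multiset.card (normalizedFactors 𝔭) = 1 := by
    rw [normalizedFactors_irreducible (Ideal.prime_of_isPrime hp0 hp).irreducible,
      Multiset.card_singleton]
  rw [normalizedFactors_mul hp0 hc0, Multiset.card_add, hcard] at hn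
  have h2c := h2.of_mul_left_right
  have huc := hu.of_mul_left_right
  by_cases hpc : 𝔠 ≤ 𝔭
  · obtain ⟨𝔡, rfl⟩ := Ideal.dvd_iff_le.2 hpc
    have hd0 : 𝔡 ≠ ⊥ := fun h => hc0 (by rw [h, Ideal.mul_bot])
    rw [normalizedFactors_mul hp0 hd0, Multiset.card_add, hcard] at hn
    have h2d := h2c.of_mul_left_right
    have hud := huc.of_mul_left_right
    rw [← mul_assoc] at hψ h0 hu
    obtain ⟨π, C, hC⟩ := exists_mean_prime_sq hp h0 h2p
    obtain ⟨hc1, hm1⟩ := hC ψ hψ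
    have hψu : HasConductor (fun y => ψ (u * y)) (𝔭 * 𝔭 * 𝔡) := by
      refine hψ.comp_mul fun y => ⟨fun hy => Ideal.mul_mem_left _ _ hy, fun hy => ?_⟩
      obtain ⟨a, ha, b, hb, hab⟩ := Ideal.isCoprime_iff_exists.1 hu
      obtain ⟨c, rfl⟩ := Ideal.mem_span_singleton'.1 hb
      rw [← one_mul y, ← hab, show (a + c * u) * y = y * a + c * (u * y) by ring]
      exact Ideal.add_mem _ (Ideal.mul_mem_left _ _ ha) (Ideal.mul_mem_left _ _ hy)
    obtain ⟨-, hm2⟩ := hC _ hψu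
    have hm3 := ih _ (by omega) 𝔡 _ u hd0 rfl hc1 h2d hud
    have : ∀ x : 𝓞 F, π ^ 2 * (u * x ^ 2) = u * (π ^ 2 * x ^ 2) := fun x => by ring
    simp only [this] at hm3
    rw [hm2, hm3, hm1, quadSym_ideal_mul hp0 hc0, quadSym_ideal_mul hp0 hd0,
      quadSym_prime hp hp0, ← mul_assoc (legSym 𝔭 u), legSym_sq hup, one_mul]
    ring
  · have hcop : IsCoprime 𝔭 𝔠 := by
      rw [Ideal.isCoprime_iff_sup_eq]
      exact hpm.out.2 _ (left_lt_sup.2 hpc)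
    obtain ⟨q, hq, p, hp', hpq⟩ := Ideal.isCoprime_iff_exists.1 hcop
    have h1 := hψ.sq_left hp' hq hpq
    have h1' := (mul_comm 𝔭 𝔠 ▸ hψ).sq_left hq hp' (by rw [add_comm, hpq])
    have hm := hψ.mean_coprime h0 hp' hq hpq
    have hm1 := hm 1
    simp only [one_mul] at hm1
    have h3 := h1.twist_prime hp hp0 h2p hup
    have h4 := ih _ (by omega) 𝔠 _ u hc0 rfl h1' h2c huc
    rw [hm u, h3, h4, hm1, quadSym_ideal_mul hp0 hc0, quadSym_prime hp hp0]
    push_cast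
    ring

/-- The twist formula for quadratic Gauss sums of odd conductor. -/
theorem HasConductor.twist {𝔟 : Ideal (𝓞 F)} (hψ : HasConductor ψ 𝔟) (h0 : 𝔟 ≠ ⊥)
    (h2 : IsCoprime 𝔟 (Ideal.span {2})) {u : 𝓞 F} (hu : IsCoprime 𝔟 (Ideal.span {u})) :
    mean (fun x => ψ (u * x ^ 2)) = quadSym 𝔟 u * mean (fun x => ψ (x ^ 2)) :=
  twist_aux _ 𝔟 ψ u h0 rfl hψ h2 hu

end Twist

section Trace

section Coe

variable {F : Type*} [Field F]

@[norm_cast] lemma RingOfIntegers.val_mul (x y : 𝓞 F) : ((x * y : 𝓞 F) : F) = x * y := rfl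

@[norm_cast] lemma RingOfIntegers.val_add (x y : 𝓞 F) : ((x + y : 𝓞 F) : F) = x + y := rfl

@[norm_cast] lemma RingOfIntegers.val_sub (x y : 𝓞 F) : ((x - y : 𝓞 F) : F) = x - y := rfl

@[norm_cast] lemma RingOfIntegers.val_neg (x : 𝓞 F) : ((-x : 𝓞 F) : F) = -x := rfl

@[norm_cast] lemma RingOfIntegers.val_pow (x : 𝓞 F) (n : ℕ) : ((x ^ n : 𝓞 F) : F) = (x : F) ^ n := rfl

@[norm_cast] lemma RingOfIntegers.val_natCast (n : ℕ) : ((n : 𝓞 F) : F) = n := rfl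

@[norm_cast] lemma RingOfIntegers.val_ofNat (n : ℕ) [n.AtLeastTwo] :
    ((ofNat(n) : 𝓞 F) : F) = ofNat(n) := rfl

@[norm_cast] lemma RingOfIntegers.val_zero : ((0 : 𝓞 F) : F) = 0 := rfl

@[norm_cast] lemma RingOfIntegers.val_one : ((1 : 𝓞 F) : F) = 1 := rfl

@[norm_cast] lemma RingOfIntegers.val_inj {x y : 𝓞 F} : (x : F) = y ↔ x = y :=
  RingOfIntegers.coe_injective.eq_iff

end Coe

variable {F : Type*} [Field F] [NumberField F]

/-- The additive character `x ↦ exp (2πi Tr x)`. -/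
def eT (x : F) : ℂ := eQ (Algebra.trace ℚ F x)

lemma eT_add (x y : F) : eT (x + y) = eT x * eT y := by
  rw [eT, map_add, eQ_add, eT, eT]

lemma conj_eT (x : F) : starRingEnd ℂ (eT x) = eT (-x) := by
  rw [eT, conj_eQ, eT, map_neg]

lemma eT_coe (x : 𝓞 F) : eT (x : F) = 1 := by
  rw [eT, ← Algebra.coe_trace_int]
  exact eQ_int _

lemma eT_congr {x y : F} (h : ∃ z : 𝓞 F, (z : F) = x - y) : eT x = eT y := by
  obtain ⟨z, hz⟩ := h
  rw [show x = z + y by rw [hz]; ring, eT_add, eT_coe, one_mul]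

lemma exists_nat_mul_integral (t : F) : ∃ N : ℕ, 0 < N ∧ ∃ w : 𝓞 F, (w : F) = N * t := by
  obtain ⟨y, hy, h⟩ := exists_integral_multiples ℤ ℚ {t}
  refine ⟨y.natAbs, Int.natAbs_pos.2 hy, ⟨(y.natAbs : F) * t, ?_⟩, rfl⟩
  have h1 := h t (Finset.mem_singleton_self t)
  rcases Int.natAbs_eq y with h2 | h2
  · rw [h2] at h1
    exact (mem_integralClosure_iff ℤ F).2 (by simpa using h1)
  · rw [h2] at h1
    have := h1.neg
    exact (mem_integralClosure_iff ℤ F).2 (by simpa using this)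

lemma ap_sq (t : F) : AlmostPeriodic fun x : 𝓞 F => eT (t * (x : F) ^ 2) := by
  obtain ⟨N, hN, w, hw⟩ := exists_nat_mul_integral t
  have h0 : Ideal.span {(N : 𝓞 F)} ≠ ⊥ := by
    rw [Ne, Ideal.span_singleton_eq_bot]
    exact_mod_cast hN.ne'
  have := quotient_finite h0
  refine .of_factor (F := 𝓞 F ⧸ Ideal.span {(N : 𝓞 F)})
    (Ideal.Quotient.mk (Ideal.span {(N : 𝓞 F)})).toAddMonoidHom
    (g := fun z => eT (t * ((z.out : 𝓞 F) : F) ^ 2)) fun x => eT_congr ?_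
  have h1 : x - (Ideal.Quotient.mk (Ideal.span {(N : 𝓞 F)}) x).out ∈ Ideal.span {(N : 𝓞 F)} := by
    rw [← Ideal.Quotient.mk_eq_mk_iff_sub_mem]
    exact (Ideal.Quotient.mk_out _).symm
  obtain ⟨c, hc⟩ := Ideal.mem_span_singleton'.1 h1
  set y := (Ideal.Quotient.mk (Ideal.span {(N : 𝓞 F)}) x).out
  refine ⟨w * c * (x + y), ?_⟩
  have h2 : (c : F) * N = x - y := by exact_mod_cast hc
  change ((w * c * (x + y) : 𝓞 F) : F) = t * (x : F) ^ 2 - t * (y : F) ^ 2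
  rw [RingOfIntegers.val_mul, RingOfIntegers.val_mul, RingOfIntegers.val_add, hw]
  linear_combination (t * (x + y)) * h2

/-- `t` is positive under all real embeddings. -/
def TPos (t : F) : Prop := ∀ v : F →+* ℝ, 0 < v t

lemma TPos.mul {s t : F} (hs : TPos s) (ht : TPos t) : TPos (s * t) := fun v => by
  rw [map_mul]; exact mul_pos (hs v) (ht v)

lemma TPos.inv {s : F} (hs : TPos s) : TPos s⁻¹ := fun v => by
  rw [map_inv₀]; exact inv_pos.2 (hs v)

lemma TPos.div {s t : F} (hs : TPos s) (ht : TPos t) : TPos (s / t) :=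
  div_eq_mul_inv s t ▸ hs.mul ht.inv

lemma TPos.natCast {m : ℕ} (hm : 0 < m) : TPos (m : F) := fun v => by
  rw [map_natCast]; exact_mod_cast hm

lemma tpos_sq {s : F} (hs : s ≠ 0) : TPos (s ^ 2) := fun v => by
  rw [map_pow]
  have : v s ≠ 0 := (map_ne_zero v).2 hs
  positivity

lemma trace_pos (hF : ∀ φ : F →+* ℂ, ComplexEmbedding.IsReal φ) {t : F} (ht : TPos t) :
    0 < Algebra.trace ℚ F t := by
  have h := trace_eq_sum_embeddings (K := ℚ) ℂ (x := t)
  have h1 (φ : F →ₐ[ℚ] ℂ) : φ t = (((hF φ.toRingHom).embedding t : ℝ) : ℂ) :=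
    ((hF φ.toRingHom).coe_embedding_apply t).symm
  simp only [h1] at h
  have h2 : ((Algebra.trace ℚ F t : ℚ) : ℝ) = ∑ φ : F →ₐ[ℚ] ℂ, (hF φ.toRingHom).embedding t := by
    have h3 : (((Algebra.trace ℚ F t : ℚ) : ℝ) : ℂ) =
      ((∑ φ : F →ₐ[ℚ] ℂ, (hF φ.toRingHom).embedding t : ℝ) : ℂ) := by
      push_cast
      rw [← h]; rfl
    exact_mod_cast h3
  have h3 : (0 : ℝ) < (Algebra.trace ℚ F t : ℚ) := by
    rw [h2]
    have : Nonempty (F →ₐ[ℚ] ℂ) := ⟨IsAlgClosed.lift⟩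
    exact Finset.sum_pos (fun φ _ => ht _) Finset.univ_nonempty
  exact_mod_cast h3

lemma TPos.ne_zero (hF : ∀ φ : F →+* ℂ, ComplexEmbedding.IsReal φ) {t : F} (ht : TPos t) :
    t ≠ 0 := fun h => by
  have := trace_pos hF ht
  rw [h, map_zero] at this
  exact lt_irrefl _ this

/-- `𝓞 F` and `𝔥` are dual to each other with respect to `(x, y) ↦ Tr (t x y)`. -/
structure DualPair (t : F) (𝔥 : Ideal (𝓞 F)) : Prop where
  left : ∀ y : F, (∀ x : 𝓞 F, eT (t * y * x) = 1) ↔ ∃ h ∈ 𝔥, (h : F) = y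
  ne_bot : 𝔥 ≠ ⊥

lemma DualPair.right {t : F} {𝔥 : Ideal (𝓞 F)} (H : DualPair t 𝔥) (x : F) :
    (∀ h ∈ 𝔥, eT (t * x * (h : F)) = 1) ↔ ∃ w : 𝓞 F, (w : F) = x := by
  constructor
  · intro h
    have hx : IsIntegral (𝓞 F) x := by
      refine isIntegral_of_smul_mem_submodule (Submodule.map (Algebra.linearMap (𝓞 F) F) 𝔥) ?_
        (Submodule.FG.map _ (IsNoetherian.noetherian 𝔥)) x ?_
      · intro h0
        refine H.ne_bot ((Submodule.eq_bot_iff _).2 fun y hy => ?_)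
        have : (y : F) ∈ Submodule.map (Algebra.linearMap (𝓞 F) F) 𝔥 := ⟨y, hy, rfl⟩
        rw [h0, Submodule.mem_bot] at this
        exact_mod_cast this
      · rintro _ ⟨y, hy, rfl⟩
        obtain ⟨z, hz, hz'⟩ := (H.left (x * y)).1 fun u => by
          rw [← h (y * u) (𝔥.mul_mem_right _ hy)]
          push_cast
          congr 1; ring
        exact ⟨z, hz, hz'⟩
    have hx' : IsIntegral ℤ x := isIntegral_trans x hx
    exact ⟨⟨x, hx'⟩, rfl⟩
  · rintro ⟨w, rfl⟩ h hh
    rw [mul_right_comm]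
    exact (H.left h).2 ⟨h, hh, rfl⟩ w

lemma DualPair.div {t : F} {𝔥 : Ideal (𝓞 F)} (H : DualPair t 𝔥) {c : 𝓞 F} (hc : c ≠ 0) :
    DualPair (t / c) (Ideal.span {c} * 𝔥) where
  ne_bot := mul_ne_zero (by simpa using hc) H.ne_bot
  left y := by
    have hc' : (c : F) ≠ 0 := by exact_mod_cast hc
    have := H.left (y / c)
    rw [show t / (c : F) * y = t * (y / c) by ring, this]
    constructor
    · rintro ⟨h, hh, h1⟩
      refine ⟨c * h, Ideal.mul_mem_mul (Ideal.mem_span_singleton_self c) hh, ?_⟩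
      rw [RingOfIntegers.val_mul, h1]; field_simp
    · rintro ⟨z, hz, rfl⟩
      obtain ⟨h, hh, rfl⟩ := Ideal.mem_span_singleton_mul.1 hz
      refine ⟨h, hh, ?_⟩
      rw [RingOfIntegers.val_mul]; field_simp

lemma eT_eq_one_iff_different (z : F) : (∀ x : 𝓞 F, eT (z * x) = 1) ↔
    ∀ d ∈ differentIdeal ℤ (𝓞 F), ∃ w : 𝓞 F, (w : F) = z * d := by
  have h1 : (∀ x : 𝓞 F, eT (z * x) = 1) ↔
      z ∈ FractionalIdeal.dual ℤ ℚ (1 : FractionalIdeal (nonZeroDivisors (𝓞 F)) F) := by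
    rw [FractionalIdeal.mem_dual (one_ne_zero' (FractionalIdeal (nonZeroDivisors (𝓞 F)) F))]
    constructor
    · rintro h a ha
      obtain ⟨x, rfl⟩ := (FractionalIdeal.mem_one_iff _).1 ha
      obtain ⟨n, hn⟩ := (eQ_eq_one_iff _).1 (h x)
      exact ⟨n, by rw [Algebra.traceForm_apply, hn]; rfl⟩
    · rintro h x
      obtain ⟨n, hn⟩ := h x ((FractionalIdeal.mem_one_iff _).2 ⟨x, rfl⟩)
      rw [Algebra.traceForm_apply] at hn
      exact (eQ_eq_one_iff _).2 ⟨n, hn.symm⟩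
  have h0 : differentIdeal ℤ (𝓞 F) ≠ ⊥ := differentIdeal_ne_bot
  have h2 : FractionalIdeal.dual ℤ ℚ (1 : FractionalIdeal (nonZeroDivisors (𝓞 F)) F) =
      (differentIdeal ℤ (𝓞 F) : FractionalIdeal (nonZeroDivisors (𝓞 F)) F)⁻¹ := by
    rw [coeIdeal_differentIdeal ℤ ℚ, inv_inv]
  rw [h1, h2, FractionalIdeal.mem_inv_iff (by simpa using h0)]
  constructor
  · intro h d hd
    exact (FractionalIdeal.mem_one_iff _).1 (h d (FractionalIdeal.mem_coeIdeal_of_mem _ hd))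
  · intro h y hy
    obtain ⟨d, hd, rfl⟩ := (FractionalIdeal.mem_coeIdeal _).1 hy
    exact (FractionalIdeal.mem_one_iff _).2 (h d hd)

/-- There is an element of a coset of a nonzero ideal that is totally positive. -/
lemma exists_tpos_sub_mem {𝔟 : Ideal (𝓞 F)} (hb : 𝔟 ≠ ⊥) (x : 𝓞 F) :
    ∃ y : 𝓞 F, y - x ∈ 𝔟 ∧ TPos (y : F) := by
  obtain ⟨k, hk⟩ : ∃ k : ℕ, ∀ v : F →+* ℝ, -v x < k := by
    have : Finite (F →+* ℝ) :=
      Finite.of_injective (fun v : F →+* ℝ => (Complex.ofRealHom.comp v : F →+* ℂ)) fun v w h => by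
        ext z
        have := DFunLike.congr_fun h z
        exact Complex.ofReal_injective this
    obtain ⟨M, hM⟩ := (Set.finite_range fun v : F →+* ℝ => -v x).bddAbove
    obtain ⟨k, hk⟩ := exists_nat_gt M
    exact ⟨k, fun v => (hM ⟨v, rfl⟩).trans_lt hk⟩
  have hN : 0 < Ideal.absNorm 𝔟 := Nat.pos_of_ne_zero (by rwa [Ne, Ideal.absNorm_eq_zero_iff])
  refine ⟨x + k * Ideal.absNorm 𝔟, ?_, fun v => ?_⟩
  · rw [add_sub_cancel_left]
    exact 𝔟.mul_mem_left _ (Ideal.absNorm_mem 𝔟)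
  · have h1 : ((x + k * Ideal.absNorm 𝔟 : 𝓞 F) : F) = x + k * Ideal.absNorm 𝔟 := by push_cast; rfl
    rw [h1, map_add, map_mul, map_natCast, map_natCast]
    have h2 : (1 : ℝ) ≤ Ideal.absNorm 𝔟 := by exact_mod_cast hN
    have h3 : (0 : ℝ) ≤ k := by positivity
    nlinarith [hk v]

/-- A totally positive element of a nonzero ideal with cofactor prime to a given ideal. -/
lemma exists_tpos_span_eq_mul {𝔞 𝔫 : Ideal (𝓞 F)} (ha : 𝔞 ≠ ⊥) (hn : 𝔫 ≠ ⊥) :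
    ∃ (r : 𝓞 F) (𝔥 : Ideal (𝓞 F)), TPos (r : F) ∧ Ideal.span {r} = 𝔞 * 𝔥 ∧ IsCoprime 𝔥 𝔫 := by
  have h0 : 𝔞 * 𝔫 ≠ ⊥ := mul_ne_zero ha hn
  obtain ⟨s, hs⟩ := IsDedekindDomain.exists_sup_span_eq (Ideal.mul_le_left : 𝔞 * 𝔫 ≤ 𝔞) h0
  obtain ⟨r, hr, hrp⟩ := exists_tpos_sub_mem h0 s
  have hrs : 𝔞 * 𝔫 ⊔ Ideal.span {r} = 𝔞 := by
    apply le_antisymm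
    · refine sup_le Ideal.mul_le_left ((Ideal.span_singleton_le_iff_mem _).2 ?_)
      rw [show r = (r - s) + s by ring]
      exact 𝔞.add_mem (Ideal.mul_le_left hr) (hs ▸ Ideal.mem_sup_right (Ideal.mem_span_singleton_self s))
    · conv_lhs => rw [← hs]
      refine sup_le le_sup_left ((Ideal.span_singleton_le_iff_mem _).2 ?_)
      rw [show s = -(r - s) + r by ring]
      exact Ideal.add_mem _ (Ideal.mem_sup_left (neg_mem hr))
        (Ideal.mem_sup_right (Ideal.mem_span_singleton_self r))
  obtain ⟨𝔥, hh⟩ : 𝔞 ∣ Ideal.span {r} := Ideal.dvd_iff_le.2 (le_sup_right.trans hrs.le)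
  refine ⟨r, 𝔥, hrp, hh, ?_⟩
  rw [hh, ← Ideal.mul_sup] at hrs
  rw [Ideal.isCoprime_iff_sup_eq, sup_comm]
  have : 𝔞 * (𝔫 ⊔ 𝔥) = 𝔞 * ⊤ := by rw [hrs, Ideal.mul_top]
  exact mul_left_cancel₀ (show 𝔞 ≠ 0 from ha) this

lemma exists_dualPair (hF : ∀ φ : F →+* ℂ, ComplexEmbedding.IsReal φ) {𝔫 : Ideal (𝓞 F)}
    (hn : 𝔫 ≠ ⊥) : ∃ (t : F) (𝔥 : Ideal (𝓞 F)), TPos t ∧ DualPair t 𝔥 ∧ IsCoprime 𝔥 𝔫 := by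
  have h0 : differentIdeal ℤ (𝓞 F) ≠ ⊥ := differentIdeal_ne_bot
  obtain ⟨r, 𝔥, hr, hrh, hcop⟩ := exists_tpos_span_eq_mul h0 hn
  have hr0 : (r : F) ≠ 0 := hr.ne_zero hF
  refine ⟨(r : F)⁻¹, 𝔥, hr.inv, ⟨fun y => ?_, ?_⟩, hcop⟩
  · rw [eT_eq_one_iff_different]
    constructor
    · intro h
      have h1 : ∃ z : 𝓞 F, (z : F) = y := by
        have h2 : r ∈ differentIdeal ℤ (𝓞 F) := by
          have := Ideal.mem_span_singleton_self r
          rw [hrh] at this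
          exact Ideal.mul_le_left this
        obtain ⟨w, hw⟩ := h r h2
        exact ⟨w, by rw [hw]; field_simp⟩
      obtain ⟨z, rfl⟩ := h1
      refine ⟨z, ?_, rfl⟩
      have h2 : Ideal.span {z} * differentIdeal ℤ (𝓞 F) ≤ 𝔥 * differentIdeal ℤ (𝓞 F) := by
        rw [mul_comm 𝔥, ← hrh, Ideal.span_singleton_mul_le_iff]
        intro d hd
        obtain ⟨w, hw⟩ := h d hd
        refine Ideal.mem_span_singleton'.2 ⟨w, RingOfIntegers.coe_injective ?_⟩
        change ((w * r : 𝓞 F) : F) = ((z * d : 𝓞 F) : F)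
        rw [RingOfIntegers.val_mul, RingOfIntegers.val_mul, hw]; field_simp
      have h3 := Ideal.dvd_iff_le.2 h2
      rwa [mul_dvd_mul_iff_right (show differentIdeal ℤ (𝓞 F) ≠ 0 from h0), Ideal.dvd_iff_le,
        Ideal.span_singleton_le_iff_mem] at h3
    · rintro ⟨z, hz, rfl⟩ d hd
      have : d * z ∈ Ideal.span {r} := hrh ▸ Ideal.mul_mem_mul hd hz
      obtain ⟨w, hw⟩ := Ideal.mem_span_singleton'.1 this
      refine ⟨w, ?_⟩
      have h2 : (w : F) * r = d * z := by exact_mod_cast hw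
      field_simp
      linear_combination h2
  · rintro rfl
    rw [Ideal.mul_bot, Ideal.span_singleton_eq_bot] at hrh
    exact hr0 (by exact_mod_cast hrh)

/-- The argument of a quadratic Gauss sum with a totally positive coefficient. -/
lemma gauss_arch (hF : ∀ φ : F →+* ℂ, ComplexEmbedding.IsReal φ) {t : F} {𝔥 : Ideal (𝓞 F)}
    (ht : TPos t) (H : DualPair t 𝔥) {m : ℕ} (hm : 0 < m) :
    ∃ r : ℝ, 0 < r ∧ mean (fun x : 𝓞 F => eT (t / (4 * m) * (x : F) ^ 2)) =
      r * Complex.exp (Real.pi * Complex.I / 4) ^ Module.finrank ℚ F := by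
  have hm0 : (m : F) ≠ 0 := by exact_mod_cast hm.ne'
  set s : F := t / (4 * m) with hs
  have hsp : TPos s := ht.div (by exact_mod_cast TPos.natCast (F := F) (m := 4 * m) (by omega))
  let B : LinearMap.BilinForm ℚ F := (Algebra.traceForm ℚ F).compLeft (LinearMap.mulLeft ℚ s)
  have hB (x y : F) : B x y = Algebra.trace ℚ F (s * x * y) := rfl
  let ι : 𝓞 F →+ F := (algebraMap (𝓞 F) F).toAddMonoidHom
  let M' : AddSubgroup F := ι.range
  let M : AddSubgroup F := (𝔥.toAddSubgroup.map ι).map (AddMonoidHom.mulLeft (2 * (m : F)))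
  have hM (y : F) : y ∈ M ↔ ∃ h ∈ 𝔥, 2 * (m : F) * h = y := by
    constructor
    · rintro ⟨_, ⟨h, hh, rfl⟩, rfl⟩
      exact ⟨h, hh, rfl⟩
    · rintro ⟨h, hh, rfl⟩
      exact ⟨_, ⟨h, hh, rfl⟩, rfl⟩
  have key := exists_mean_eQ_dual B (fun x y => by rw [hB, hB]; congr 1; ring)
    (fun x hx => by
      rw [hB, mul_assoc, ← sq]
      exact trace_pos hF (hsp.mul (tpos_sq hx))) M M' ?_ ?_ ?_
  · obtain ⟨r, hr, h⟩ := key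
    refine ⟨r, hr, h ▸ ?_⟩
    let φ : 𝓞 F ≃+ M' := AddMonoidHom.ofInjective (f := ι) RingOfIntegers.coe_injective
    have hap : AlmostPeriodic fun x : M' => eQ (B x x) := by
      have := (ap_sq s).comp φ.symm.toAddMonoidHom
      convert this using 2 with x
      obtain ⟨y, rfl⟩ := φ.surjective x
      have h2 : (φ.symm.toAddMonoidHom (φ y)) = y := φ.symm_apply_apply y
      rw [h2, hB]
      change eQ (Algebra.trace ℚ F (s * (y : F) * y)) = _
      rw [eT]; congr 2; ring
    rw [← mean_comp_surjective hap φ.toAddMonoidHom φ.surjective]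
    congr 1
    funext y
    change _ = eQ (Algebra.trace ℚ F (s * (y : F) * y))
    rw [eT]; congr 2; ring
  · intro v
    obtain ⟨N, hN, w, hw⟩ := exists_nat_mul_integral v
    have hN' : 0 < Ideal.absNorm 𝔥 :=
      Nat.pos_of_ne_zero (by rw [Ne, Ideal.absNorm_eq_zero_iff]; exact H.ne_bot)
    refine ⟨2 * m * Ideal.absNorm 𝔥 * N, by positivity, (hM _).2 ⟨Ideal.absNorm 𝔥 * w,
      Ideal.mul_mem_right _ _ (Ideal.absNorm_mem 𝔥), ?_⟩⟩
    rw [RingOfIntegers.val_mul, RingOfIntegers.val_natCast, hw, nsmul_eq_mul]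
    push_cast
    ring
  · intro y hy
    obtain ⟨h, hh, rfl⟩ := (hM y).1 hy
    obtain ⟨n, hn⟩ := (eQ_eq_one_iff _).1 ((H.left h).2 ⟨h, hh, rfl⟩ (m * h))
    refine ⟨n, ?_⟩
    rw [← hn, hB]
    congr 1
    push_cast
    rw [hs]; field_simp; ring
  · intro x
    have h1 : x ∈ M' ↔ ∃ w : 𝓞 F, (w : F) = x := Iff.rfl
    rw [h1, ← H.right]
    constructor
    · intro h y hy
      obtain ⟨g, hg, rfl⟩ := (hM y).1 hy
      obtain ⟨n, hn⟩ := (eQ_eq_one_iff _).1 (h g hg)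
      refine ⟨n, ?_⟩
      rw [← hn, hB, ← smul_eq_mul (2 : ℚ), ← map_smul]
      congr 1
      rw [hs, Algebra.smul_def, map_ofNat]; field_simp; ring
    · intro h g hg
      obtain ⟨n, hn⟩ := h _ ((hM _).2 ⟨g, hg, rfl⟩)
      refine (eQ_eq_one_iff _).2 ⟨n, ?_⟩
      rw [← hn, hB, ← smul_eq_mul (2 : ℚ), ← map_smul]
      congr 1
      rw [hs, Algebra.smul_def, map_ofNat]; field_simp; ring

end Trace

section Reciprocity

variable {F : Type*} [Field F] [NumberField F]

lemma ap_const {A : Type*} [AddCommGroup A] (c : ℂ) : AlmostPeriodic fun _ : A => c :=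
  .of_factor (0 : A →+ Unit) (g := fun _ => c) fun _ => rfl

lemma isCoprime_span_iff {𝔥 : Ideal (𝓞 F)} {x : 𝓞 F} :
    IsCoprime 𝔥 (Ideal.span {x}) ↔ ∃ p ∈ 𝔥, ∃ j, p + j * x = 1 := by
  rw [Ideal.isCoprime_iff_exists]
  constructor
  · rintro ⟨p, hp, q, hq, h⟩
    obtain ⟨j, rfl⟩ := Ideal.mem_span_singleton'.1 hq
    exact ⟨p, hp, j, h⟩
  · rintro ⟨p, hp, j, h⟩
    exact ⟨p, hp, j * x, Ideal.mul_mem_left _ _ (Ideal.mem_span_singleton_self x), h⟩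

lemma mem_of_mul_mem_of_isCoprime {𝔥 : Ideal (𝓞 F)} {x y : 𝓞 F}
    (h : IsCoprime 𝔥 (Ideal.span {x})) (hy : x * y ∈ 𝔥) : y ∈ 𝔥 := by
  obtain ⟨p, hp, j, hj⟩ := isCoprime_span_iff.1 h
  rw [show y = y * p + j * (x * y) by linear_combination (-y) * hj]
  exact 𝔥.add_mem (𝔥.mul_mem_left _ hp) (𝔥.mul_mem_left _ hy)

/-- The coefficient of the residue characters used for quadratic reciprocity. -/
lemma hasConductor_div {t : F} {𝔥 : Ideal (𝓞 F)} (H : DualPair t 𝔥) {a w m : 𝓞 F} (ha : a ≠ 0)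
    (hw : w ∈ 𝔥) (hw1 : w - 1 ∈ Ideal.span {a}) (hm : IsCoprime (Ideal.span {a}) (Ideal.span {m})) :
    HasConductor (fun y : 𝓞 F => eT (t * m * w ^ 2 / a * y)) (Ideal.span {a}) where
  add x y := by
    rw [← eT_add, ← mul_add]; rfl
  mem_iff y := by
    have ha' : (a : F) ≠ 0 := by exact_mod_cast ha
    have h1 : (∀ x : 𝓞 F, eT (t * m * w ^ 2 / a * (x * y : 𝓞 F)) = 1) ↔
        ∃ h ∈ 𝔥, (h : F) = m * w ^ 2 * y / a := by
      rw [← H.left]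
      refine forall_congr' fun x => ?_
      rw [RingOfIntegers.val_mul, show t * m * w ^ 2 / a * ((x : F) * y) =
        t * (m * w ^ 2 * y / a) * x by ring]
    rw [h1]
    constructor
    · intro hy
      obtain ⟨c, rfl⟩ := Ideal.mem_span_singleton'.1 hy
      refine ⟨m * w ^ 2 * c, Ideal.mul_mem_right _ _ (Ideal.mul_mem_left _ _
        (by rw [sq]; exact Ideal.mul_mem_left _ _ hw)), ?_⟩
      simp only [RingOfIntegers.val_mul, RingOfIntegers.val_pow]
      field_simp
    · rintro ⟨h, hh, h2⟩
      have h3 : m * (w ^ 2 * y) = h * a := by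
        have : (m : F) * (w ^ 2 * y) = h * a := by rw [h2]; field_simp
        exact_mod_cast this
      have h4 : w ^ 2 * y ∈ Ideal.span {a} :=
        mem_of_mul_mem_of_isCoprime hm (h3 ▸ Ideal.mul_mem_left _ _ (Ideal.mem_span_singleton_self a))
      have h5 : IsCoprime (Ideal.span {a}) (Ideal.span {w}) :=
        isCoprime_span_iff.2 ⟨-(w - 1), neg_mem hw1, 1, by ring⟩
      rw [sq, mul_assoc] at h4
      exact mem_of_mul_mem_of_isCoprime h5 (mem_of_mul_mem_of_isCoprime h5 h4)

lemma hasConductor_dual {t : F} {𝔥 : Ideal (𝓞 F)} (H : DualPair t 𝔥) {m : 𝓞 F}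
    (hm : IsCoprime 𝔥 (Ideal.span {m})) :
    HasConductor (fun y : 𝓞 F => eT (t * m * y)) 𝔥 where
  add x y := by
    rw [← eT_add, ← mul_add]; rfl
  mem_iff y := by
    have h1 : (∀ x : 𝓞 F, eT (t * m * (x * y : 𝓞 F)) = 1) ↔
        ∃ h ∈ 𝔥, (h : F) = m * y := by
      rw [← H.left]
      refine forall_congr' fun x => ?_
      rw [RingOfIntegers.val_mul, show t * m * ((x : F) * y) = t * (m * y) * x by ring]
    rw [h1]
    constructor
    · exact fun hy => ⟨m * y, Ideal.mul_mem_left _ _ hy, rfl⟩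
    · rintro ⟨h, hh, h2⟩
      have h3 : h = m * y := by exact_mod_cast h2
      exact mem_of_mul_mem_of_isCoprime hm (h3 ▸ hh)

lemma ap_sq_ideal (t : F) (𝔥 : Ideal (𝓞 F)) :
    AlmostPeriodic fun x : 𝔥.toAddSubgroup => eT (t * ((x : 𝓞 F) : F) ^ 2) :=
  (ap_sq t).comp 𝔥.toAddSubgroup.subtype

/-- Multiplying a quadratic Gauss sum by a scalar `a ≡ 1 (mod 4m)`. -/
lemma mean_scale {t : F} {𝔥 : Ideal (𝓞 F)} (H : DualPair t 𝔥) {m : ℕ} (hm : 0 < m) {a : 𝓞 F}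
    (hha : IsCoprime 𝔥 (Ideal.span {a})) (hhm : IsCoprime 𝔥 (Ideal.span {2 * (m : 𝓞 F)}))
    (ha1 : a - 1 ∈ Ideal.span {4 * (m : 𝓞 F)}) :
    mean (fun x : 𝓞 F => eT (t * a / (4 * m) * (x : F) ^ 2)) =
      quadSym 𝔥 a * mean (fun x : 𝓞 F => eT (t / (4 * m) * (x : F) ^ 2)) := by
  have hm0 : (m : F) ≠ 0 := by exact_mod_cast hm.ne'
  obtain ⟨p, hp, j, hj⟩ := isCoprime_span_iff.1 hhm
  let φ : 𝓞 F × 𝔥.toAddSubgroup →+ 𝓞 F :=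
    (AddMonoidHom.mulLeft (2 * (m : 𝓞 F))).coprod 𝔥.toAddSubgroup.subtype
  have hφ : Function.Surjective φ := fun x => by
    refine ⟨(j * x, ⟨p * x, Ideal.mul_mem_right _ _ hp⟩), ?_⟩
    change 2 * (m : 𝓞 F) * (j * x) + p * x = x
    linear_combination x * hj
  have split (κ : 𝓞 F) : mean (fun x : 𝓞 F => eT (t * κ / (4 * m) * (x : F) ^ 2)) =
      mean (fun x : 𝓞 F => eT (t * κ * m * (x : F) ^ 2)) *
      mean (fun x : 𝔥.toAddSubgroup => eT (t * κ / (4 * m) * ((x : 𝓞 F) : F) ^ 2)) := by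
    refine mean_eq_mul (ap_sq _) (ap_sq _) (ap_sq_ideal _ _) φ hφ fun u v => ?_
    change eT (t * κ / (4 * m) * (((2 * (m : 𝓞 F) * u + v : 𝓞 F) : F)) ^ 2) = _
    have h1 := (H.left (v : 𝓞 F)).2 ⟨v, v.2, rfl⟩ (κ * u)
    rw [← eT_add, ← mul_one (eT (_ + _)), ← h1, ← eT_add]
    congr 1
    simp only [RingOfIntegers.val_mul, RingOfIntegers.val_add, RingOfIntegers.val_ofNat,
      RingOfIntegers.val_natCast]
    field_simp
    ring
  have hD : mean (fun x : 𝔥.toAddSubgroup => eT (t * a / (4 * m) * ((x : 𝓞 F) : F) ^ 2)) =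
      mean (fun x : 𝔥.toAddSubgroup => eT (t * (1 : 𝓞 F) / (4 * m) * ((x : 𝓞 F) : F) ^ 2)) := by
    congr 1
    funext v
    obtain ⟨k, hk⟩ := Ideal.mem_span_singleton'.1 ha1
    have h1 := (H.left (v : 𝓞 F)).2 ⟨v, v.2, rfl⟩ (k * v)
    rw [← mul_one (eT (t * (1 : 𝓞 F) / _ * _)), ← h1, ← eT_add]
    congr 1
    have hk' : (k : F) * (4 * m) = a - 1 := by
      have := congrArg (fun z : 𝓞 F => (z : F)) hk
      simpa only [RingOfIntegers.val_mul, RingOfIntegers.val_sub, RingOfIntegers.val_ofNat,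
        RingOfIntegers.val_natCast, RingOfIntegers.val_one] using this
    have ha : (a : F) = 1 + k * (4 * m) := by rw [hk']; ring
    rw [ha, RingOfIntegers.val_mul, RingOfIntegers.val_one]
    field_simp
  rw [mul_comm (2 : 𝓞 F), ← Ideal.span_singleton_mul_span_singleton] at hhm
  have hψ := hasConductor_dual H hhm.of_mul_right_left
  have hB := hψ.twist H.ne_bot hhm.of_mul_right_right hha
  have hB' : mean (fun x : 𝓞 F => eT (t * a * m * (x : F) ^ 2)) =
      quadSym 𝔥 a * mean (fun x : 𝓞 F => eT (t * (1 : 𝓞 F) * m * (x : F) ^ 2)) := by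
    convert hB using 4 with x
    · simp only [RingOfIntegers.val_mul, RingOfIntegers.val_pow, RingOfIntegers.val_natCast]; ring
    · simp only [RingOfIntegers.val_pow, RingOfIntegers.val_natCast,
        RingOfIntegers.val_one]; ring_nf
  have h1 := split 1
  rw [split a, hD, hB', mul_assoc, ← h1, RingOfIntegers.val_one, mul_one]

/-- The quadratic Gauss sum modulo a totally positive `a ≡ 1 (mod 4m)`. -/
lemma exists_mean_div (hF : ∀ φ : F →+* ℂ, ComplexEmbedding.IsReal φ) {t : F} {𝔥 : Ideal (𝓞 F)}
    (ht : TPos t) (H : DualPair t 𝔥) {m : ℕ} (hm : 0 < m) {a : 𝓞 F} (ha : TPos (a : F))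
    (hha : IsCoprime 𝔥 (Ideal.span {a})) (hhm : IsCoprime 𝔥 (Ideal.span {2 * (m : 𝓞 F)}))
    (ha1 : a - 1 ∈ Ideal.span {4 * (m : 𝓞 F)}) {w : 𝓞 F} (hw : w ∈ 𝔥)
    (hw1 : w - 1 ∈ Ideal.span {a}) :
    ∃ r : ℝ, 0 < r ∧ mean (fun x : 𝓞 F => eT (t * m * w ^ 2 / a * (x : F) ^ 2)) =
      quadSym 𝔥 a * r := by
  have hm0 : (m : F) ≠ 0 := by exact_mod_cast hm.ne'
  have ha0 : (a : F) ≠ 0 := ha.ne_zero hF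
  have ha0' : a ≠ 0 := by exact_mod_cast ha0
  obtain ⟨r1, hr1, h1⟩ := gauss_arch hF (ht.div ha) (H.div ha0') hm
  obtain ⟨r0, hr0, h0⟩ := gauss_arch hF ht H hm
  have hA := mean_scale H hm hha hhm ha1
  obtain ⟨k, hk⟩ := Ideal.mem_span_singleton'.1 ha1
  obtain ⟨j, hj⟩ := Ideal.mem_span_singleton'.1 hw1
  set W := mean (fun x : 𝔥.toAddSubgroup => eT (t * m / a * ((x : 𝓞 F) : F) ^ 2)) with hW
  have hG : mean (fun x : 𝓞 F => eT (t / a / (4 * m) * (x : F) ^ 2)) =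
      mean (fun x : 𝓞 F => eT (t * a / (4 * m) * (x : F) ^ 2)) * W := by
    let φ : 𝓞 F × 𝔥.toAddSubgroup →+ 𝓞 F := (AddMonoidHom.mulLeft a).coprod
      ((AddMonoidHom.mulLeft (2 * (m : 𝓞 F))).comp 𝔥.toAddSubgroup.subtype)
    have hφ : Function.Surjective φ := fun x => by
      refine ⟨((1 + 4 * m * k * j) * x, ⟨w * (-2 * k * x), Ideal.mul_mem_right _ _ hw⟩), ?_⟩
      change a * ((1 + 4 * m * k * j) * x) + 2 * (m : 𝓞 F) * (w * (-2 * k * x)) = x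
      linear_combination (4 * m * k * x) * hj - x * hk
    refine mean_eq_mul (ap_sq _) (ap_sq _) (ap_sq_ideal _ _) φ hφ fun u v => ?_
    change eT (t / a / (4 * m) * (((a * u + 2 * (m : 𝓞 F) * v : 𝓞 F) : F)) ^ 2) = _
    have h2 := (H.left (v : 𝓞 F)).2 ⟨v, v.2, rfl⟩ u
    rw [← eT_add, ← mul_one (eT (_ + _)), ← h2, ← eT_add]
    congr 1
    simp only [RingOfIntegers.val_mul, RingOfIntegers.val_add, RingOfIntegers.val_ofNat,
      RingOfIntegers.val_natCast]
    field_simp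
    ring
  have hWW : W = mean (fun x : 𝓞 F => eT (t * m * w ^ 2 / a * (x : F) ^ 2)) := by
    let φ : 𝓞 F × 𝔥.toAddSubgroup →+ 𝔥.toAddSubgroup :=
      ((AddMonoidHom.mulLeft w).coprod
        ((AddMonoidHom.mulLeft a).comp 𝔥.toAddSubgroup.subtype)).codRestrict _
        fun x => 𝔥.add_mem (𝔥.mul_mem_right _ hw) (𝔥.mul_mem_left _ x.2.2)
    have hφ : Function.Surjective φ := fun v => by
      refine ⟨(v, ⟨-j * v, Ideal.mul_mem_left _ _ v.2⟩), Subtype.ext ?_⟩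
      change w * (v : 𝓞 F) + a * (-j * v) = v
      linear_combination -(v : 𝓞 F) * hj
    rw [← mul_one (mean fun x : 𝓞 F => _), ← mean_const (A := 𝔥.toAddSubgroup) 1]
    refine mean_eq_mul (ap_sq_ideal _ _) (ap_sq _) (ap_const 1) φ hφ fun u v => ?_
    change eT (t * m / a * (((w * u + a * v : 𝓞 F) : F)) ^ 2) = _
    have h2 := (H.left (v : 𝓞 F)).2 ⟨v, v.2, rfl⟩ (2 * m * w * u + m * a * v)
    rw [← h2, ← eT_add]
    congr 1
    simp only [RingOfIntegers.val_mul, RingOfIntegers.val_add, RingOfIntegers.val_ofNat,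
      RingOfIntegers.val_natCast]
    field_simp
    ring
  refine ⟨r1 / r0, div_pos hr1 hr0, ?_⟩
  rw [← hWW]
  rw [hG, hA, h0] at h1
  have hω : Complex.exp (Real.pi * Complex.I / 4) ^ Module.finrank ℚ F ≠ 0 :=
    pow_ne_zero _ (Complex.exp_ne_zero _)
  have hr0' : (r0 : ℂ) ≠ 0 := by exact_mod_cast hr0.ne'
  have hq : ((quadSym 𝔥 a : ℤ) : ℂ) * (quadSym 𝔥 a : ℤ) = 1 := by
    exact_mod_cast quadSym_mul_self hha
  have h3 : (quadSym 𝔥 a : ℂ) * r0 * W = r1 := by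
    apply mul_right_cancel₀ hω
    linear_combination h1
  push_cast
  field_simp
  linear_combination (quadSym 𝔥 a : ℂ) * h3 - r0 * W * hq

lemma intCast_mul_pos_eq {q q' : ℤ} (hq : q = 1 ∨ q = -1) (hq' : q' = 1 ∨ q' = -1) {r r' : ℝ}
    (hr : 0 < r) (hr' : 0 < r') (h : (q : ℂ) * r = q' * r') : q = q' := by
  have h' : (q : ℝ) * r = q' * r' := by exact_mod_cast h
  rcases hq with rfl | rfl <;> rcases hq' with rfl | rfl <;> push_cast at h' <;>
    first | rfl | (exfalso; linarith)

lemma isCoprime_of_sub_one_mem {a x : 𝓞 F} (h : a - 1 ∈ Ideal.span {x}) :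
    IsCoprime (Ideal.span {a}) (Ideal.span {x}) := by
  obtain ⟨k, hk⟩ := Ideal.mem_span_singleton'.1 h
  exact isCoprime_span_iff.2 ⟨a, Ideal.mem_span_singleton_self a, -k, by linear_combination -hk⟩

lemma IsCoprime.span_of_dvd {𝔟 : Ideal (𝓞 F)} {x y : 𝓞 F} (h : IsCoprime 𝔟 (Ideal.span {y}))
    (hxy : x ∣ y) : IsCoprime 𝔟 (Ideal.span {x}) := by
  obtain ⟨z, rfl⟩ := hxy
  rw [← Ideal.span_singleton_mul_span_singleton] at h
  exact h.of_mul_right_left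

/-- Quadratic reciprocity for a primary totally positive integer. -/
theorem quadSym_reciprocity (hF : ∀ φ : F →+* ℂ, ComplexEmbedding.IsReal φ) {a c : 𝓞 F}
    (ha : TPos (a : F)) (hc : TPos (c : F)) (ha1 : a - 1 ∈ Ideal.span {4})
    (hc2 : IsCoprime (Ideal.span {c}) (Ideal.span {2}))
    (hca : IsCoprime (Ideal.span {c}) (Ideal.span {a})) :
    quadSym (Ideal.span {a}) c = quadSym (Ideal.span {c}) a := by
  have ha0 : (a : F) ≠ 0 := ha.ne_zero hF
  have hc0 : (c : F) ≠ 0 := hc.ne_zero hF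
  have ha0' : a ≠ 0 := by exact_mod_cast ha0
  have hc0' : c ≠ 0 := by exact_mod_cast hc0
  obtain ⟨t, 𝔥, ht, H, hcop⟩ := exists_dualPair hF (𝔫 := Ideal.span {2 * a}) (by
    rw [Ne, Ideal.span_singleton_eq_bot]; exact mul_ne_zero two_ne_zero ha0')
  have hha := hcop.span_of_dvd (Dvd.intro_left _ rfl : a ∣ 2 * a)
  have hh2 := hcop.span_of_dvd (Dvd.intro _ rfl : (2 : 𝓞 F) ∣ 2 * a)
  obtain ⟨w, hw, j, hj⟩ := isCoprime_span_iff.1 hha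
  have hw1 : w - 1 ∈ Ideal.span {a} := Ideal.mem_span_singleton'.2 ⟨-j, by linear_combination -hj⟩
  obtain ⟨q, hq, s, hs⟩ := isCoprime_span_iff.1 hca
  obtain ⟨d, rfl⟩ := Ideal.mem_span_singleton'.1 hq
  have ha2 : IsCoprime (Ideal.span {a}) (Ideal.span {2}) :=
    (isCoprime_of_sub_one_mem ha1).span_of_dvd ⟨2, by norm_num⟩
  have ha1' : a - 1 ∈ Ideal.span {4 * ((1 : ℕ) : 𝓞 F)} := by simpa using ha1
  have hh2' : IsCoprime 𝔥 (Ideal.span {2 * ((1 : ℕ) : 𝓞 F)}) := by simpa using hh2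
  obtain ⟨r, hr, h1⟩ := exists_mean_div hF ht H one_pos ha hha hh2' ha1' hw hw1
  have hw' : c * d * w ∈ Ideal.span {c} * 𝔥 := by
    rw [mul_assoc]
    exact Ideal.mul_mem_mul (Ideal.mem_span_singleton_self c) (Ideal.mul_mem_left _ _ hw)
  have hw1' : c * d * w - 1 ∈ Ideal.span {a} := Ideal.mem_span_singleton'.2
    ⟨-j * (c * d) - s, by linear_combination -(c * d) * hj - hs⟩
  obtain ⟨r', hr', h2⟩ := exists_mean_div hF (ht.div hc) (H.div hc0') one_pos ha
    (hca.mul_left hha) ((by simpa using hc2 : IsCoprime _ (Ideal.span {2 * ((1 : ℕ) : 𝓞 F)})).mul_left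
      hh2') ha1' hw' hw1'
  have hψ := hasConductor_div H ha0' hw hw1 (m := ((1 : ℕ) : 𝓞 F)) (isCoprime_span_iff.2
    ⟨0, zero_mem _, 1, by simp⟩)
  have hac : IsCoprime (Ideal.span {a}) (Ideal.span {c}) := hca.symm
  have had : IsCoprime (Ideal.span {a}) (Ideal.span {d}) :=
    isCoprime_span_iff.2 ⟨s * a, Ideal.mul_mem_left _ _ (Ideal.mem_span_singleton_self a), c, by
      linear_combination hs⟩
  have hcd : IsCoprime (Ideal.span {a}) (Ideal.span {c * d ^ 2}) := by
    rw [← Ideal.span_singleton_mul_span_singleton, ← Ideal.span_singleton_pow]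
    exact hac.mul_right had.pow_right
  have h3 := hψ.twist (by simpa using ha0') ha2 hcd
  have h4 : mean (fun x : 𝓞 F => eT (t / c * ((1 : ℕ) : F) * (c * d * w : 𝓞 F) ^ 2 / a * (x : F) ^ 2)) =
      quadSym (Ideal.span {a}) (c * d ^ 2) *
        mean (fun x : 𝓞 F => eT (t * ((1 : ℕ) : F) * w ^ 2 / a * (x : F) ^ 2)) := by
    convert h3 using 4 with x
    · simp only [RingOfIntegers.val_mul, RingOfIntegers.val_pow, RingOfIntegers.val_natCast]
      field_simp
    · rfl
  rw [h1, h2, quadSym_mul, quadSym_sq had, mul_one, quadSym_ideal_mul (by simpa using hc0') H.ne_bot,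
    ← mul_assoc] at h4
  have hq1 := quadSym_eq_one_or hha
  have hq2 := quadSym_eq_one_or hca
  have hq3 := quadSym_eq_one_or hac
  have h5 := intCast_mul_pos_eq
    (q := quadSym (Ideal.span {c}) a * quadSym 𝔥 a) (q' := quadSym (Ideal.span {a}) c * quadSym 𝔥 a)
    (by rcases hq1 with h | h <;> rcases hq2 with h' | h' <;> simp [h, h'])
    (by rcases hq1 with h | h <;> rcases hq3 with h' | h' <;> simp [h, h']) hr' hr
    (by push_cast at h4 ⊢; exact h4)
  have h6 : quadSym 𝔥 a ≠ 0 := by rcases hq1 with h | h <;> simp [h]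
  exact (mul_right_cancel₀ h6 h5).symm

/-- The supplementary law at `2`. -/
theorem quadSym_two (hF : ∀ φ : F →+* ℂ, ComplexEmbedding.IsReal φ) {a : 𝓞 F}
    (ha : TPos (a : F)) (ha1 : a - 1 ∈ Ideal.span {8}) : quadSym (Ideal.span {a}) 2 = 1 := by
  have ha0' : a ≠ 0 := by have := ha.ne_zero hF; exact_mod_cast this
  obtain ⟨t, 𝔥, ht, H, hcop⟩ := exists_dualPair hF (𝔫 := Ideal.span {4 * a}) (by
    rw [Ne, Ideal.span_singleton_eq_bot]; exact mul_ne_zero (by norm_num) ha0')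
  have hha := hcop.span_of_dvd (Dvd.intro_left _ rfl : a ∣ 4 * a)
  have hh4 := hcop.span_of_dvd (Dvd.intro _ rfl : (4 : 𝓞 F) ∣ 4 * a)
  obtain ⟨w, hw, j, hj⟩ := isCoprime_span_iff.1 hha
  have hw1 : w - 1 ∈ Ideal.span {a} := Ideal.mem_span_singleton'.2 ⟨-j, by linear_combination -hj⟩
  have ha2 : IsCoprime (Ideal.span {a}) (Ideal.span {2}) :=
    (isCoprime_of_sub_one_mem ha1).span_of_dvd ⟨4, by norm_num⟩
  have h84 : Ideal.span {(8 : 𝓞 F)} ≤ Ideal.span {4} :=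
    Ideal.span_singleton_le_span_singleton.2 ⟨2, by norm_num⟩
  obtain ⟨r, hr, h1⟩ := exists_mean_div hF ht H one_pos ha hha
    (hh4.span_of_dvd ⟨2, by norm_num⟩) (by simpa using h84 ha1) hw hw1
  obtain ⟨r', hr', h2⟩ := exists_mean_div hF ht H two_pos ha hha
    (by norm_num; exact hh4) (by norm_num; exact ha1) hw hw1
  have hψ := hasConductor_div H ha0' hw hw1 (m := ((1 : ℕ) : 𝓞 F)) (isCoprime_span_iff.2
    ⟨0, zero_mem _, 1, by simp⟩)
  have h3 := hψ.twist (by simpa using ha0') ha2 ha2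
  have h4 : mean (fun x : 𝓞 F => eT (t * ((2 : ℕ) : F) * w ^ 2 / a * (x : F) ^ 2)) =
      quadSym (Ideal.span {a}) 2 *
        mean (fun x : 𝓞 F => eT (t * ((1 : ℕ) : F) * w ^ 2 / a * (x : F) ^ 2)) := by
    convert h3 using 4 with x
    · simp only [RingOfIntegers.val_mul, RingOfIntegers.val_pow, RingOfIntegers.val_natCast,
        RingOfIntegers.val_ofNat]
      push_cast
      ring
    · rfl
  rw [h1, h2, ← mul_assoc] at h4
  have hq1 := quadSym_eq_one_or hha
  have hq2 := quadSym_eq_one_or ha2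
  have h5 := intCast_mul_pos_eq (q := quadSym 𝔥 a) (q' := quadSym (Ideal.span {a}) 2 * quadSym 𝔥 a)
    hq1 (by rcases hq1 with h | h <;> rcases hq2 with h' | h' <;> simp [h, h']) hr' hr
    (by push_cast at h4 ⊢; exact h4)
  have h6 : quadSym 𝔥 a ≠ 0 := by rcases hq1 with h | h <;> simp [h]
  exact (mul_right_cancel₀ h6 (by rw [one_mul]; exact h5)).symm

/-- The supplementary law at `-1`. -/
theorem quadSym_neg_one (hF : ∀ φ : F →+* ℂ, ComplexEmbedding.IsReal φ) {a : 𝓞 F}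
    (ha : TPos (a : F)) (ha1 : a - 1 ∈ Ideal.span {4}) : quadSym (Ideal.span {a}) (-1) = 1 := by
  have ha0' : a ≠ 0 := by have := ha.ne_zero hF; exact_mod_cast this
  obtain ⟨t, 𝔥, ht, H, hcop⟩ := exists_dualPair hF (𝔫 := Ideal.span {2 * a}) (by
    rw [Ne, Ideal.span_singleton_eq_bot]; exact mul_ne_zero two_ne_zero ha0')
  have hha := hcop.span_of_dvd (Dvd.intro_left _ rfl : a ∣ 2 * a)
  have hh2 := hcop.span_of_dvd (Dvd.intro _ rfl : (2 : 𝓞 F) ∣ 2 * a)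
  obtain ⟨w, hw, j, hj⟩ := isCoprime_span_iff.1 hha
  have hw1 : w - 1 ∈ Ideal.span {a} := Ideal.mem_span_singleton'.2 ⟨-j, by linear_combination -hj⟩
  have ha2 : IsCoprime (Ideal.span {a}) (Ideal.span {2}) :=
    (isCoprime_of_sub_one_mem ha1).span_of_dvd ⟨2, by norm_num⟩
  obtain ⟨r, hr, h1⟩ := exists_mean_div hF ht H one_pos ha hha (by simpa using hh2)
    (by simpa using ha1) hw hw1
  have hψ := hasConductor_div H ha0' hw hw1 (m := ((1 : ℕ) : 𝓞 F)) (isCoprime_span_iff.2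
    ⟨0, zero_mem _, 1, by simp⟩)
  have hneg : IsCoprime (Ideal.span {a}) (Ideal.span {-1}) :=
    isCoprime_span_iff.2 ⟨0, zero_mem _, -1, by simp⟩
  have h3 := hψ.twist (by simpa using ha0') ha2 hneg
  have h4 : starRingEnd ℂ (mean fun x : 𝓞 F => eT (t * ((1 : ℕ) : F) * w ^ 2 / a * (x : F) ^ 2)) =
      quadSym (Ideal.span {a}) (-1) *
        mean (fun x : 𝓞 F => eT (t * ((1 : ℕ) : F) * w ^ 2 / a * (x : F) ^ 2)) := by
    rw [← mean_conj (ap_sq _)]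
    convert h3 using 3 with x
    · rw [conj_eT]
      congr 1
      simp only [RingOfIntegers.val_mul, RingOfIntegers.val_pow, RingOfIntegers.val_neg,
        RingOfIntegers.val_one, RingOfIntegers.val_natCast]
      ring
    · rfl
  rw [h1, map_mul, map_intCast, Complex.conj_ofReal, ← mul_assoc] at h4
  have hq1 := quadSym_eq_one_or hha
  have hq2 := quadSym_eq_one_or hneg
  have h5 := intCast_mul_pos_eq (q := quadSym 𝔥 a) (q' := quadSym (Ideal.span {a}) (-1) * quadSym 𝔥 a)
    hq1 (by rcases hq1 with h | h <;> rcases hq2 with h' | h' <;> simp [h, h']) hr hr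
    (by push_cast at h4 ⊢; exact h4)
  have h6 : quadSym 𝔥 a ≠ 0 := by rcases hq1 with h | h <;> simp [h]
  exact (mul_right_cancel₀ h6 (by rw [one_mul]; exact h5)).symm

end Reciprocity

lemma isSquare_algebraMap_iff {k k' : Type*} [Field k] [Field k'] [Finite k] [Finite k']
    [Algebra k k'] {x : k} (hx : x ≠ 0) :
    IsSquare (algebraMap k k' x) ↔ IsSquare x ∨ Even (Module.finrank k k') := by
  have := Fintype.ofFinite k
  have := Fintype.ofFinite k'
  by_cases h2 : ringChar k = 2
  · have h := FiniteField.isSquare_of_char_two h2 x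
    exact ⟨fun _ => .inl h, fun _ => h.map _⟩
  have h2' : ringChar k' ≠ 2 := by
    rwa [← Algebra.ringChar_eq k k']
  have hx' : algebraMap k k' x ≠ 0 := by simpa using hx
  have hc : Fintype.card k' = Fintype.card k ^ Module.finrank k k' := Module.card_eq_pow_finrank
  set f := Module.finrank k k'
  have hq := FiniteField.odd_card_of_char_ne_two h2
  set q := Fintype.card k
  have hodd : Odd q := Nat.odd_iff.mpr hq
  have hpow : q ^ f / 2 = q / 2 * ∑ i ∈ Finset.range f, q ^ i := by
    have h1 := Nat.geomSum_eq (m := q) (by have := Fintype.one_lt_card (α := k); omega) f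
    have h3 := Nat.sub_one_dvd_pow_sub_one q f
    have h5 : q - 1 = 2 * (q / 2) := by omega
    have h6 : q ^ f % 2 = 1 := Nat.odd_iff.mp hodd.pow
    have h4 : (q - 1) * ∑ i ∈ Finset.range f, q ^ i = q ^ f - 1 := by
      rw [h1, Nat.mul_div_cancel' h3]
    rw [h5, mul_assoc] at h4
    omega
  have hpar : Odd (∑ i ∈ Finset.range f, q ^ i) ↔ Odd f := by
    rw [Finset.odd_sum_iff_odd_card_odd, Finset.filter_true_of_mem fun _ _ => hodd.pow]
    simp
  rw [FiniteField.isSquare_iff h2' hx', FiniteField.isSquare_iff h2 hx, hc, hpow, pow_mul,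
    ← map_pow, ← map_pow, map_eq_one_iff _ (algebraMap k k').injective]
  rcases FiniteField.pow_dichotomy h2 hx with h | h
  · simp [h, q]
  · have hne : (-1 : k) ≠ 1 := Ring.neg_one_ne_one_of_char_ne_two h2
    rw [h]
    simp only [hne, false_or]
    rw [← Nat.not_odd_iff_even, ← hpar]
    constructor
    · intro h' h''
      rw [h''.neg_one_pow] at h'
      exact hne h'
    · intro h'
      exact (Nat.not_odd_iff_even.mp h').neg_one_pow

section ExtendScalars

open UniqueFactorizationMonoid

variable {L M : Type*} [Field L] [NumberField L] [Field M] [NumberField M] [Algebra L M]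

lemma legSym_algebraMap {P : Ideal (𝓞 M)} (hP : P.IsPrime) (h0 : P ≠ ⊥) (b : 𝓞 L) :
    legSym P (algebraMap (𝓞 L) (𝓞 M) b) = quadSym (Ideal.relNorm (𝓞 L) P) b := by
  have : P.IsMaximal := hP.isMaximal h0
  set p := P.under (𝓞 L) with hp
  have hpP : P.LiesOver p := ⟨rfl⟩
  have hpm : p.IsMaximal := Ideal.isMaximal_comap_of_isIntegral_of_isMaximal P
  have hp0 : p ≠ ⊥ := fun h => h0 (Ideal.eq_bot_of_comap_eq_bot h)
  rw [Ideal.relNorm_eq_pow_of_isMaximal P p, Ideal.inertiaDeg_eq_of_isMaximal p P]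
  let := Ideal.Quotient.field p
  let := Ideal.Quotient.field P
  have := quotient_finite hp0
  have := quotient_finite h0
  have hk := isSquare_algebraMap_iff (k := 𝓞 L ⧸ p) (k' := 𝓞 M ⧸ P) (x := Ideal.Quotient.mk p b)
  have hmap : algebraMap (𝓞 L ⧸ p) (𝓞 M ⧸ P) (Ideal.Quotient.mk p b) =
    Ideal.Quotient.mk P (algebraMap (𝓞 L) (𝓞 M) b) := rfl
  rw [hmap] at hk
  have hz : Ideal.Quotient.mk P (algebraMap (𝓞 L) (𝓞 M) b) = 0 ↔ Ideal.Quotient.mk p b = 0 := by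
    rw [← hmap, map_eq_zero_iff _ (algebraMap (𝓞 L ⧸ p) (𝓞 M ⧸ P)).injective]
  have hpow : ∀ f, quadSym (p ^ f) b = legSym p b ^ f := by
    intro f
    induction f with
    | zero => rw [pow_zero, pow_zero, Ideal.one_eq_top, quadSym_top]
    | succ f ih =>
      rw [pow_succ, quadSym_ideal_mul (pow_ne_zero f hp0) hp0, ih, quadSym_prime hpm.isPrime hp0,
        pow_succ]
  have hf : 0 < Module.finrank (𝓞 L ⧸ p) (𝓞 M ⧸ P) := Module.finrank_pos
  rw [hpow]
  unfold legSym
  by_cases hb : Ideal.Quotient.mk p b = 0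
  · simp [hz.mpr hb, hb, hf.ne']
  have hk := hk hb
  rw [if_neg hb, if_neg (by rwa [hz])]
  by_cases hs : IsSquare (Ideal.Quotient.mk p b)
  · rw [if_pos (hk.mpr (.inl hs)), if_pos hs, one_pow]
  · simp only [hs, false_or] at hk
    rw [if_neg hs]
    by_cases he : Even (Module.finrank (𝓞 L ⧸ p) (𝓞 M ⧸ P))
    · rw [if_pos (hk.mpr he), he.neg_one_pow]
    · rw [if_neg (by rwa [hk]), (Nat.not_even_iff_odd.mp he).neg_one_pow]

lemma quadSym_algebraMap {I : Ideal (𝓞 M)} (h0 : I ≠ ⊥) (b : 𝓞 L) :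
    quadSym I (algebraMap (𝓞 L) (𝓞 M) b) = quadSym (Ideal.relNorm (𝓞 L) I) b := by
  induction I using UniqueFactorizationMonoid.induction_on_prime with
  | h₁ => exact absurd rfl h0
  | h₂ I hI =>
    rw [Ideal.isUnit_iff.mp hI, quadSym_top, Ideal.relNorm_top, quadSym_top]
  | h₃ I P hI hP ih =>
    have hP0 : P ≠ ⊥ := hP.ne_zero
    have hPp : P.IsPrime := (Ideal.prime_iff_isPrime hP0).mp hP
    rw [map_mul, quadSym_ideal_mul hP0 hI, ih hI, quadSym_prime hPp hP0,
      legSym_algebraMap hPp hP0, quadSym_ideal_mul (by rwa [Ne, Ideal.relNorm_eq_bot_iff])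
        (by rwa [Ne, Ideal.relNorm_eq_bot_iff])]

end ExtendScalars

section Quadratic

variable {L M : Type*} [Field L] [NumberField L] [Field M] [NumberField M] [Algebra L M]

/-- `s` generates the Galois group of the quadratic extension `M/L`. -/
structure IsQuadConj (s : M ≃ₐ[L] M) : Prop where
  ne_one : s ≠ 1
  invol : ∀ x, s (s x) = x
  fixed : ∀ x, s x = x → ∃ y : L, algebraMap L M y = x

/-- The action of an automorphism on the ring of integers. -/
abbrev intConj (s : M ≃ₐ[L] M) : 𝓞 M →+* 𝓞 M := RingOfIntegers.mapRingHom (s : M →+* M)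

lemma val_intConj (s : M ≃ₐ[L] M) (x : 𝓞 M) : ((intConj s x : 𝓞 M) : M) = s x := rfl

lemma val_algebraMap (x : 𝓞 L) : ((algebraMap (𝓞 L) (𝓞 M) x : 𝓞 M) : M) = algebraMap L M x := rfl

lemma algebraMap_ringOfIntegers_injective : Function.Injective (algebraMap (𝓞 L) (𝓞 M)) :=
  FaithfulSMul.algebraMap_injective _ _

namespace IsQuadConj

variable {s : M ≃ₐ[L] M}

lemma isGalois (h : IsQuadConj s) : IsGalois L M := by
  apply IsGalois.of_fixedField_eq_bot
  rw [eq_bot_iff]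
  intro x hx
  obtain ⟨y, rfl⟩ := h.fixed x (hx ⟨s, trivial⟩)
  exact IntermediateField.algebraMap_mem _ y

lemma univ_eq (h : IsQuadConj s) [Fintype (M ≃ₐ[L] M)] : (Finset.univ : Finset (M ≃ₐ[L] M)) = {1, s} := by
  have hz : Subgroup.zpowers s = ⊤ := by
    rw [← IntermediateField.fixingSubgroup_fixedField (Subgroup.zpowers s),
      ← IntermediateField.fixingSubgroup_bot]
    congr 1
    rw [eq_bot_iff]
    intro x hx
    obtain ⟨y, rfl⟩ := h.fixed x (hx ⟨s, Subgroup.mem_zpowers s⟩)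
    exact IntermediateField.algebraMap_mem _ y
  ext g
  have hg : g ∈ Subgroup.zpowers s := hz ▸ Subgroup.mem_top g
  have hs : s ^ 2 = 1 := by
    rw [pow_two]
    ext x
    exact h.invol x
  obtain ⟨k, rfl⟩ := hg
  simp only [Finset.mem_univ, Finset.mem_insert, Finset.mem_singleton, true_iff]
  have hs' : s ^ (2 : ℤ) = 1 := by exact_mod_cast hs
  rcases Int.even_or_odd' k with ⟨m, rfl | rfl⟩
  · left
    simp [zpow_mul, hs']
  · right
    simp [zpow_add, zpow_mul, hs']

lemma algebraMap_norm (h : IsQuadConj s) (x : M) : algebraMap L M (Algebra.norm L x) = x * s x := by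
  have := h.isGalois
  rw [Algebra.norm_eq_prod_automorphisms, h.univ_eq, Finset.prod_pair h.ne_one.symm]
  rfl

lemma algebraMap_trace (h : IsQuadConj s) (x : M) : algebraMap L M (Algebra.trace L M x) = x + s x := by
  have := h.isGalois
  rw [trace_eq_sum_automorphisms, h.univ_eq, Finset.sum_pair h.ne_one.symm]
  rfl

lemma finrank_eq (h : IsQuadConj s) : Module.finrank (𝓞 L) (𝓞 M) = 2 := by
  have := h.isGalois
  rw [← IsFractionRing.finrank_eq (𝓞 L) L (𝓞 M) M, ← IsGalois.card_aut_eq_finrank,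
    Nat.card_eq_fintype_card, ← Finset.card_univ, h.univ_eq, Finset.card_pair h.ne_one.symm]

lemma algebraMap_intNorm (h : IsQuadConj s) (x : 𝓞 M) :
    algebraMap (𝓞 L) (𝓞 M) (Algebra.intNorm (𝓞 L) (𝓞 M) x) = x * intConj s x := by
  apply RingOfIntegers.val_inj.mp
  rw [val_algebraMap, RingOfIntegers.val_mul, val_intConj, ← h.algebraMap_norm]
  congr 1
  exact Algebra.algebraMap_intNorm (A := 𝓞 L) (K := L) (L := M) (B := 𝓞 M) x

lemma exists_algebraMap_eq (h : IsQuadConj s) {x : 𝓞 M} (hx : intConj s x = x) :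
    ∃ y : 𝓞 L, algebraMap (𝓞 L) (𝓞 M) y = x := by
  obtain ⟨y, hy⟩ := h.fixed x (congrArg (fun z : 𝓞 M => (z : M)) hx)
  have hyi : IsIntegral ℤ y := by
    rw [← isIntegral_algebraMap_iff (algebraMap L M).injective, hy]
    exact x.isIntegral_coe
  exact ⟨⟨y, hyi⟩, RingOfIntegers.val_inj.mp hy⟩

lemma intConj_intConj (h : IsQuadConj s) (x : 𝓞 M) : intConj s (intConj s x) = x :=
  RingOfIntegers.val_inj.mp (h.invol x)

lemma intConj_algebraMap (x : 𝓞 L) :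
    intConj s (algebraMap (𝓞 L) (𝓞 M) x) = algebraMap (𝓞 L) (𝓞 M) x :=
  RingOfIntegers.val_inj.mp (s.commutes x)

lemma exists_intConj_eq_neg (h : IsQuadConj s) : ∃ g : 𝓞 M, g ≠ 0 ∧ intConj s g = -g := by
  by_contra! hc
  apply h.ne_one
  have key : ∀ x : 𝓞 M, intConj s x = x := by
    intro x
    by_contra hx
    refine hc (x - intConj s x) (sub_ne_zero.mpr (Ne.symm hx)) ?_
    rw [map_sub, h.intConj_intConj, neg_sub]
  ext x
  obtain ⟨a, b, hb, rfl⟩ := IsFractionRing.div_surjective (A := 𝓞 M) x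
  rw [map_div₀]
  have h1 := congrArg (fun z : 𝓞 M => (z : M)) (key a)
  have h2 := congrArg (fun z : 𝓞 M => (z : M)) (key b)
  exact congrArg₂ (· / ·) h1 h2

end IsQuadConj

end Quadratic

section Different

open nonZeroDivisors

variable {L M : Type*} [Field L] [NumberField L] [Field M] [NumberField M] [Algebra L M]
  {s : M ≃ₐ[L] M}

/-- The ideal generated by all `x - s x`. -/
def diffIdeal (s : M ≃ₐ[L] M) : Ideal (𝓞 M) :=
  Ideal.span (Set.range fun x : 𝓞 M => x - intConj s x)

/-- The ideal of all `g (x - s x)`, for an integer `g` with `s g = -g`. -/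
def IsQuadConj.antiIdeal (s : M ≃ₐ[L] M) (g : 𝓞 M) : Ideal (𝓞 L) where
  carrier := {m | ∃ x : 𝓞 M, algebraMap (𝓞 L) (𝓞 M) m = g * (x - intConj s x)}
  zero_mem' := ⟨0, by simp⟩
  add_mem' := by
    rintro a b ⟨x, hx⟩ ⟨y, hy⟩
    exact ⟨x + y, by rw [map_add, hx, hy, map_add]; ring⟩
  smul_mem' := by
    rintro c a ⟨x, hx⟩
    refine ⟨algebraMap (𝓞 L) (𝓞 M) c * x, ?_⟩
    rw [smul_eq_mul, map_mul, hx, map_mul, IsQuadConj.intConj_algebraMap]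
    ring

namespace IsQuadConj

lemma exists_antiIdeal (h : IsQuadConj s) {g : 𝓞 M} (hg : intConj s g = -g) (x : 𝓞 M) :
    ∃ m ∈ antiIdeal s g, algebraMap (𝓞 L) (𝓞 M) m = g * (x - intConj s x) := by
  obtain ⟨y, hy⟩ := h.exists_algebraMap_eq (x := g * (x - intConj s x)) (by
    rw [map_mul, map_sub, h.intConj_intConj, hg]
    ring)
  exact ⟨y, ⟨x, hy⟩, hy⟩

lemma span_mul_diffIdeal (h : IsQuadConj s) {g : 𝓞 M} (hg : intConj s g = -g) :
    Ideal.span {g} * diffIdeal s = (antiIdeal s g).map (algebraMap (𝓞 L) (𝓞 M)) := by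
  apply le_antisymm
  · rw [diffIdeal, Ideal.span_mul_span', Ideal.span_le]
    rintro _ ⟨_, rfl, _, ⟨x, rfl⟩, rfl⟩
    obtain ⟨m, hm, he⟩ := h.exists_antiIdeal hg x
    simp only [← he]
    exact Ideal.mem_map_of_mem _ hm
  · rw [Ideal.map_le_iff_le_comap]
    rintro m ⟨x, hx⟩
    rw [Ideal.mem_comap, hx]
    exact Ideal.mul_mem_mul (Ideal.mem_span_singleton_self g)
      (Ideal.subset_span ⟨x, rfl⟩)

lemma diffIdeal_ne_bot (h : IsQuadConj s) : diffIdeal s ≠ ⊥ := by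
  obtain ⟨g, hg0, hg⟩ := h.exists_intConj_eq_neg
  intro hb
  have h1 : g - intConj s g ∈ diffIdeal s := Ideal.subset_span ⟨g, rfl⟩
  rw [hb, Ideal.mem_bot, hg, sub_neg_eq_add, ← two_mul] at h1
  exact hg0 (by simpa using h1)

lemma trace_mem_of_mem_inv (h : IsQuadConj s) {y : M}
    (hy : ∀ x ∈ diffIdeal s, ∃ z : 𝓞 M, (z : M) = y * x) :
    ∃ t : 𝓞 L, algebraMap L M t = y + s y := by
  obtain ⟨g, hg0, hg⟩ := h.exists_intConj_eq_neg
  set 𝔪 := antiIdeal s g with h𝔪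
  have hm0 : 𝔪 ≠ ⊥ := by
    intro hb
    have := h.span_mul_diffIdeal hg
    rw [← h𝔪, hb, Ideal.map_bot, Ideal.mul_eq_bot] at this
    exact this.elim (by simpa using hg0) h.diffIdeal_ne_bot
  obtain ⟨c, hc, hc0⟩ := Submodule.exists_mem_ne_zero_of_ne_bot hm0
  obtain ⟨𝔫, hn⟩ := Ideal.dvd_iff_le.mpr ((Ideal.span_singleton_le_iff_mem 𝔪).mpr hc)
  have key : ∀ w ∈ 𝔪 * 𝔫, ∃ v ∈ 𝔪 * 𝔫,
      algebraMap L M (v : L) = algebraMap L M (w : L) * (y + s y) := by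
    intro w hw
    induction hw using Submodule.mul_induction_on' with
    | mem_mul_mem m hm n hn =>
      obtain ⟨x, hx⟩ := hm
      obtain ⟨z, hz⟩ := hy _ (Ideal.subset_span ⟨x, rfl⟩)
      obtain ⟨m', hm', he⟩ := h.exists_antiIdeal hg z
      refine ⟨m' * n, Ideal.mul_mem_mul hm' hn, ?_⟩
      have e1 := congrArg (fun z : 𝓞 M => (z : M)) hx
      have e2 := congrArg (fun z : 𝓞 M => (z : M)) he
      have e3 := congrArg (fun z : 𝓞 M => (z : M)) hg
      simp only [val_algebraMap, RingOfIntegers.val_mul, RingOfIntegers.val_sub, val_intConj,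
        RingOfIntegers.val_neg] at e1 e2 e3
      simp only [RingOfIntegers.val_sub, val_intConj] at hz
      have e5 := h.invol (x : M)
      rw [RingOfIntegers.val_mul, RingOfIntegers.val_mul, map_mul, map_mul, e1, e2, hz,
        map_mul s y, map_sub, e5]
      ring
    | add a ha b hb iha ihb =>
      obtain ⟨v, hv, e⟩ := iha
      obtain ⟨v', hv', e'⟩ := ihb
      refine ⟨v + v', add_mem hv hv', ?_⟩
      rw [RingOfIntegers.val_add, RingOfIntegers.val_add, map_add, map_add, e, e', add_mul]
  rw [← hn] at key
  obtain ⟨v, hv, e⟩ := key c (Ideal.mem_span_singleton_self c)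
  obtain ⟨u, rfl⟩ := Ideal.mem_span_singleton'.mp hv
  refine ⟨u, ?_⟩
  rw [RingOfIntegers.val_mul, map_mul, mul_comm] at e
  refine mul_left_cancel₀ ?_ e
  simpa using hc0

lemma differentIdeal_eq (h : IsQuadConj s) : differentIdeal (𝓞 L) (𝓞 M) = diffIdeal s := by
  have := h.isGalois
  apply le_antisymm
  · rw [differentialIdeal_le_iff (A := 𝓞 L) (K := L) (L := M) h.diffIdeal_ne_bot]
    rintro _ ⟨y, hy, rfl⟩
    have hy' : y ∈ ((diffIdeal s : FractionalIdeal (𝓞 M)⁰ M))⁻¹ := hy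
    rw [FractionalIdeal.mem_inv_iff (by simpa using h.diffIdeal_ne_bot)] at hy'
    obtain ⟨t, ht⟩ := h.trace_mem_of_mem_inv (y := y) (fun x hx => by
      have := hy' (x : M) (FractionalIdeal.mem_coeIdeal_of_mem _ hx)
      rw [FractionalIdeal.mem_one_iff] at this
      exact this)
    rw [← h.algebraMap_trace] at ht
    have ht := (algebraMap L M).injective ht
    rw [Submodule.mem_one]
    exact ⟨t, ht⟩
  · rw [diffIdeal, Ideal.span_le]
    rintro _ ⟨x, rfl⟩
    suffices H : ((x - intConj s x : 𝓞 M) : M) ∈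
        (differentIdeal (𝓞 L) (𝓞 M) : FractionalIdeal (𝓞 M)⁰ M) by
      obtain ⟨z, hz, e⟩ := (FractionalIdeal.mem_coeIdeal _).mp H
      change x - intConj s x ∈ _
      rwa [← RingOfIntegers.val_inj.mp e]
    rw [coeIdeal_differentIdeal (𝓞 L) L M (𝓞 M), FractionalIdeal.mem_inv_iff (by simp)]
    intro y hy
    rw [FractionalIdeal.mem_dual
      (one_ne_zero : (1 : FractionalIdeal (𝓞 M)⁰ M) ≠ 0)] at hy
    have hT : ∀ z : 𝓞 M, ∃ t : 𝓞 L, algebraMap L M t = y * z + s y * s z := by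
      intro z
      obtain ⟨t, ht⟩ := hy z ((FractionalIdeal.mem_one_iff _).mpr ⟨z, rfl⟩)
      refine ⟨t, ?_⟩
      rw [← map_mul, ← h.algebraMap_trace]
      exact congrArg _ ht
    obtain ⟨t1, h1⟩ := hT x
    obtain ⟨t2, h2⟩ := hT 1
    rw [FractionalIdeal.mem_one_iff]
    refine ⟨algebraMap (𝓞 L) (𝓞 M) t1 - intConj s x * algebraMap (𝓞 L) (𝓞 M) t2, ?_⟩
    change ((_ : 𝓞 M) : M) = _
    simp only [RingOfIntegers.val_sub, RingOfIntegers.val_mul, val_algebraMap, val_intConj, h1, h2,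
      map_one]
    ring

lemma span_mul_relDiscr (h : IsQuadConj s) {g : 𝓞 M} (hg : intConj s g = -g) {d : 𝓞 L}
    (hd : algebraMap (𝓞 L) (𝓞 M) d = g ^ 2) :
    Ideal.span {d} * relDiscr L M = antiIdeal s g ^ 2 := by
  have h1 := congrArg (Ideal.relNorm (𝓞 L)) (h.span_mul_diffIdeal hg)
  rw [map_mul, Ideal.relNorm_singleton, Ideal.relNorm_algebraMap, h.finrank_eq,
    ← h.differentIdeal_eq] at h1
  rw [← h1]
  congr 1
  have h2 : Algebra.intNorm (𝓞 L) (𝓞 M) g = -d := by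
    apply algebraMap_ringOfIntegers_injective (M := M)
    rw [h.algebraMap_intNorm, hg, map_neg, hd]
    ring
  rw [h2, Ideal.span_singleton_neg]

lemma intNorm_mem_relDiscr (h : IsQuadConj s) {x : 𝓞 M} {n : 𝓞 L}
    (hn : algebraMap (𝓞 L) (𝓞 M) n = (x - intConj s x) ^ 2) : n ∈ relDiscr L M := by
  have h1 : Algebra.intNorm (𝓞 L) (𝓞 M) (x - intConj s x) ∈ relDiscr L M :=
    Ideal.subset_span ⟨_, by
      rw [h.differentIdeal_eq]
      exact Ideal.subset_span ⟨x, rfl⟩, rfl⟩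
  have h2 : Algebra.intNorm (𝓞 L) (𝓞 M) (x - intConj s x) = -n := by
    apply algebraMap_ringOfIntegers_injective (M := M)
    rw [h.algebraMap_intNorm, map_neg, hn, map_sub, h.intConj_intConj]
    ring
  rw [h2] at h1
  simpa using neg_mem h1

end IsQuadConj

end Different

section Relative

variable {L M : Type*} [Field L] [NumberField L] [Field M] [NumberField M] [Algebra L M]

lemma exists_realEmbedding_extension (hM : ∀ φ : M →+* ℂ, ComplexEmbedding.IsReal φ)
    (v : L →+* ℝ) : ∃ w : M →+* ℝ, ∀ x, w (algebraMap L M x) = v x := by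
  refine ⟨(hM (ComplexEmbedding.lift M (Complex.ofRealHom.comp v))).embedding, fun x => ?_⟩
  apply Complex.ofReal_injective
  rw [ComplexEmbedding.IsReal.coe_embedding_apply, ComplexEmbedding.lift_algebraMap_apply]
  rfl

lemma isReal_of_extension (hM : ∀ φ : M →+* ℂ, ComplexEmbedding.IsReal φ) (φ : L →+* ℂ) :
    ComplexEmbedding.IsReal φ := by
  have h := hM (ComplexEmbedding.lift M φ)
  rw [ComplexEmbedding.isReal_iff] at h ⊢
  ext x
  have := RingHom.congr_fun h (algebraMap L M x)
  rw [ComplexEmbedding.conjugate_coe_eq] at this ⊢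
  rwa [ComplexEmbedding.lift_algebraMap_apply] at this

lemma TPos.of_algebraMap (hM : ∀ φ : M →+* ℂ, ComplexEmbedding.IsReal φ) {t : L}
    (ht : TPos (algebraMap L M t)) : TPos t := fun v => by
  obtain ⟨w, hw⟩ := exists_realEmbedding_extension hM v
  rw [← hw]
  exact ht w

lemma TPos.add {s t : M} (hs : TPos s) (ht : TPos t) : TPos (s + t) := fun v => by
  rw [map_add]
  exact add_pos (hs v) (ht v)

lemma TPos.map {t : M} (ht : TPos t) (f : M →+* M) : TPos (f t) := fun v => ht (v.comp f)

lemma isCoprime_span_of_isUnit (𝔟 : Ideal (𝓞 M)) {x : 𝓞 M} (hx : IsUnit x) :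
    IsCoprime 𝔟 (Ideal.span {x}) := by
  rw [Ideal.span_singleton_eq_top.mpr hx, ← Ideal.one_eq_top]
  exact isCoprime_one_right

namespace IsQuadConj

variable {s : M ≃ₐ[L] M}

lemma quadSym_relDiscr (h : IsQuadConj s) (hM : ∀ φ : M →+* ℂ, ComplexEmbedding.IsReal φ)
    {g : 𝓞 M} (hg0 : g ≠ 0) (hg : intConj s g = -g) {d b : 𝓞 L}
    (hd : algebraMap (𝓞 L) (𝓞 M) d = g ^ 2) (hb : TPos (b : L)) (hb1 : b - 1 ∈ Ideal.span {4})
    (hdb : IsCoprime (Ideal.span {d}) (Ideal.span {b}))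
    (hD : IsCoprime (relDiscr L M) (Ideal.span {2}))
    (hDb : IsCoprime (relDiscr L M) (Ideal.span {b})) :
    quadSym (relDiscr L M) b = quadSym (Ideal.span {b}) d := by
  have hL := fun φ : L →+* ℂ => isReal_of_extension hM φ
  have hb0 : b ≠ 0 := by have := hb.ne_zero hL; exact_mod_cast this
  have hd0 : d ≠ 0 := by
    rintro rfl
    rw [map_zero] at hd
    exact hg0 (pow_eq_zero_iff two_ne_zero |>.mp hd.symm)
  have hD0 : relDiscr L M ≠ ⊥ := by
    rw [show relDiscr L M = Ideal.relNorm (𝓞 L) (differentIdeal (𝓞 L) (𝓞 M)) from rfl, Ne,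
      Ideal.relNorm_eq_bot_iff, h.differentIdeal_eq]
    exact h.diffIdeal_ne_bot
  have hdD := h.span_mul_relDiscr hg hd
  have hm0 : antiIdeal s g ≠ ⊥ := by
    intro hm
    rw [hm, Ideal.bot_pow two_ne_zero, Ideal.mul_eq_bot] at hdD
    exact hdD.elim (by simpa using hd0) hD0
  obtain ⟨r, 𝔥, hr, hrh, hcop⟩ := exists_tpos_span_eq_mul hm0 (𝔫 := Ideal.span {2 * b}) (by
    rw [Ne, Ideal.span_singleton_eq_bot]
    exact mul_ne_zero two_ne_zero hb0)
  have hhb := hcop.span_of_dvd (Dvd.intro_left _ rfl : b ∣ 2 * b)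
  have hh2 := hcop.span_of_dvd (Dvd.intro _ rfl : (2 : 𝓞 L) ∣ 2 * b)
  have hr0 : r ≠ 0 := by have := hr.ne_zero hL; exact_mod_cast this
  have hh0 : 𝔥 ≠ ⊥ := by
    rintro rfl
    rw [Ideal.mul_bot, Ideal.span_singleton_eq_bot] at hrh
    exact hr0 hrh
  have hr2 : Ideal.span {r ^ 2} = Ideal.span {d} * (relDiscr L M * (𝔥 * 𝔥)) := by
    rw [← Ideal.span_singleton_pow, hrh, mul_pow, ← hdD]
    ring
  obtain ⟨e, he⟩ : d ∣ r ^ 2 := by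
    rw [← Ideal.span_singleton_le_span_singleton, hr2]
    exact Ideal.mul_le_left
  have hee : Ideal.span {e} = relDiscr L M * (𝔥 * 𝔥) := by
    rw [he, ← Ideal.span_singleton_mul_span_singleton] at hr2
    exact mul_left_cancel₀ (by simpa using hd0 : Ideal.span {d} ≠ 0) hr2
  have hdpos : TPos (d : L) := by
    apply TPos.of_algebraMap hM
    rw [← val_algebraMap, hd, RingOfIntegers.val_pow]
    exact tpos_sq (by exact_mod_cast hg0)
  have hepos : TPos (e : L) := by
    have h1 : (e : L) = r ^ 2 / d := by
      rw [eq_div_iff (hdpos.ne_zero hL), ← RingOfIntegers.val_pow, he, RingOfIntegers.val_mul,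
        mul_comm]
    rw [h1]
    exact (tpos_sq (hr.ne_zero hL)).div hdpos
  have he2 : IsCoprime (Ideal.span {e}) (Ideal.span {2}) := by
    rw [hee]
    exact hD.mul_left (hh2.mul_left hh2)
  have heb : IsCoprime (Ideal.span {e}) (Ideal.span {b}) := by
    rw [hee]
    exact hDb.mul_left (hhb.mul_left hhb)
  have h1 := quadSym_reciprocity hL hb hepos hb1 he2 heb
  rw [hee, quadSym_ideal_mul hD0 (mul_ne_zero hh0 hh0), quadSym_ideal_mul hh0 hh0,
    quadSym_mul_self hhb, mul_one] at h1
  have hrb : IsCoprime (Ideal.span {b}) (Ideal.span {r}) := by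
    refine IsCoprime.span_of_dvd (y := r ^ 2) ?_ (dvd_pow_self r two_ne_zero)
    rw [he, ← Ideal.span_singleton_mul_span_singleton]
    exact hdb.symm.mul_right heb.symm
  have h2 := quadSym_sq hrb
  rw [he, quadSym_mul] at h2
  rw [← h1]
  rcases quadSym_eq_one_or hdb.symm with h3 | h3 <;> rcases quadSym_eq_one_or heb.symm with h4 | h4
  all_goals
    rw [h3, h4] at h2 ⊢
    try norm_num at h2

theorem quadSym_conj (h : IsQuadConj s) (hM : ∀ φ : M →+* ℂ, ComplexEmbedding.IsReal φ)
    {a : 𝓞 M} (ha : TPos (a : M)) (ha1 : a - 1 ∈ Ideal.span {8})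
    (hcop : IsCoprime (Ideal.span {a}) (Ideal.span {intConj s a}))
    (hD : IsCoprime (relDiscr L M) (Ideal.span {2})) {b : 𝓞 L}
    (hb : algebraMap (𝓞 L) (𝓞 M) b + algebraMap (𝓞 L) (𝓞 M) b = a + intConj s a) :
    quadSym (Ideal.span {intConj s a}) a = quadSym (relDiscr L M) b := by
  have hL := fun φ : L →+* ℂ => isReal_of_extension hM φ
  have hinj := algebraMap_ringOfIntegers_injective (L := L) (M := M)
  obtain ⟨x, hx⟩ := Ideal.mem_span_singleton'.mp ha1
  obtain rfl : a = 1 + 8 * x := by linear_combination -hx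
  have hsa : intConj s (1 + 8 * x) = 1 + 8 * intConj s x := by
    rw [map_add, map_mul, map_one, map_ofNat]
  obtain ⟨t, ht⟩ := h.exists_algebraMap_eq (x := x + intConj s x) (by
    rw [map_add, h.intConj_intConj, add_comm])
  obtain ⟨n, hn⟩ := h.exists_algebraMap_eq (x := x * intConj s x) (by
    rw [map_mul, h.intConj_intConj, mul_comm])
  obtain rfl : b = 1 + 4 * t := by
    apply hinj
    rw [hsa] at hb
    rw [map_add, map_mul, map_one, map_ofNat, ht]
    have h2 : (2 : 𝓞 M) ≠ 0 := two_ne_zero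
    refine mul_left_cancel₀ h2 ?_
    linear_combination hb
  set b := 1 + 4 * t with hbdef
  set a := 1 + 8 * x with hadef
  set N : 𝓞 L := 1 + 8 * (t + 8 * n) with hN
  have hNa : algebraMap (𝓞 L) (𝓞 M) N = a * intConj s a := by
    rw [hN, hsa, hadef]
    simp only [map_add, map_mul, map_one, map_ofNat, ht, hn]
    ring
  have hapos' : TPos (intConj s a : M) := ha.map (s : M →+* M)
  have hNpos : TPos (N : L) := by
    apply TPos.of_algebraMap hM
    rw [← val_algebraMap, hNa, RingOfIntegers.val_mul]
    exact ha.mul hapos'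
  have hbpos : TPos (b : L) := by
    apply TPos.of_algebraMap hM
    rw [← val_algebraMap]
    intro v
    have h1 := (ha.add hapos') v
    rw [← RingOfIntegers.val_add, ← hb, RingOfIntegers.val_add, map_add] at h1
    linarith
  have hb1 : b - 1 ∈ Ideal.span {4} := Ideal.mem_span_singleton'.mpr ⟨t, by rw [hbdef]; ring⟩
  have hN1 : N - 1 ∈ Ideal.span {8} :=
    Ideal.mem_span_singleton'.mpr ⟨t + 8 * n, by rw [hN]; ring⟩
  have hN2 : IsCoprime (Ideal.span {N}) (Ideal.span {2}) :=
    (isCoprime_of_sub_one_mem hN1).span_of_dvd ⟨4, by norm_num⟩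
  set g := 4 * (x - intConj s x) with hg
  have hgs : intConj s g = -g := by
    rw [hg, map_mul, map_sub, h.intConj_intConj, map_ofNat]
    ring
  have hd : algebraMap (𝓞 L) (𝓞 M) (b ^ 2 - N) = g ^ 2 := by
    rw [map_sub, hNa, hsa, hadef, map_pow, hbdef, hg]
    simp only [map_add, map_mul, map_one, map_ofNat, ht]
    ring
  have hag : a - intConj s a = 2 * g := by
    rw [hsa, hadef, hg]
    ring
  clear_value a b N g
  have hNb' : IsCoprime N b := by
    rw [Ideal.isCoprime_span_singleton_iff] at hcop
    have h1 : IsCoprime (algebraMap (𝓞 L) (𝓞 M) N) (algebraMap (𝓞 L) (𝓞 M) b) := by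
      obtain ⟨p, q, hpq⟩ := hcop
      have h2 : IsCoprime (a * intConj s a) (a + intConj s a) :=
        IsCoprime.mul_left ⟨p - q, q, by linear_combination hpq⟩
          ⟨q - p, p, by linear_combination hpq⟩
      rw [hNa]
      rw [← hb, ← two_mul] at h2
      exact h2.of_mul_right_right
    obtain ⟨u, v, huv⟩ := h1
    obtain ⟨p, hp⟩ := h.exists_algebraMap_eq (x := u * intConj s u) (by
      rw [map_mul, h.intConj_intConj, mul_comm])
    obtain ⟨q, hq⟩ := h.exists_algebraMap_eq (x := v * intConj s v) (by
      rw [map_mul, h.intConj_intConj, mul_comm])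
    obtain ⟨r, hr⟩ := h.exists_algebraMap_eq (x := u * intConj s v + v * intConj s u) (by
      rw [map_add, map_mul, map_mul, h.intConj_intConj, h.intConj_intConj]
      ring)
    refine ⟨p * N + r * b, q * b, hinj ?_⟩
    have huv' := congrArg (intConj s) huv
    simp only [map_add, map_mul, map_one, intConj_algebraMap] at huv' ⊢
    rw [hp, hq, hr]
    linear_combination (intConj s u * algebraMap (𝓞 L) (𝓞 M) N +
      intConj s v * algebraMap (𝓞 L) (𝓞 M) b) * huv + huv'
  have hNb : IsCoprime (Ideal.span {N}) (Ideal.span {b}) := (Ideal.isCoprime_span_singleton_iff _ _).mpr hNb'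
  have hdb' : IsCoprime (b ^ 2 - N) b := by
    have h1 := (hNb'.neg_left).add_mul_left_left b
    rwa [show -N + b * b = b ^ 2 - N by ring] at h1
  have hdb := (Ideal.isCoprime_span_singleton_iff _ _).mpr hdb'
  have hb2 : IsCoprime (Ideal.span {b}) (Ideal.span {2}) :=
    (isCoprime_of_sub_one_mem hb1).span_of_dvd ⟨2, by norm_num⟩
  have key : quadSym (relDiscr L M) b = quadSym (Ideal.span {b}) (b ^ 2 - N) := by
    by_cases hg0 : g = 0
    · rw [hg0] at hd
      have hd0 : b ^ 2 - N = 0 := by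
        apply hinj
        rw [hd, map_zero]
        ring
      rw [hd0, isCoprime_zero_left] at hdb'
      obtain ⟨g', hg0', hgs'⟩ := h.exists_intConj_eq_neg
      obtain ⟨d', hd'⟩ := h.exists_algebraMap_eq (x := g' ^ 2) (by
        rw [map_pow, hgs']
        ring)
      rw [h.quadSym_relDiscr hM hg0' hgs' hd' hbpos hb1 (isCoprime_span_of_isUnit _ hdb') hD
        (isCoprime_span_of_isUnit _ hdb'), Ideal.span_singleton_eq_top.mpr hdb', quadSym_top,
        quadSym_top]
    · refine h.quadSym_relDiscr hM hg0 hgs hd hbpos hb1 hdb hD ?_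
      have h1 : 4 * (b ^ 2 - N) ∈ relDiscr L M := h.intNorm_mem_relDiscr (x := a) (by
        rw [map_mul, hd, map_ofNat, hag]
        ring)
      have h2 : IsCoprime (Ideal.span {4 * (b ^ 2 - N)}) (Ideal.span {b}) := by
        rw [← Ideal.span_singleton_mul_span_singleton]
        refine IsCoprime.mul_left ?_ hdb
        rw [show (4 : 𝓞 L) = 2 * 2 by norm_num, ← Ideal.span_singleton_mul_span_singleton]
        exact hb2.symm.mul_left hb2.symm
      rw [Ideal.isCoprime_iff_sup_eq, eq_top_iff] at h2 ⊢
      exact h2.trans (sup_le_sup_right ((Ideal.span_singleton_le_iff_mem _).mpr h1) _)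
  have hNorm : Algebra.intNorm (𝓞 L) (𝓞 M) (intConj s a) = N := by
    apply hinj
    rw [h.algebraMap_intNorm, h.intConj_intConj, hNa, mul_comm]
  have hsa0 : intConj s a ≠ 0 := by
    have := hapos'.ne_zero hM
    exact_mod_cast this
  calc quadSym (Ideal.span {intConj s a}) a
      = quadSym (Ideal.span {intConj s a}) (algebraMap (𝓞 L) (𝓞 M) (2 * b)) := by
        apply quadSym_congr
        have h2 : algebraMap (𝓞 L) (𝓞 M) (2 * b) = a + intConj s a := by
          rw [two_mul, ← hb]
          exact map_add _ _ _
        rw [h2]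
        exact Ideal.mem_span_singleton'.mpr ⟨-1, by ring⟩
    _ = quadSym (Ideal.span {N}) (2 * b) := by
        rw [quadSym_algebraMap (by simpa using hsa0), Ideal.relNorm_singleton, hNorm]
    _ = quadSym (Ideal.span {N}) b := by
        rw [quadSym_mul, quadSym_two hL hNpos hN1, one_mul]
    _ = quadSym (Ideal.span {b}) N := (quadSym_reciprocity hL hbpos hNpos hb1 hN2 hNb).symm
    _ = quadSym (Ideal.span {b}) (-1 * (b ^ 2 - N)) := by
        apply quadSym_congr
        exact Ideal.mem_span_singleton'.mpr ⟨b, by ring⟩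
    _ = quadSym (relDiscr L M) b := by
        rw [quadSym_mul, quadSym_neg_one hL hbpos hb1, one_mul, key]

end IsQuadConj

end Relative

/-- **Proposition 10.1** (Friedlander–Iwaniec–Mazur–Rubin, "The spin of prime ideals").
Let `K/ℚ` be totally real Galois of even degree `n ≥ 2` with all totally positive units
squares, let `σ` be an involution in the Galois group with fixed field `L`, and assume the
relative discriminant `𝔇` of `K/L` is odd.  If `α ∈ 𝓞 K` is totally positive,
`α ≡ 1 (mod 8)`, and `((α), (σα)) = 1`, then with `β = (α + σα)/2 ∈ 𝓞 L` one has
`spin(σ, (α)) = (β/𝔇)_L`. -/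
theorem spins_of_prime_ideals_stmt7
    (n : ℕ) (hn : 2 ≤ n) (hneven : Even n)
    (K : Type*) [Field K] [NumberField K] [IsGalois ℚ K]
    (hdeg : Module.finrank ℚ K = n)
    (htotreal : ∀ φ : K →+* ℂ, ComplexEmbedding.IsReal φ)
    (hunits : ∀ u : (𝓞 K)ˣ, TotPos (u : 𝓞 K) → ∃ w : (𝓞 K)ˣ, u = w ^ 2)
    (σ : K ≃ₐ[ℚ] K) (hσinv : σ * σ = 1) (hσne : σ ≠ 1)
    (L : Type*) [Field L] [NumberField L] [Algebra L K]
    (hfix : ∀ x : K, σ x = x ↔ ∃ y : L, algebraMap L K y = x)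
    (h𝔇odd : IsCoprime (relDiscr L K) (Ideal.span {(2 : 𝓞 L)}))
    (α : 𝓞 K) (hαpos : TotPos α)
    (hα1 : α - 1 ∈ Ideal.span {(8 : 𝓞 K)})
    (hcop : IsCoprime (Ideal.span {α})
      (Ideal.span {RingOfIntegers.mapRingHom (σ : K →+* K) α})) :
    (∃ β : 𝓞 L, algebraMap (𝓞 L) (𝓞 K) β + algebraMap (𝓞 L) (𝓞 K) β =
        α + RingOfIntegers.mapRingHom (σ : K →+* K) α) ∧
    ∀ β : 𝓞 L, algebraMap (𝓞 L) (𝓞 K) β + algebraMap (𝓞 L) (𝓞 K) β =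
        α + RingOfIntegers.mapRingHom (σ : K →+* K) α →
      spin σ (Ideal.span {α}) = quadSym (relDiscr L K) β := by
  have hext : ∀ x : K, σ (σ x) = x := fun x => by
    rw [← AlgEquiv.mul_apply, hσinv, AlgEquiv.one_apply]
  let s : K ≃ₐ[L] K :=
    AlgEquiv.ofRingEquiv (f := (σ : K ≃+* K)) fun y => (hfix _).mpr ⟨y, rfl⟩
  have h : IsQuadConj s :=
    { ne_one := fun hs => hσne (AlgEquiv.ext fun x => AlgEquiv.congr_fun hs x)
      invol := hext
      fixed := fun x hx => (hfix x).mp hx }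
  have hs : RingOfIntegers.mapRingHom (σ : K →+* K) = intConj s := rfl
  refine ⟨?_, fun β hβ => ?_⟩
  · obtain ⟨x, hx⟩ := Ideal.mem_span_singleton'.mp hα1
    obtain ⟨t, ht⟩ := h.exists_algebraMap_eq (x := x + intConj s x) (by
      rw [map_add, h.intConj_intConj, add_comm])
    refine ⟨1 + 4 * t, ?_⟩
    rw [hs, show α = 1 + 8 * x by linear_combination -hx]
    simp only [map_add, map_mul, map_one, map_ofNat, ht]
    ring
  · have hex : ∃ α' : 𝓞 K, Ideal.span {α'} = Ideal.span {α} ∧ TotPos α' := ⟨α, rfl, hαpos⟩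
    rw [spin, dif_pos hex]
    obtain ⟨hspan, hpos⟩ := hex.choose_spec
    set α' := hex.choose
    obtain ⟨u, hu⟩ := Ideal.span_singleton_eq_span_singleton.mp hspan.symm
    have hupos : TotPos (u : 𝓞 K) := fun v => by
      have h1 := hpos v
      rw [← hu, RingOfIntegers.val_mul, map_mul] at h1
      exact (pos_iff_pos_of_mul_pos h1).mp (hαpos v)
    obtain ⟨w, rfl⟩ := hunits u hupos
    rw [galMap, Ideal.map_span, Set.image_singleton, ← hu, Units.val_pow_eq_pow_val, quadSym_mul,
      quadSym_sq (isCoprime_span_of_isUnit _ w.isUnit), mul_one, hs]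
    rw [hs] at hcop hβ
    exact h.quadSym_conj htotreal hαpos hα1 hcop h𝔇odd hβ

end
end

section
/- Let L be a number field with ring of integers 𝓞_L, let 𝔭 be a prime ideal of 𝓞_L dividing 2𝓞_L, and let L_𝔭 denote the 𝔭-adic completion of L. Suppose β, δ ∈ 𝓞_L satisfy β ≡ 1 (mod 4𝓞_L) and δ is odd (coprime to 2𝓞_L). Then the quadratic form βx² + δy² − z² represents zero nontrivially over L_𝔭: there exist (x, y, z) ∈ L_𝔭³ with (x,y,z) ≠ (0,0,0) and βx² + δy² = z². Equivalently, the Hilbert symbol (β, δ / 𝔭) equals 1. -/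
set_option synthInstance.maxHeartbeats 1000000
set_option maxHeartbeats 2000000

open NumberField IsDedekindDomain

open Metric in
/-- In a complete nonarchimedean field, the Artin–Schreier type equation `w² + w = c` is solvable
whenever `‖c‖ < 1`. -/
lemma exists_sq_add_self_eq_of_norm_lt_one {K : Type*} [NormedField K] [IsUltrametricDist K]
    [CompleteSpace K] {c : K} (hc : ‖c‖ < 1) : ∃ w : K, w ^ 2 + w = c := by
  have hmaps : Set.MapsTo (fun w : K ↦ c - w ^ 2) (closedBall 0 ‖c‖) (closedBall 0 ‖c‖) := by
    intro w hw
    rw [mem_closedBall_zero_iff] at hw ⊢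
    change ‖c - w ^ 2‖ ≤ ‖c‖
    rw [sub_eq_add_neg]
    refine (IsUltrametricDist.norm_add_le_max _ _).trans (max_le le_rfl ?_)
    rw [norm_neg, norm_pow, sq]
    exact (mul_le_of_le_one_left (norm_nonneg w) (hw.trans hc.le)).trans hw
  have hcontr : ContractingWith ‖c‖₊ (hmaps.restrict _ (closedBall 0 ‖c‖) (closedBall 0 ‖c‖)) := by
    refine ⟨by exact_mod_cast hc, LipschitzWith.of_dist_le_mul ?_⟩
    rintro ⟨x, hx⟩ ⟨y, hy⟩
    rw [mem_closedBall_zero_iff] at hx hy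
    simp only [Subtype.dist_eq, Set.MapsTo.val_restrict_apply, dist_eq_norm, coe_nnnorm]
    rw [show c - x ^ 2 - (c - y ^ 2) = -((x + y) * (x - y)) by ring, norm_neg, norm_mul]
    gcongr
    exact (IsUltrametricDist.norm_add_le_max _ _).trans (max_le hx hy)
  obtain ⟨w, -, hw, -⟩ := hcontr.exists_fixedPoint' isClosed_closedBall.isComplete hmaps
    (mem_closedBall_self (norm_nonneg c)) (edist_ne_top _ _)
  refine ⟨w, ?_⟩
  have hw' : c - w ^ 2 = w := hw
  linear_combination -hw'

/-- Modulo a maximal ideal above `2` with finite residue field, `b + d * u ^ 2` has a zero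
`u` whenever `d` is a unit there. -/
lemma exists_mul_sq_add_mem {R : Type*} [CommRing R] {P : Ideal R} [P.IsMaximal] [Finite (R ⧸ P)]
    (h2 : (2 : R) ∈ P) {d : R} (hd : d ∉ P) (b : R) : ∃ u : R, b + d * u ^ 2 ∈ P := by
  let _ : Field (R ⧸ P) := Ideal.Quotient.field P
  have h2' : (2 : R ⧸ P) = 0 := by
    rw [← map_ofNat (Ideal.Quotient.mk P) 2]
    exact Ideal.Quotient.eq_zero_iff_mem.mpr h2
  have hchar : ringChar (R ⧸ P) = 2 := by
    have := CharTwo.of_one_ne_zero_of_two_eq_zero (one_ne_zero (α := R ⧸ P)) h2'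
    exact ringChar.eq_iff.mpr this
  have hd' : Ideal.Quotient.mk P d ≠ 0 := fun h ↦ hd (Ideal.Quotient.eq_zero_iff_mem.mp h)
  obtain ⟨r, hr⟩ := FiniteField.isSquare_of_char_two hchar
    (-Ideal.Quotient.mk P b / Ideal.Quotient.mk P d)
  obtain ⟨u, rfl⟩ := Ideal.Quotient.mk_surjective r
  refine ⟨u, Ideal.Quotient.eq_zero_iff_mem.mp ?_⟩
  rw [map_add, map_mul, map_pow, sq, ← hr, mul_div_cancel₀ _ hd', add_neg_cancel]

/-- **Lemma 10.5** (Friedlander–Iwaniec–Mazur–Rubin, "The spin of prime ideals").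
Let `L` be a number field, `𝔭` a prime of `𝓞 L` above `2`, and `L_𝔭` the `𝔭`-adic
completion.  If `β ≡ 1 (mod 4)` and `δ` is odd, then `β x² + δ y² − z²` represents zero
nontrivially over `L_𝔭`; i.e. the Hilbert symbol `(β, δ / 𝔭)` equals `1`. -/
theorem spins_of_prime_ideals_stmt10
    (L : Type*) [Field L] [NumberField L]
    (v : HeightOneSpectrum (𝓞 L)) (hv : (2 : 𝓞 L) ∈ v.asIdeal)
    (β δ : 𝓞 L)
    (hβ : β - 1 ∈ Ideal.span {(4 : 𝓞 L)})
    (hδ : IsCoprime (Ideal.span {δ}) (Ideal.span {(2 : 𝓞 L)})) :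
    ∃ x y z : v.adicCompletion L, ¬(x = 0 ∧ y = 0 ∧ z = 0) ∧
      algebraMap L (v.adicCompletion L) (β : L) * x ^ 2 +
        algebraMap L (v.adicCompletion L) (δ : L) * y ^ 2 = z ^ 2 := by
  obtain ⟨b, hb⟩ := Ideal.mem_span_singleton'.mp hβ
  have hδv : δ ∉ v.asIdeal := by
    intro h
    refine v.isPrime.ne_top (top_le_iff.mp ?_)
    rw [← Ideal.isCoprime_iff_sup_eq.mp hδ]
    exact sup_le ((Ideal.span_singleton_le_iff_mem _).mpr h)
      ((Ideal.span_singleton_le_iff_mem _).mpr hv)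
  have := v.isMaximal
  have := v.asIdeal.finiteQuotientOfFreeOfNeBot v.ne_bot
  obtain ⟨u, hu⟩ := exists_mul_sq_add_mem hv hδv b
  let φ : 𝓞 L →+* v.adicCompletion L :=
    (algebraMap L (v.adicCompletion L)).comp (algebraMap (𝓞 L) L)
  have hnorm : ‖φ (b + δ * u ^ 2)‖ < 1 := (FinitePlace.norm_lt_one_iff_mem L v _).mpr hu
  obtain ⟨w, hw⟩ := exists_sq_add_self_eq_of_norm_lt_one hnorm
  refine ⟨1, 2 * φ u, 1 + 2 * w, by simp, ?_⟩
  have hβ' : φ β = 1 + 4 * φ b := by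
    rw [show β = 1 + 4 * b by linear_combination -hb]
    simp only [map_add, map_mul, map_one, map_ofNat]
  change φ β * 1 ^ 2 + φ δ * (2 * φ u) ^ 2 = (1 + 2 * w) ^ 2
  simp only [map_add, map_mul, map_pow] at hw
  rw [hβ']
  linear_combination -4 * hw
end
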